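/- Assume ψ = ψ_c + δψ with ψ_c'' ≥ λ₀ > 0 and |δψ| + |δψ'| ≤ B, and let L > 0. Then there exists C₀ > 0 depending only on ψ and L such that for every K ∈ ℕ, every m ∈ ℝ, every a ∈ ℝ^K with max_i |a_i| ≤ L, and every smooth f ≥ 0 on X_{K,m} with ∫ f dμ_{K,a,m} = 1, one has |cov_{μ_{K,a,m}}(f, (1/K)∑_{i=1}^K ψ'(x_i))|² ≤ C₀ K ∫ |∇f|²/f dμ_{K,a,m}, where ∇f is the tangential gradient of f along the hyperplane X_{K,m}. -/

import Mathlib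

open MeasureTheory ENNReal Real

noncomputable section

/-- The canonical ensemble `μ_{K,a,m}` on the hyperplane `X_{K,m}`, with density
`Z⁻¹ exp(-∑ (ψ(xᵢ) + aᵢxᵢ))` with respect to `(K-1)`-dimensional Hausdorff measure. -/
def canonEns (ψ : ℝ → ℝ) (N : ℕ) (a : Fin N → ℝ) (m : ℝ) :
    Measure (EuclideanSpace ℝ (Fin N)) :=
  let ν : Measure (EuclideanSpace ℝ (Fin N)) :=
    ((μH[(N : ℝ) - 1]).restrict {x : EuclideanSpace ℝ (Fin N) | ∑ i, x i = (N : ℝ) * m}).withDensity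
      fun x => ENNReal.ofReal (Real.exp (-(∑ i, (ψ (x i) + a i * x i))))
  (ν Set.univ)⁻¹ • ν

/-- Covariance of two real functions with respect to a measure. -/
def covFn {X : Type*} [MeasurableSpace X] (μ : Measure X) (f g : X → ℝ) : ℝ :=
  (∫ x, f x * g x ∂μ) - (∫ x, f x ∂μ) * (∫ x, g x ∂μ)

/-- `|∇f|²/f` where `∇f` is the tangential gradient along `X_{N,m}`, i.e. the projection of
the Euclidean gradient onto `{v : ∑ vᵢ = 0}`; interpreted as `0` where `f = 0`. -/
def fisherX (N : ℕ) (f : EuclideanSpace ℝ (Fin N) → ℝ) (x : EuclideanSpace ℝ (Fin N)) : ℝ :=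
  if f x = 0 then 0
  else (∑ i, (gradient f x i - (∑ j, gradient f x j) / (N : ℝ)) ^ 2) / f x

/-- Positive, continuous, integrable and bounded functions. -/
structure Nice (g : ℝ → ℝ) : Prop where
  pos : ∀ x, 0 < g x
  cont : Continuous g
  int : Integrable g
  bdd : ∃ M, ∀ x, g x ≤ M

/-- Log-concavity, phrased as a rearrangement inequality. -/
def LC (g : ℝ → ℝ) : Prop :=
  ∀ a b t, a ≤ b → 0 ≤ t → g a * g (b + t) ≤ g (a + t) * g b

/-- Convolution of two functions on the line. -/
def cv (p q : ℝ → ℝ) (s : ℝ) : ℝ := ∫ r, p r * q (s - r)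

/-- `p` is a product density whose conditional laws given the sum of the coordinates (which has
density `Z`) can be realised by random vectors depending `A`-Lipschitz continuously on the sum. -/
def Samples {ι : Type} [Fintype ι] (p : ι → ℝ → ℝ) (Z : ℝ → ℝ) (A : ℝ) : Prop :=
  ∃ (Ω : Type) (_ : MeasurableSpace Ω) (P : Measure Ω) (_ : IsProbabilityMeasure P)
    (X : ℝ → Ω → ι → ℝ), (∀ s, Measurable (X s)) ∧
    (∀ s t ω i, |X s ω i - X t ω i| ≤ A * |s - t|) ∧ (∀ s ω, ∑ i, X s ω i = s) ∧
    ∀ F : (ι → ℝ) → ℝ≥0∞, Measurable F →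
      ∫⁻ x, F x * ∏ i, ENNReal.ofReal (p i (x i)) =
        ∫⁻ s, ENNReal.ofReal (Z s) * ∫⁻ ω, F (X s ω) ∂P

lemma strictMono_cdf {g : ℝ → ℝ} (hpos : ∀ x, 0 < g x) (hgi : Integrable g) :
    StrictMono fun r => ∫ x in Set.Iic r, g x := by
  intro a b hab
  have h : (∫ x in Set.Iic b, g x) - ∫ x in Set.Iic a, g x = ∫ x in a..b, g x :=
    intervalIntegral.integral_Iic_sub_Iic hgi.integrableOn hgi.integrableOn
  have h2 : 0 < ∫ x in a..b, g x :=
    intervalIntegral.intervalIntegral_pos_of_pos hgi.intervalIntegrable hpos hab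
  simp only
  linarith

lemma continuous_cdf {g : ℝ → ℝ} (hgi : Integrable g) :
    Continuous fun r => ∫ x in Set.Iic r, g x := by
  have h : (fun r => ∫ x in Set.Iic r, g x) =
      fun r => (∫ x in Set.Iic (0:ℝ), g x) + ∫ x in (0:ℝ)..r, g x := by
    funext r
    have := intervalIntegral.integral_Iic_sub_Iic (a := 0) (b := r) (μ := volume) (f := g)
      hgi.integrableOn hgi.integrableOn
    linarith
  rw [h]
  exact continuous_const.add (intervalIntegral.continuous_primitive
    (fun a b => hgi.intervalIntegrable) 0)

lemma exists_cdf_eq {g : ℝ → ℝ} (hpos : ∀ x, 0 < g x) (hgi : Integrable g) {w : ℝ}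
    (hw0 : 0 < w) (hw1 : w < 1) : ∃ r, ∫ x in Set.Iic r, g x = w * ∫ x, g x := by
  have hT : 0 < ∫ x, g x := by
    rw [integral_pos_iff_support_of_nonneg (fun x => (hpos x).le) hgi]
    have : Function.support g = Set.univ := by
      ext x; simp [(hpos x).ne']
    simp [this]
  have hbot : Filter.Tendsto (fun n : ℕ => ∫ x in Set.Iic (-(n:ℝ)), g x) Filter.atTop
      (nhds 0) := by
    have := MeasureTheory.tendsto_setIntegral_of_antitone (μ := volume) (f := g)
      (s := fun n : ℕ => Set.Iic (-(n:ℝ))) (fun _ => measurableSet_Iic)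
      (fun a b h => Set.Iic_subset_Iic.2 (by simpa using h)) ⟨0, hgi.integrableOn⟩
    have h2 : (⋂ n : ℕ, Set.Iic (-(n:ℝ))) = (∅ : Set ℝ) := by
      ext x
      simp only [Set.mem_iInter, Set.mem_Iic, Set.mem_empty_iff_false, iff_false, not_forall,
        not_le]
      obtain ⟨n, hn⟩ := exists_nat_gt (-x)
      exact ⟨n, by linarith⟩
    rw [h2] at this
    simpa using this
  have htop : Filter.Tendsto (fun r => ∫ x in Set.Iic r, g x) Filter.atTop
      (nhds (∫ x, g x)) := by
    have := MeasureTheory.tendsto_setIntegral_of_monotone (μ := volume) (f := g)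
      (s := fun n : ℝ => Set.Iic n) (fun _ => measurableSet_Iic)
      (fun a b h => Set.Iic_subset_Iic.2 h) hgi.integrableOn
    simpa [Set.iUnion_Iic] using this
  have h1 : ∃ a, ∫ x in Set.Iic a, g x < w * ∫ x, g x := by
    obtain ⟨n, hn⟩ := (hbot.eventually (gt_mem_nhds (mul_pos hw0 hT))).exists
    exact ⟨_, hn⟩
  have h2 : ∃ b, w * ∫ x, g x < ∫ x in Set.Iic b, g x :=
    (htop.eventually (lt_mem_nhds (by nlinarith))).exists
  obtain ⟨a, ha⟩ := h1
  obtain ⟨b, hb⟩ := h2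
  exact mem_range_of_exists_le_of_exists_ge (continuous_cdf hgi) ⟨a, ha.le⟩ ⟨b, hb.le⟩

/-- Lebesgue measure on the open unit interval. -/
def unitLaw : Measure (Set.Ioo (0:ℝ) 1) := Measure.comap Subtype.val volume

instance : IsProbabilityMeasure unitLaw := by
  constructor
  rw [unitLaw, comap_subtype_coe_apply measurableSet_Ioo, Set.image_univ,
    Subtype.range_val]
  simp

lemma volume_Ioo_le {u : ℝ} (h0 : 0 ≤ u) (h1 : u ≤ 1) :
    unitLaw {w : Set.Ioo (0:ℝ) 1 | (w:ℝ) ≤ u} = ENNReal.ofReal u := by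
  have hm : MeasurableSet {w : Set.Ioo (0:ℝ) 1 | (w:ℝ) ≤ u} :=
    measurableSet_le measurable_subtype_coe measurable_const
  rw [unitLaw, comap_subtype_coe_apply measurableSet_Ioo]
  have : ((↑) '' {w : Set.Ioo (0:ℝ) 1 | (w:ℝ) ≤ u} : Set ℝ) = Set.Ioo 0 1 ∩ Set.Iic u := by
    ext x; simp [and_comm]
  rw [this]
  apply le_antisymm
  · calc volume (Set.Ioo 0 1 ∩ Set.Iic u) ≤ volume (Set.Ioc 0 u) := by
          apply measure_mono
          rintro x ⟨hx, hx'⟩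
          exact ⟨hx.1, hx'⟩
      _ = _ := by simp
  · calc ENNReal.ofReal u = volume (Set.Ioo 0 u) := by simp
      _ ≤ _ := by
        apply measure_mono
        rintro x hx
        exact ⟨⟨hx.1, hx.2.trans_le h1⟩, hx.2.le⟩

lemma exists_quantile {g : ℝ → ℝ} (hpos : ∀ x, 0 < g x) (hgi : Integrable g) :
    ∃ R : Set.Ioo (0:ℝ) 1 → ℝ, (∀ w, ∫ x in Set.Iic (R w), g x = w * ∫ x, g x) ∧
      Measurable R ∧ ∀ G : ℝ → ℝ≥0∞, Measurable G →
        ∫⁻ r, G r * ENNReal.ofReal (g r) = ENNReal.ofReal (∫ x, g x) * ∫⁻ w, G (R w) ∂unitLaw := by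
  choose R hR using fun w : Set.Ioo (0:ℝ) 1 => exists_cdf_eq hpos hgi w.2.1 w.2.2
  have hT : 0 < ∫ x, g x := by
    rw [integral_pos_iff_support_of_nonneg (fun x => (hpos x).le) hgi]
    have : Function.support g = Set.univ := by
      ext x; simp [(hpos x).ne']
    simp [this]
  have hmono := strictMono_cdf hpos hgi
  have hiff : ∀ w r, R w ≤ r ↔ (w:ℝ) ≤ (∫ x in Set.Iic r, g x) / ∫ x, g x := by
    intro w r
    rw [le_div_iff₀ hT, ← hR w]
    exact hmono.le_iff_le.symm
  have hRm : Measurable R := by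
    apply measurable_of_Iic
    intro r
    have : R ⁻¹' Set.Iic r = {w : Set.Ioo (0:ℝ) 1 | (w:ℝ) ≤ (∫ x in Set.Iic r, g x) / ∫ x, g x} := by
      ext w; simp [hiff]
    rw [this]
    exact measurableSet_le measurable_subtype_coe measurable_const
  refine ⟨R, hR, hRm, ?_⟩
  have hd : volume.withDensity (fun r => ENNReal.ofReal (g r)) =
      ENNReal.ofReal (∫ x, g x) • Measure.map R unitLaw := by
    have hfin : IsFiniteMeasure (volume.withDensity (fun r => ENNReal.ofReal (g r))) :=
      isFiniteMeasure_withDensity_ofReal hgi.2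
    refine Measure.ext_of_Iic _ _ fun r => ?_
    rw [withDensity_apply _ measurableSet_Iic, Measure.smul_apply,
      Measure.map_apply hRm measurableSet_Iic]
    have : R ⁻¹' Set.Iic r = {w : Set.Ioo (0:ℝ) 1 | (w:ℝ) ≤ (∫ x in Set.Iic r, g x) / ∫ x, g x} := by
      ext w; simp [hiff]
    have hle : ∫ x in Set.Iic r, g x ≤ ∫ x, g x :=
      setIntegral_le_integral hgi (Filter.Eventually.of_forall fun x => (hpos x).le)
    have h0 : 0 ≤ ∫ x in Set.Iic r, g x := integral_nonneg fun x => (hpos x).le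
    rw [this, volume_Ioo_le (by positivity) (by rw [div_le_one hT]; exact hle), smul_eq_mul,
      ← ENNReal.ofReal_mul hT.le, mul_div_cancel₀ _ hT.ne',
      ofReal_integral_eq_lintegral_ofReal hgi.integrableOn
        (Filter.Eventually.of_forall fun x => (hpos x).le)]
  intro G hG
  have hgm : AEMeasurable (fun r => ENNReal.ofReal (g r)) volume :=
    hgi.1.aemeasurable.ennreal_ofReal
  have h1 := lintegral_withDensity_eq_lintegral_mul₀ hgm (g := G) hG.aemeasurable
  rw [hd, lintegral_smul_measure, lintegral_map hG hRm] at h1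
  rw [smul_eq_mul] at h1
  rw [h1]
  simp [mul_comm]

lemma continuous_of_abs_le {f : ℝ → ℝ} {A : ℝ} (h : ∀ s t, |f s - f t| ≤ A * |s - t|) :
    Continuous f := by
  have : LipschitzWith (Real.toNNReal A) f := by
    apply LipschitzWith.of_dist_le_mul
    intro s t
    rw [Real.dist_eq, Real.dist_eq]
    exact (h s t).trans (mul_le_mul_of_nonneg_right (Real.le_coe_toNNReal A) (abs_nonneg _))
  exact this.continuous

lemma measurable_uncurry_of_lip {Ω ι : Type} [Fintype ι] [MeasurableSpace Ω]
    {X : ℝ → Ω → ι → ℝ} {A : ℝ} (hm : ∀ s, Measurable (X s))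
    (hl : ∀ s t ω i, |X s ω i - X t ω i| ≤ A * |s - t|) : Measurable (Function.uncurry X) :=
  measurable_uncurry_of_continuous_of_measurable
    (fun ω => continuous_pi fun i => continuous_of_abs_le fun s t => hl s t ω i) hm

lemma Nice.mul_shift {p q : ℝ → ℝ} (hp : Nice p) (hq : Nice q) (s : ℝ) :
    Integrable fun r => p r * q (s - r) := by
  obtain ⟨M, hM⟩ := hq.bdd
  refine hp.int.mul_bdd (c := M) ?_ ?_
  · exact (hq.cont.comp (continuous_const.sub continuous_id)).aestronglyMeasurable
  · refine Filter.Eventually.of_forall fun x => ?_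
    rw [Real.norm_eq_abs, abs_of_pos (hq.pos _)]
    exact hM _

lemma lintegral_sum_elim {ι κ : Type} [Fintype ι] [Fintype κ] (G : (ι ⊕ κ → ℝ) → ℝ≥0∞)
    (hG : Measurable G) : ∫⁻ x, G x = ∫⁻ x : ι → ℝ, ∫⁻ y : κ → ℝ, G (Sum.elim x y) := by
  have h := (volume_measurePreserving_sumPiEquivProdPi_symm
    (fun _ : ι ⊕ κ => ℝ)).lintegral_comp hG
  rw [← h, Measure.volume_eq_prod, lintegral_prod]
  · refine lintegral_congr fun x => lintegral_congr fun y => ?_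
    rfl
  · exact (hG.comp (MeasurableEquiv.measurable _)).aemeasurable

lemma measurable_sumElim {ι κ α : Type} [MeasurableSpace α] {f : α → ι → ℝ} {g : α → κ → ℝ}
    (hf : Measurable f) (hg : Measurable g) : Measurable fun a => Sum.elim (f a) (g a) := by
  rw [measurable_pi_iff]
  rintro (i | i)
  · exact (measurable_pi_apply i).comp hf
  · exact (measurable_pi_apply i).comp hg

lemma Samples.node {ι κ : Type} [Fintype ι] [Fintype κ] {p : ι → ℝ → ℝ} {q : κ → ℝ → ℝ}
    {Z W : ℝ → ℝ} {A A' c c' : ℝ} (hA : 0 ≤ A) (hA' : 0 ≤ A')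
    (hp : ∀ i, Measurable (p i)) (hq : ∀ i, Measurable (q i))
    (hZ : Nice Z) (hW : Nice W) (h1 : Samples p Z A) (h2 : Samples q W A')
    (hR : ∀ s t w r r', ∫ x in Set.Iic r, Z x * W (s - x) = w * cv Z W s →
      ∫ x in Set.Iic r', Z x * W (t - x) = w * cv Z W t →
      |r - r'| ≤ c * |s - t| ∧ |(s - r) - (t - r')| ≤ c' * |s - t|) :
    Samples (Sum.elim p q) (cv Z W) (max (A * c) (A' * c')) := by
  obtain ⟨Ω, mΩ, P, hP, X, hXm, hXl, hXs, hXF⟩ := h1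
  obtain ⟨Ω', mΩ', P', hP', Y, hYm, hYl, hYs, hYF⟩ := h2
  have hpos : ∀ s x, 0 < Z x * W (s - x) := fun s x => mul_pos (hZ.pos _) (hW.pos _)
  choose R hRc hRm hRF using fun s => exists_quantile (hpos s) (hZ.mul_shift hW s)
  have hXj := measurable_uncurry_of_lip hXm hXl
  have hYj := measurable_uncurry_of_lip hYm hYl
  refine ⟨Set.Ioo (0:ℝ) 1 × Ω × Ω', inferInstance, unitLaw.prod (P.prod P'), inferInstance,
    fun s ω => Sum.elim (X (R s ω.1) ω.2.1) (Y (s - R s ω.1) ω.2.2), ?_, ?_, ?_, ?_⟩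
  · intro s
    apply measurable_sumElim
    · exact hXj.comp (f := fun ω : Set.Ioo (0:ℝ) 1 × Ω × Ω' => (R s ω.1, ω.2.1))
        (((hRm s).comp measurable_fst).prodMk (measurable_fst.comp measurable_snd))
    · exact hYj.comp (f := fun ω : Set.Ioo (0:ℝ) 1 × Ω × Ω' => (s - R s ω.1, ω.2.2))
        ((measurable_const.sub ((hRm s).comp measurable_fst)).prodMk
          (measurable_snd.comp measurable_snd))
  · intro s t ω i
    obtain ⟨hr, hr'⟩ := hR s t ω.1 _ _ (hRc s ω.1) (hRc t ω.1)
    cases i with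
    | inl i =>
      calc _ ≤ A * |R s ω.1 - R t ω.1| := hXl _ _ _ _
        _ ≤ A * (c * |s - t|) := by gcongr
        _ = (A * c) * |s - t| := by ring
        _ ≤ _ := by gcongr; exact le_max_left _ _
    | inr i =>
      calc _ ≤ A' * |(s - R s ω.1) - (t - R t ω.1)| := hYl _ _ _ _
        _ ≤ A' * (c' * |s - t|) := by gcongr
        _ = (A' * c') * |s - t| := by ring
        _ ≤ _ := by gcongr; exact le_max_right _ _
  · intro s ω
    simp [hXs, hYs]
  · intro F hF
    have hpm : Measurable fun x : ι → ℝ => ∏ i, ENNReal.ofReal (p i (x i)) :=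
      Finset.measurable_prod _ fun i _ => ((hp i).comp (measurable_pi_apply i)).ennreal_ofReal
    have hqm : Measurable fun x : κ → ℝ => ∏ i, ENNReal.ofReal (q i (x i)) :=
      Finset.measurable_prod _ fun i _ => ((hq i).comp (measurable_pi_apply i)).ennreal_ofReal
    have hFe : Measurable fun z : (ι → ℝ) × (κ → ℝ) => F (Sum.elim z.1 z.2) :=
      hF.comp (measurable_sumElim measurable_fst measurable_snd)
    have hZm : Measurable fun s => ENNReal.ofReal (Z s) := hZ.cont.measurable.ennreal_ofReal
    have hWm : Measurable fun s => ENNReal.ofReal (W s) := hW.cont.measurable.ennreal_ofReal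
    have hΨ : Measurable fun z : (ℝ × ℝ) × Ω × Ω' =>
        F (Sum.elim (X z.1.1 z.2.1) (Y z.1.2 z.2.2)) := by
      refine hF.comp (measurable_sumElim ?_ ?_)
      · exact hXj.comp (f := fun z : (ℝ × ℝ) × Ω × Ω' => (z.1.1, z.2.1)) (by fun_prop)
      · exact hYj.comp (f := fun z : (ℝ × ℝ) × Ω × Ω' => (z.1.2, z.2.2)) (by fun_prop)
    set Φ : ℝ × ℝ → ℝ≥0∞ := fun z =>
      ∫⁻ ω, F (Sum.elim (X z.1 ω.1) (Y z.2 ω.2)) ∂(P.prod P') with hΦ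
    have hΦm : Measurable Φ := hΨ.lintegral_prod_right'
    have key : ∫⁻ x : ι ⊕ κ → ℝ, F x * ∏ i, ENNReal.ofReal (Sum.elim p q i (x i)) =
        ∫⁻ s, ∫⁻ t, ENNReal.ofReal (Z s) * ENNReal.ofReal (W t) * Φ (s, t) := by
      rw [lintegral_sum_elim]
      swap
      · refine hF.mul (Finset.measurable_prod _ fun i _ => ?_)
        cases i with
        | inl i => exact ((hp i).comp (measurable_pi_apply _)).ennreal_ofReal
        | inr i => exact ((hq i).comp (measurable_pi_apply _)).ennreal_ofReal
      simp only [Fintype.prod_sum_type, Sum.elim_inl, Sum.elim_inr]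
      have e1 : ∀ x : ι → ℝ, ∫⁻ y : κ → ℝ, F (Sum.elim x y) *
          ((∏ i, ENNReal.ofReal (p i (x i))) * ∏ i, ENNReal.ofReal (q i (y i))) =
          (∫⁻ t, ENNReal.ofReal (W t) * ∫⁻ ω, F (Sum.elim x (Y t ω)) ∂P') *
            ∏ i, ENNReal.ofReal (p i (x i)) := by
        intro x
        rw [← hYF (fun y => F (Sum.elim x y)) (hFe.comp (measurable_const.prodMk measurable_id)),
          ← lintegral_mul_const]
        · refine lintegral_congr fun y => by ring
        · exact (hFe.comp (measurable_const.prodMk measurable_id)).mul hqm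
      simp_rw [e1]
      rw [hXF (fun x => ∫⁻ t, ENNReal.ofReal (W t) * ∫⁻ ω, F (Sum.elim x (Y t ω)) ∂P')]
      · refine lintegral_congr fun s => ?_
        have e2 : ∀ t, ENNReal.ofReal (Z s) * ENNReal.ofReal (W t) * Φ (s, t) =
            ENNReal.ofReal (Z s) * (ENNReal.ofReal (W t) * Φ (s, t)) := fun t => mul_assoc _ _ _
        simp_rw [e2]
        rw [lintegral_const_mul]
        swap
        · exact hWm.mul (hΦm.comp (measurable_const.prodMk measurable_id))
        congr 1
        rw [lintegral_lintegral_swap]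
        · refine lintegral_congr fun t => ?_
          rw [hΦ]
          simp only
          rw [lintegral_prod, lintegral_const_mul]
          · exact Measurable.lintegral_prod_right' (f := fun z : Ω × Ω' =>
              F (Sum.elim (X s z.1) (Y t z.2))) (hΨ.comp (f := fun z : Ω × Ω' => ((s, t), z)) (by fun_prop))
          · exact (hΨ.comp (f := fun z : Ω × Ω' => ((s, t), z)) (by fun_prop)).aemeasurable
        · refine Measurable.aemeasurable ?_
          refine (hWm.comp measurable_snd).mul ?_
          exact Measurable.lintegral_prod_right' (f := fun z : (Ω × ℝ) × Ω' =>
              F (Sum.elim (X s z.1.1) (Y z.1.2 z.2)))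
              (hΨ.comp (f := fun z : (Ω × ℝ) × Ω' => ((s, z.1.2), z.1.1, z.2)) (by fun_prop))
      · refine Measurable.lintegral_prod_right' (f := fun z : (ι → ℝ) × ℝ =>
          ENNReal.ofReal (W z.2) * ∫⁻ ω, F (Sum.elim z.1 (Y z.2 ω)) ∂P') ?_
        refine (hWm.comp measurable_snd).mul ?_
        refine Measurable.lintegral_prod_right' (f := fun z : ((ι → ℝ) × ℝ) × Ω' =>
              F (Sum.elim z.1.1 (Y z.1.2 z.2))) ?_
        refine hF.comp (measurable_sumElim (by fun_prop) ?_)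
        exact hYj.comp (f := fun z : ((ι → ℝ) × ℝ) × Ω' => (z.1.2, z.2)) (by fun_prop)
    have hH : Measurable fun z : ℝ × ℝ => ENNReal.ofReal (Z z.1) * ENNReal.ofReal (W z.2) * Φ z :=
      ((hZm.comp measurable_fst).mul (hWm.comp measurable_snd)).mul hΦm
    rw [key]
    calc _ = ∫⁻ r, ∫⁻ s, ENNReal.ofReal (Z r) * ENNReal.ofReal (W (s - r)) * Φ (r, s - r) := by
          refine lintegral_congr fun r => ?_
          exact (lintegral_sub_right_eq_self
            (fun t => ENNReal.ofReal (Z r) * ENNReal.ofReal (W t) * Φ (r, t)) r).symm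
      _ = ∫⁻ s, ∫⁻ r, ENNReal.ofReal (Z r) * ENNReal.ofReal (W (s - r)) * Φ (r, s - r) := by
          rw [lintegral_lintegral_swap]
          exact (hH.comp (f := fun z : ℝ × ℝ => (z.1, z.2 - z.1)) (by fun_prop)).aemeasurable
      _ = _ := by
          refine lintegral_congr fun s => ?_
          have e3 : ∀ r, ENNReal.ofReal (Z r) * ENNReal.ofReal (W (s - r)) * Φ (r, s - r) =
              Φ (r, s - r) * ENNReal.ofReal (Z r * W (s - r)) := by
            intro r
            rw [ENNReal.ofReal_mul (hZ.pos _).le]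
            ring
          simp_rw [e3]
          rw [hRF s (fun r => Φ (r, s - r)) (hΦm.comp (f := fun r : ℝ => (r, s - r)) (by fun_prop))]
          congr 1
          rw [lintegral_prod]
          refine Measurable.aemeasurable ?_
          exact hΨ.comp (f := fun ω : Set.Ioo (0:ℝ) 1 × Ω × Ω' => ((R s ω.1, s - R s ω.1), ω.2))
            ((((hRm s).comp measurable_fst).prodMk (measurable_const.sub ((hRm s).comp
              measurable_fst))).prodMk measurable_snd)

lemma Samples.single {ι : Type} [Unique ι] {p : ι → ℝ → ℝ} (hp : Measurable (p default)) :
    Samples p (p default) 1 := by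
  refine ⟨Unit, inferInstance, Measure.dirac (), inferInstance, fun s _ _ => s, ?_, ?_, ?_, ?_⟩
  · intro s; exact measurable_const
  · intro s t _ i; simp
  · intro s _; simp
  · intro F hF
    have h := ((volume_preserving_funUnique ι ℝ).symm).lintegral_comp
      (f := fun x => F x * ∏ i, ENNReal.ofReal (p i (x i)))
      (hF.mul (by
        simp only [Fintype.prod_unique]
        exact (hp.comp (measurable_pi_apply _)).ennreal_ofReal))
    rw [← h]
    refine lintegral_congr fun s => ?_
    simp only [Fintype.prod_unique, lintegral_dirac]
    rw [mul_comm]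
    rfl

lemma Samples.reindex {ι κ : Type} [Fintype ι] [Fintype κ] (e : ι ≃ κ) {p : κ → ℝ → ℝ}
    {Z : ℝ → ℝ} {A : ℝ} (hp : ∀ i, Measurable (p i)) (h : Samples (fun i => p (e i)) Z A) :
    Samples p Z A := by
  obtain ⟨Ω, mΩ, P, hP, X, hXm, hXl, hXs, hXF⟩ := h
  refine ⟨Ω, mΩ, P, hP, fun s ω i => X s ω (e.symm i), ?_, ?_, ?_, ?_⟩
  · intro s
    rw [measurable_pi_iff]
    exact fun i => (measurable_pi_apply _).comp (hXm s)
  · intro s t ω i; exact hXl _ _ _ _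
  · intro s ω
    refine Eq.trans ?_ (hXs s ω)
    exact Equiv.sum_comp e.symm (X s ω)
  · intro F hF
    have hpm : Measurable fun x : κ → ℝ => ∏ i, ENNReal.ofReal (p i (x i)) :=
      Finset.measurable_prod _ fun i _ => ((hp i).comp (measurable_pi_apply i)).ennreal_ofReal
    have h2 := (volume_measurePreserving_piCongrLeft (fun _ : κ => ℝ) e).lintegral_comp
      (hF.mul hpm)
    have e1 : ∀ x : ι → ℝ, MeasurableEquiv.piCongrLeft (fun _ : κ => ℝ) e x =
        fun i => x (e.symm i) := by
      intro x; funext i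
      obtain ⟨j, rfl⟩ := e.surjective i
      simp [MeasurableEquiv.coe_piCongrLeft]
    simp only [e1, Pi.mul_apply] at h2
    rw [← h2]
    rw [← hXF (fun x => F fun i => x (e.symm i))]
    · refine lintegral_congr fun x => ?_
      congr 1
      rw [← Equiv.prod_comp e]
      simp
    · exact hF.comp (by fun_prop)

lemma cdf_le_of_likelihood_ratio {f g : ℝ → ℝ} (hf : Integrable f) (hg : Integrable g)
    (h : ∀ x y, x ≤ y → f y * g x ≤ f x * g y) (r : ℝ) :
    (∫ x in Set.Iic r, g x) * ∫ x, f x ≤ (∫ x in Set.Iic r, f x) * ∫ x, g x := by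
  have e : ∀ u : ℝ → ℝ, Integrable u →
      ∫ x, u x = (∫ x in Set.Iic r, u x) + ∫ x in Set.Ioi r, u x := by
    intro u hu
    rw [← Set.compl_Iic, integral_add_compl measurableSet_Iic hu]
  have h1 : ∀ y ∈ Set.Ioi r, f y * ∫ x in Set.Iic r, g x ≤ (∫ x in Set.Iic r, f x) * g y := by
    intro y hy
    rw [← integral_const_mul, ← integral_mul_const]
    refine setIntegral_mono_on (hg.integrableOn.const_mul _) (hf.integrableOn.mul_const _)
      measurableSet_Iic fun x hx => ?_
    exact h x y (hx.trans (le_of_lt hy))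
  have h2 : (∫ y in Set.Ioi r, f y * ∫ x in Set.Iic r, g x) ≤
      ∫ y in Set.Ioi r, (∫ x in Set.Iic r, f x) * g y :=
    setIntegral_mono_on (hf.integrableOn.mul_const _) (hg.integrableOn.const_mul _)
      measurableSet_Ioi h1
  rw [integral_const_mul, integral_mul_const] at h2
  rw [e f hf, e g hg]
  nlinarith

lemma integral_Iic_add (g : ℝ → ℝ) (r h : ℝ) :
    ∫ x in Set.Iic (r + h), g x = ∫ x in Set.Iic r, g (x + h) := by
  have := (measurePreserving_add_right volume h).setIntegral_preimage_emb
    (measurableEmbedding_addRight h) g (Set.Iic (r + h))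
  rw [← this]
  simp

lemma Nice.cv_pos {p q : ℝ → ℝ} (hp : Nice p) (hq : Nice q) (s : ℝ) : 0 < cv p q s := by
  rw [cv, integral_pos_iff_support_of_nonneg (fun x => (mul_pos (hp.pos _) (hq.pos _)).le)
    (hp.mul_shift hq s)]
  have : Function.support (fun r => p r * q (s - r)) = Set.univ := by
    ext x; simp [(hp.pos _).ne', (hq.pos _).ne']
  simp [this]

/-- For log-concave factors, quantiles of the split are monotone in the sum and so is the rest. -/
lemma quantile_lip_of_LC {Z W : ℝ → ℝ} (hZ : Nice Z) (hW : Nice W) (hZl : LC Z) (hWl : LC W)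
    (s t w r r' : ℝ) (h1 : ∫ x in Set.Iic r, Z x * W (s - x) = w * cv Z W s)
    (h2 : ∫ x in Set.Iic r', Z x * W (t - x) = w * cv Z W t) :
    |r - r'| ≤ 1 * |s - t| ∧ |(s - r) - (t - r')| ≤ 1 * |s - t| := by
  wlog hst : s ≤ t generalizing s t r r'
  · have := this t s r' r h2 h1 (le_of_not_ge hst)
    rw [abs_sub_comm r r', abs_sub_comm s t, abs_sub_comm (s - r)]
    exact this
  have hmono : ∀ s, StrictMono fun r => ∫ x in Set.Iic r, Z x * W (s - x) := fun s =>
    strictMono_cdf (fun x => mul_pos (hZ.pos _) (hW.pos _)) (hZ.mul_shift hW s)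
  have hs := hZ.cv_pos hW s
  have ht := hZ.cv_pos hW t
  have a1 : r ≤ r' := by
    have := cdf_le_of_likelihood_ratio (hZ.mul_shift hW s) (hZ.mul_shift hW t) (fun x y hxy => by
      have := hWl (s - y) (t - y) (y - x) (by linarith) (by linarith)
      rw [show t - y + (y - x) = t - x by ring, show s - y + (y - x) = s - x by ring] at this
      have h3 : 0 ≤ Z x * Z y := (mul_pos (hZ.pos _) (hZ.pos _)).le
      nlinarith [mul_le_mul_of_nonneg_left this h3]) r
    rw [h1] at this
    change _ * cv Z W s ≤ w * cv Z W s * cv Z W t at this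
    rw [← (hmono t).le_iff_le]
    rw [h2]
    exact le_of_mul_le_mul_right (by linarith) hs
  have a2 : r' ≤ r + (t - s) := by
    have hi : Integrable fun x => Z (x + (t - s)) * W (t - (x + (t - s))) :=
      (hZ.mul_shift hW t).comp_add_right (t - s)
    have := cdf_le_of_likelihood_ratio hi (hZ.mul_shift hW s) (fun x y hxy => by
      have := hZl x y (t - s) hxy (by linarith)
      rw [show t - (x + (t - s)) = s - x by ring, show t - (y + (t - s)) = s - y by ring]
      have h3 : 0 ≤ W (s - x) * W (s - y) := (mul_pos (hW.pos _) (hW.pos _)).le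
      nlinarith [mul_le_mul_of_nonneg_left this h3]) r
    rw [h1, integral_add_right_eq_self (fun x => Z x * W (t - x)),
      ← integral_Iic_add (fun x => Z x * W (t - x))] at this
    change w * cv Z W s * cv Z W t ≤ _ * cv Z W s at this
    rw [← (hmono t).le_iff_le]
    rw [h2]
    exact le_of_mul_le_mul_right (by linarith) hs
  rw [one_mul]
  constructor <;> rw [abs_le] <;> constructor <;>
    [skip; skip; skip; skip] <;> rw [abs_of_nonpos (by linarith : s - t ≤ 0)] <;> linarith

lemma Samples.node_of_LC {ι κ : Type} [Fintype ι] [Fintype κ] {p : ι → ℝ → ℝ} {q : κ → ℝ → ℝ}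
    {Z W : ℝ → ℝ} {A A' : ℝ} (hA : 0 ≤ A) (hA' : 0 ≤ A')
    (hp : ∀ i, Measurable (p i)) (hq : ∀ i, Measurable (q i))
    (hZ : Nice Z) (hW : Nice W) (hZl : LC Z) (hWl : LC W)
    (h1 : Samples p Z A) (h2 : Samples q W A') :
    Samples (Sum.elim p q) (cv Z W) (max A A') := by
  have := Samples.node (c := 1) (c' := 1) hA hA' hp hq hZ hW h1 h2
    (fun s t w r r' => quantile_lip_of_LC hZ hW hZl hWl s t w r r')
  simpa using this

lemma Nice.cv {p q : ℝ → ℝ} (hp : Nice p) (hq : Nice q) : Nice (cv p q) := by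
  obtain ⟨M, hM⟩ := hq.bdd
  refine ⟨hp.cv_pos hq, ?_, ?_, M * ∫ x, p x, ?_⟩
  · refine continuous_of_dominated (bound := fun x => p x * M) ?_ ?_ (hp.int.mul_const M) ?_
    · exact fun s => (hp.mul_shift hq s).1
    · intro s
      refine Filter.Eventually.of_forall fun x => ?_
      rw [norm_mul, Real.norm_eq_abs, Real.norm_eq_abs, abs_of_pos (hp.pos _),
        abs_of_pos (hq.pos _)]
      exact mul_le_mul_of_nonneg_left (hM _) (hp.pos _).le
    · refine Filter.Eventually.of_forall fun x => ?_
      exact continuous_const.mul (hq.cont.comp (continuous_id.sub continuous_const))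
  · exact (hp.int.integrable_convolution (ContinuousLinearMap.mul ℝ ℝ) hq.int)
  · intro s
    rw [← integral_const_mul]
    refine integral_mono (hp.mul_shift hq s) (hp.int.const_mul M) fun x => ?_
    simp only
    rw [mul_comm]
    exact mul_le_mul_of_nonneg_right (hM _) (hp.pos _).le

/-- `φ` is differentiable with continuous derivative `φ'`, and is `lam`-strongly convex. -/
structure ConvPot (lam : ℝ) (φ φ' : ℝ → ℝ) : Prop where
  lam_pos : 0 < lam
  deriv : ∀ x, HasDerivAt φ (φ' x) x
  cont : Continuous φ'
  mono : ∀ x y, x ≤ y → lam * (y - x) ≤ φ' y - φ' x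

namespace ConvPot
variable {lam : ℝ} {φ φ' : ℝ → ℝ}

lemma continuous (h : ConvPot lam φ φ') : Continuous φ :=
  continuous_iff_continuousAt.2 fun x => (h.deriv x).continuousAt

lemma lower_bound (h : ConvPot lam φ φ') (x y : ℝ) :
    φ x + φ' x * (y - x) + lam / 2 * (y - x) ^ 2 ≤ φ y := by
  set g : ℝ → ℝ := fun z => φ z - φ' x * (z - x) - lam / 2 * (z - x) ^ 2 with hg
  have hd : ∀ z, HasDerivAt g (φ' z - φ' x - lam * (z - x)) z := by
    intro z
    have h1 := ((h.deriv z).sub (((hasDerivAt_id z).sub_const x).const_mul (φ' x))).sub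
      ((((hasDerivAt_id z).sub_const x).pow 2).const_mul (lam / 2))
    refine h1.congr_deriv ?_
    simp only [id, Nat.cast_ofNat]
    ring
  have hc : ∀ s, ContinuousOn g s := fun s z _ => (hd z).continuousAt.continuousWithinAt
  have hx : g x = φ x := by simp [hg]
  have : g x ≤ g y := by
    rcases lt_trichotomy x y with hxy | hxy | hxy
    · obtain ⟨c, hc1, hc2⟩ := exists_hasDerivAt_eq_slope g _ hxy (hc _) (fun z _ => hd z)
      rw [_root_.eq_div_iff (by linarith)] at hc2
      have := h.mono x c hc1.1.le
      have h3 : 0 ≤ (φ' c - φ' x - lam * (c - x)) * (y - x) :=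
        mul_nonneg (by linarith) (by linarith)
      linarith
    · rw [hxy]
    · obtain ⟨c, hc1, hc2⟩ := exists_hasDerivAt_eq_slope g _ hxy (hc _) (fun z _ => hd z)
      rw [_root_.eq_div_iff (by linarith)] at hc2
      have := h.mono c x hc1.2.le
      have h3 : 0 ≤ -(φ' c - φ' x - lam * (c - x)) * (x - y) :=
        mul_nonneg (by linarith) (by linarith)
      linarith
  rw [hx] at this
  simp only [hg] at this
  linarith

lemma exists_crit (h : ConvPot lam φ φ') : ∃ x, φ' x = 0 := by
  have hl := h.lam_pos
  apply mem_range_of_exists_le_of_exists_ge h.cont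
  · refine ⟨-|φ' 0| / lam, ?_⟩
    have h1 := h.mono (-|φ' 0| / lam) 0 (div_nonpos_of_nonpos_of_nonneg (by simp) hl.le)
    have h2 : lam * (0 - -|φ' 0| / lam) = |φ' 0| := by field_simp; ring
    linarith [le_abs_self (φ' 0)]
  · refine ⟨|φ' 0| / lam, ?_⟩
    have h1 := h.mono 0 (|φ' 0| / lam) (by positivity)
    have h2 : lam * (|φ' 0| / lam - 0) = |φ' 0| := by field_simp; ring
    linarith [neg_abs_le (φ' 0)]

lemma tilt (h : ConvPot lam φ φ') (b : ℝ) :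
    ConvPot lam (fun x => φ x + b * x) (fun x => φ' x + b) where
  lam_pos := h.lam_pos
  deriv x := ((h.deriv x).add ((hasDerivAt_id x).const_mul b)).congr_deriv (by ring)
  cont := h.cont.add continuous_const
  mono x y hxy := by linarith [h.mono x y hxy]

lemma shift (h : ConvPot lam φ φ') (c d : ℝ) :
    ConvPot lam (fun x => φ (c + x) - d) (fun x => φ' (c + x)) where
  lam_pos := h.lam_pos
  deriv x := by
    have := ((h.deriv (c + x)).comp x ((hasDerivAt_id x).const_add c)).sub_const d
    simpa using this
  cont := h.cont.comp (continuous_const.add continuous_id)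
  mono x y hxy := by
    have := h.mono (c + x) (c + y) (by linarith)
    linarith

lemma reflect (h : ConvPot lam φ φ') : ConvPot lam (fun x => φ (-x)) (fun x => -φ' (-x)) where
  lam_pos := h.lam_pos
  deriv x := by
    exact ((h.deriv (-x)).comp x (hasDerivAt_neg x)).congr_deriv (by ring)
  cont := (h.cont.comp continuous_neg).neg
  mono x y hxy := by
    have := h.mono (-y) (-x) (by linarith)
    linarith

lemma gauss_bound (h : ConvPot lam φ φ') {x₀ : ℝ} (h0 : φ' x₀ = 0) (x : ℝ) :
    exp (-φ x) ≤ exp (-φ x₀) * exp (-(lam / 2) * (x - x₀) ^ 2) := by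
  rw [← Real.exp_add, Real.exp_le_exp]
  have := h.lower_bound x₀ x
  rw [h0] at this
  linarith

lemma integrable (h : ConvPot lam φ φ') : Integrable fun x => exp (-φ x) := by
  obtain ⟨x₀, h0⟩ := h.exists_crit
  have h1 : Integrable fun x => exp (-φ x₀) * exp (-(lam / 2) * (x - x₀) ^ 2) :=
    ((integrable_exp_neg_mul_sq (half_pos h.lam_pos)).comp_sub_right x₀).const_mul _
  refine h1.mono' (by have := h.continuous; fun_prop) (Filter.Eventually.of_forall fun x => ?_)
  rw [Real.norm_eq_abs, abs_of_pos (exp_pos _)]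
  exact h.gauss_bound h0 x

lemma nice (h : ConvPot lam φ φ') : Nice fun x => exp (-φ x) := by
  refine ⟨fun x => exp_pos _, by have := h.continuous; fun_prop, h.integrable, ?_⟩
  obtain ⟨x₀, h0⟩ := h.exists_crit
  refine ⟨exp (-φ x₀), fun x => (h.gauss_bound h0 x).trans ?_⟩
  refine mul_le_of_le_one_right (exp_pos _).le ?_
  rw [Real.exp_le_one_iff]
  nlinarith [h.lam_pos, sq_nonneg (x - x₀)]

lemma lc (h : ConvPot lam φ φ') : LC fun x => exp (-φ x) := by
  intro a b t hab ht
  simp only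
  rw [← Real.exp_add, ← Real.exp_add, Real.exp_le_exp]
  have hm : Monotone fun u => φ (b + u) - φ (a + u) := by
    have hd : ∀ u, HasDerivAt (fun u => φ (b + u) - φ (a + u)) (φ' (b + u) - φ' (a + u)) u := by
      intro u
      have h1 := (h.deriv (b + u)).comp u ((hasDerivAt_id u).const_add b)
      have h2 := (h.deriv (a + u)).comp u ((hasDerivAt_id u).const_add a)
      exact (h1.sub h2).congr_deriv (by ring)
    refine monotone_of_deriv_nonneg (fun u => (hd u).differentiableAt) fun u => ?_
    rw [(hd u).deriv]
    have := h.mono (a + u) (b + u) (by linarith)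
    nlinarith [h.lam_pos]
  have := hm ht
  simp only [add_zero] at this
  linarith

lemma hasDerivAt_exp (h : ConvPot lam φ φ') (x : ℝ) :
    HasDerivAt (fun x => exp (-φ x)) (-φ' x * exp (-φ x)) x := by
  exact (h.deriv x).fun_neg.exp.congr_deriv (by ring)

lemma tendsto (h : ConvPot lam φ φ') :
    Filter.Tendsto (fun x => exp (-φ x)) Filter.atTop (nhds 0) := by
  rw [Real.tendsto_exp_comp_nhds_zero]
  have h1 : Filter.Tendsto (fun x => φ 0 + x * (φ' 0 + lam / 2 * x)) Filter.atTop
      Filter.atTop := by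
    apply Filter.tendsto_atTop_add_const_left
    apply Filter.Tendsto.atTop_mul_atTop₀ Filter.tendsto_id
    apply Filter.tendsto_atTop_add_const_left
    exact Filter.Tendsto.const_mul_atTop (half_pos h.lam_pos) Filter.tendsto_id
  rw [Filter.tendsto_neg_atBot_iff]
  refine Filter.tendsto_atTop_mono (fun x => ?_) h1
  have := h.lower_bound 0 x
  simp only [sub_zero] at this
  nlinarith

lemma deriv_half (h : ConvPot lam φ φ') {x₀ : ℝ} (h0 : φ' x₀ = 0) :
    IntegrableOn (fun x => -φ' x * exp (-φ x)) (Set.Ioi x₀) ∧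
      ∫ x in Set.Ioi x₀, |-φ' x * exp (-φ x)| = exp (-φ x₀) := by
  have hn : ∀ x ∈ Set.Ioi x₀, -φ' x * exp (-φ x) ≤ 0 := by
    intro x hx
    have := h.mono x₀ x (le_of_lt hx)
    have h2 : 0 ≤ lam * (x - x₀) := mul_nonneg h.lam_pos.le (sub_nonneg.2 (le_of_lt hx))
    exact mul_nonpos_of_nonpos_of_nonneg (by linarith) (exp_pos _).le
  refine ⟨integrableOn_Ioi_deriv_of_nonpos' (fun x _ => h.hasDerivAt_exp x) hn h.tendsto, ?_⟩
  have := integral_Ioi_of_hasDerivAt_of_nonpos' (fun x _ => h.hasDerivAt_exp x) hn h.tendsto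
  rw [setIntegral_congr_fun measurableSet_Ioi (g := fun x => -(-φ' x * exp (-φ x)))
    (fun x hx => abs_of_nonpos (hn x hx)), integral_neg, this]
  ring

lemma deriv_half' (h : ConvPot lam φ φ') {x₀ : ℝ} (h0 : φ' x₀ = 0) :
    IntegrableOn (fun x => -φ' x * exp (-φ x)) (Set.Iic x₀) ∧
      ∫ x in Set.Iic x₀, |-φ' x * exp (-φ x)| = exp (-φ x₀) := by
  obtain ⟨h1, h2⟩ := h.reflect.deriv_half (x₀ := -x₀) (by simp [h0])
  simp only [neg_neg] at h1 h2
  have e1 : ∀ g : ℝ → ℝ, ∫ x in Set.Iic x₀, g x = ∫ x in Set.Ioi (-x₀), g (-x) := fun g => by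
    rw [integral_comp_neg_Ioi]; simp
  constructor
  · rw [integrableOn_Iic_iff_integrableOn_Iio,
      ← (Measure.measurePreserving_neg volume).integrableOn_comp_preimage
      (Homeomorph.neg ℝ).measurableEmbedding]
    have e2 : (Neg.neg ⁻¹' Set.Iio x₀ : Set ℝ) = Set.Ioi (-x₀) := by ext x; simp [neg_lt]
    rw [e2]
    refine h1.neg.congr (Filter.Eventually.of_forall fun x => ?_)
    simp
  · rw [e1, ← h2]
    refine integral_congr_ae (Filter.Eventually.of_forall fun x => ?_)
    simp [abs_mul]

lemma integrable_deriv (h : ConvPot lam φ φ') : Integrable fun x => -φ' x * exp (-φ x) := by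
  obtain ⟨x₀, h0⟩ := h.exists_crit
  rw [← integrableOn_univ, ← Set.Iic_union_Ioi (a := x₀)]
  exact (h.deriv_half' h0).1.union (h.deriv_half h0).1

lemma integral_abs_deriv (h : ConvPot lam φ φ') {x₀ : ℝ} (h0 : φ' x₀ = 0) :
    ∫ x, |-φ' x * exp (-φ x)| = 2 * exp (-φ x₀) := by
  rw [← integral_add_compl (measurableSet_Iic (a := x₀)) h.integrable_deriv.abs,
    Set.compl_Iic, (h.deriv_half' h0).2, (h.deriv_half h0).2]
  ring
end ConvPot

/-- Log-concavity is preserved by convolution. -/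
lemma LC_cv {Z W : ℝ → ℝ} (hZ : Nice Z) (hW : Nice W) (hZl : LC Z) (hWl : LC W) :
    LC (cv Z W) := by
  intro a b t hab ht
  have hpos : ∀ s x, 0 < Z x * W (s - x) := fun s x => mul_pos (hZ.pos _) (hW.pos _)
  choose R hRc hRm hRF using fun s => exists_quantile (hpos s) (hZ.mul_shift hW s)
  have key : ∀ s, ENNReal.ofReal (cv Z W (s + t)) = ENNReal.ofReal (cv Z W s) *
      ∫⁻ w, ENNReal.ofReal (W (s + t - R s w) / W (s - R s w)) ∂unitLaw := by
    intro s
    have hWc := hW.cont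
    have hm : Measurable fun r => ENNReal.ofReal (W (s + t - r) / W (s - r)) :=
      Measurable.ennreal_ofReal
        ((hWc.measurable.comp (by fun_prop)).div (hWc.measurable.comp (by fun_prop)))
    rw [cv, cv, ← hRF s _ hm, ofReal_integral_eq_lintegral_ofReal
      (hZ.mul_shift hW _) (Filter.Eventually.of_forall fun x => (hpos _ x).le)]
    refine lintegral_congr fun r => ?_
    rw [← ENNReal.ofReal_mul (div_pos (hW.pos _) (hW.pos _)).le]
    congr 1
    have := (hW.pos (s - r)).ne'
    field_simp
  have hle : ∫⁻ w, ENNReal.ofReal (W (b + t - R b w) / W (b - R b w)) ∂unitLaw ≤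
      ∫⁻ w, ENNReal.ofReal (W (a + t - R a w) / W (a - R a w)) ∂unitLaw := by
    refine lintegral_mono fun w => ENNReal.ofReal_le_ofReal ?_
    have h1 := (quantile_lip_of_LC hZ hW hZl hWl a b w _ _ (hRc a w) (hRc b w)).1
    rw [abs_sub_comm, abs_sub_comm a b, abs_of_nonneg (sub_nonneg.2 hab)] at h1
    have h2 := le_of_abs_le h1
    rw [div_le_div_iff₀ (hW.pos _) (hW.pos _)]
    have := hWl (a - R a w) (b - R b w) t (by linarith) ht
    rw [show b - R b w + t = b + t - R b w by ring,
      show a - R a w + t = a + t - R a w by ring] at this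
    linarith
  have hn : ∀ s, 0 ≤ cv Z W s := fun s => (hZ.cv_pos hW s).le
  rw [← ENNReal.ofReal_le_ofReal_iff (mul_nonneg (hn _) (hn _)), ENNReal.ofReal_mul (hn _),
    ENNReal.ofReal_mul (hn _), key a, key b]
  calc _ ≤ ENNReal.ofReal (cv Z W a) * (ENNReal.ofReal (cv Z W b) *
        ∫⁻ w, ENNReal.ofReal (W (a + t - R a w) / W (a - R a w)) ∂unitLaw) := by
        gcongr
    _ = _ := by ring

/-- A function with a continuous integrable derivative, itself `Nice`. -/
structure NiceD (p p' : ℝ → ℝ) : Prop where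
  nice : Nice p
  deriv : ∀ x, HasDerivAt p (p' x) x
  cont : Continuous p'
  int : Integrable p'

/-- Partial convolution integrals are jointly continuous. -/
lemma continuous_partial_cv {k Z : ℝ → ℝ} (hk : Integrable k) (hkc : Continuous k)
    (hZ : Nice Z) : Continuous fun z : ℝ × ℝ => ∫ t in Set.Iic z.2, Z t * k (z.1 - t) := by
  have hZc := hZ.cont
  obtain ⟨M, hM⟩ := hZ.bdd
  have e : ∀ z : ℝ × ℝ, ∫ t in Set.Iic z.2, Z t * k (z.1 - t) =
      ∫ x, (Set.Iic z.2).indicator Z (z.1 - x) * k x := by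
    intro z
    rw [← integral_indicator measurableSet_Iic, ← integral_sub_left_eq_self _ volume z.1]
    refine integral_congr_ae (Filter.Eventually.of_forall fun x => ?_)
    simp only [Set.indicator_apply]
    split_ifs <;> simp
  simp_rw [e]
  rw [continuous_iff_continuousAt]
  rintro ⟨s, y⟩
  refine continuousAt_of_dominated (bound := fun x => M * |k x|) ?_ ?_ (hk.abs.const_mul M) ?_
  · refine Filter.Eventually.of_forall fun z => ?_
    refine AEStronglyMeasurable.mul ?_ hkc.aestronglyMeasurable
    exact ((hZc.measurable.indicator measurableSet_Iic).comp
      (measurable_const.sub measurable_id)).aestronglyMeasurable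
  · refine Filter.Eventually.of_forall fun z => Filter.Eventually.of_forall fun x => ?_
    rw [norm_mul, Real.norm_eq_abs, Real.norm_eq_abs]
    refine mul_le_mul_of_nonneg_right ?_ (abs_nonneg _)
    rw [Set.indicator_apply]
    split_ifs
    · rw [abs_of_pos (hZ.pos _)]; exact hM _
    · rw [abs_zero]; exact (hZ.pos 0).le.trans (hM 0)
  · have : ∀ᵐ x : ℝ, x ≠ s - y := by simp [ae_iff]
    filter_upwards [this] with x hx
    refine ContinuousAt.mul ?_ continuousAt_const
    rcases lt_or_gt_of_ne hx with h | h
    · have h1 : ∀ᶠ z : ℝ × ℝ in nhds (s, y), x < z.1 - z.2 :=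
        (continuous_fst.sub continuous_snd).continuousAt.eventually (lt_mem_nhds h)
      refine (continuousAt_const (y := (0:ℝ))).congr ?_
      filter_upwards [h1] with z hz
      rw [Set.indicator_of_notMem]
      simp; linarith
    · have h1 : ∀ᶠ z : ℝ × ℝ in nhds (s, y), z.1 - z.2 < x :=
        (continuous_fst.sub continuous_snd).continuousAt.eventually (gt_mem_nhds h)
      refine ContinuousAt.congr (f := fun z : ℝ × ℝ => Z (z.1 - x)) (by fun_prop) ?_
      filter_upwards [h1] with z hz
      rw [Set.indicator_of_mem]
      simp; linarith

lemma continuous_cv {k Z : ℝ → ℝ} (hk : Integrable k) (hkc : Continuous k)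
    (hZ : Nice Z) : Continuous fun s : ℝ => ∫ t, Z t * k (s - t) := by
  have hZc := hZ.cont
  obtain ⟨M, hM⟩ := hZ.bdd
  have e : ∀ s : ℝ, ∫ t, Z t * k (s - t) = ∫ x, Z (s - x) * k x := by
    intro s
    rw [← integral_sub_left_eq_self _ volume s]
    simp
  simp_rw [e]
  refine continuous_of_dominated (bound := fun x => M * |k x|) ?_ ?_ (hk.abs.const_mul M) ?_
  · exact fun s => (by fun_prop : Continuous fun x => Z (s - x) * k x).aestronglyMeasurable
  · refine fun z => Filter.Eventually.of_forall fun x => ?_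
    rw [norm_mul, Real.norm_eq_abs, Real.norm_eq_abs]
    refine mul_le_mul_of_nonneg_right ?_ (abs_nonneg _)
    rw [abs_of_pos (hZ.pos _)]; exact hM _
  · exact Filter.Eventually.of_forall fun x => by fun_prop

lemma Nice.mul_int_shift {Z k : ℝ → ℝ} (hZ : Nice Z) (hk : Integrable k) (s : ℝ) :
    Integrable fun t => Z t * k (s - t) := by
  obtain ⟨M, hM⟩ := hZ.bdd
  refine (hk.comp_sub_left s).bdd_mul (c := M) hZ.cont.aestronglyMeasurable ?_
  refine Filter.Eventually.of_forall fun x => ?_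
  rw [Real.norm_eq_abs, abs_of_pos (hZ.pos _)]
  exact hM _

lemma hasDerivAt_setIntegral_cv {p p' Z : ℝ → ℝ} (hp : NiceD p p') (hZ : Nice Z) {S : Set ℝ}
    (hc : Continuous fun s => ∫ t in S, Z t * p' (s - t)) (s : ℝ) :
    HasDerivAt (fun s => ∫ t in S, Z t * p (s - t)) (∫ t in S, Z t * p' (s - t)) s := by
  have h1 : ∀ u, ∫ t in S, Z t * p (u - t) = (∫ t in S, Z t * p (s - t)) +
      ∫ v in s..u, ∫ t in S, Z t * p' (v - t) := by
    intro u
    have hswap : ∫ v in s..u, ∫ t in S, Z t * p' (v - t) =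
        ∫ t in S, ∫ v in s..u, Z t * p' (v - t) := by
      apply MeasureTheory.intervalIntegral_integral_swap
      have := (hZ.int.convolution_integrand (ContinuousLinearMap.mul ℝ ℝ) hp.int
        (μ := volume) (ν := volume))
      have h2 := this.mono_measure (μ := (volume.restrict (Set.uIoc s u)).prod
        (volume.restrict S)) (Measure.prod_mono Measure.restrict_le_self
        Measure.restrict_le_self)
      exact h2
    rw [hswap, ← integral_add]
    · refine integral_congr_ae (Filter.Eventually.of_forall fun t => ?_)
      simp only
      rw [intervalIntegral.integral_const_mul]
      have h3 : ∫ v in s..u, p' (v - t) = p (u - t) - p (s - t) := by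
        refine intervalIntegral.integral_eq_sub_of_hasDerivAt (f := fun v => p (v - t)) ?_ ?_
        · intro v _
          exact (hp.deriv (v - t)).comp_sub_const v t
        · exact (hp.cont.comp (continuous_id.sub continuous_const)).intervalIntegrable _ _
      rw [h3]; ring
    · exact (hZ.mul_shift hp.nice s).integrableOn
    · have h3 : ∀ t, ∫ v in s..u, Z t * p' (v - t) = Z t * p (u - t) - Z t * p (s - t) := by
        intro t
        rw [intervalIntegral.integral_const_mul]
        rw [intervalIntegral.integral_eq_sub_of_hasDerivAt (f := fun v => p (v - t))]
        · ring
        · intro v _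
          exact (hp.deriv (v - t)).comp_sub_const v t
        · exact (hp.cont.comp (continuous_id.sub continuous_const)).intervalIntegrable _ _
      simp_rw [h3]
      exact ((hZ.mul_shift hp.nice u).sub (hZ.mul_shift hp.nice s)).integrableOn
  have h2 : (fun s => ∫ t in S, Z t * p (s - t)) = fun u => (∫ t in S, Z t * p (s - t)) +
      ∫ v in s..u, ∫ t in S, Z t * p' (v - t) := funext h1
  rw [h2]
  exact (intervalIntegral.integral_hasDerivAt_right (hc.intervalIntegrable _ _)
    (hc.stronglyMeasurableAtFilter _ _) hc.continuousAt).const_add _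

lemma hasDerivAt_along_line {f g₁ g₂ : ℝ → ℝ → ℝ}
    (h₁ : ∀ s y, HasDerivAt (fun s => f s y) (g₁ s y) s)
    (h₂ : ∀ s y, HasDerivAt (fun y => f s y) (g₂ s y) y)
    (c₁ : Continuous fun z : ℝ × ℝ => g₁ z.1 z.2) (c₂ : Continuous fun z : ℝ × ℝ => g₂ z.1 z.2)
    (r C s : ℝ) :
    HasDerivAt (fun s => f s (r + C * s)) (g₁ s (r + C * s) + C * g₂ s (r + C * s)) s := by
  have h := hasStrictFDerivAt_uncurry_coprod (𝕜 := ℝ) (u := (s, r + C * s)) (f := f)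
    (f₁ := fun s y => ContinuousLinearMap.toSpanSingleton ℝ (g₁ s y))
    (f₂ := fun s y => ContinuousLinearMap.toSpanSingleton ℝ (g₂ s y))
    (Filter.Eventually.of_forall fun v => (h₁ v.1 v.2).hasFDerivAt)
    (Filter.Eventually.of_forall fun v => (h₂ v.1 v.2).hasFDerivAt)
    ((ContinuousLinearMap.toSpanSingletonCLE (𝕜 := ℝ) (E := ℝ)).continuous.comp c₁).continuousAt
    ((ContinuousLinearMap.toSpanSingletonCLE (𝕜 := ℝ) (E := ℝ)).continuous.comp c₂).continuousAt
  have hc : HasDerivAt (fun s : ℝ => (s, r + C * s)) ((1 : ℝ), C) s := by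
    refine HasDerivAt.prodMk (hasDerivAt_id s) ?_
    simpa using ((hasDerivAt_id s).const_mul C).const_add r
  have := h.hasFDerivAt.comp_hasDerivAt s hc
  refine this.congr_deriv ?_
  simp [Function.HasUncurry.uncurry]

lemma double_integral_le {a b c d k ρ : ℝ → ℝ} (ha : Integrable a) (hb : Integrable b)
    (hc : Integrable c) (hd : Integrable d) (hk : Integrable k) (hρ : Integrable ρ)
    (hρ0 : ∀ x, 0 ≤ ρ x) {α β y : ℝ} (hβ : 0 ≤ β)
    (h : ∀ t u, t ≤ y → y < u → a t * b u - c t * d u ≤ α * (k t * ρ u - ρ t * k u) +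
      (Set.Ioc (y - 1) y).indicator (fun _ => (1:ℝ)) t * (β * ρ (t + u - y))) :
    (∫ t in Set.Iic y, a t) * (∫ t in Set.Ioi y, b t) -
      (∫ t in Set.Iic y, c t) * (∫ t in Set.Ioi y, d t) ≤
    α * ((∫ t in Set.Iic y, k t) * (∫ t in Set.Ioi y, ρ t) -
      (∫ t in Set.Iic y, ρ t) * (∫ t in Set.Ioi y, k t)) + β * ∫ t, ρ t := by
  set I : ℝ → ℝ := (Set.Ioc (y - 1) y).indicator (fun _ => (1:ℝ)) with hI
  have hI0 : ∀ t, 0 ≤ I t := fun t => Set.indicator_nonneg (fun _ _ => zero_le_one) t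
  have hIi : Integrable I := by
    rw [hI, integrable_indicator_iff measurableSet_Ioc]
    exact integrableOn_const (by simp)
  have h1 : ∀ t ∈ Set.Iic y, a t * (∫ u in Set.Ioi y, b u) - c t * (∫ u in Set.Ioi y, d u) ≤
      (α * k t) * (∫ u in Set.Ioi y, ρ u) - (α * ρ t) * (∫ u in Set.Ioi y, k u) +
        I t * (β * ∫ u, ρ u) := by
    intro t ht
    have hs : Integrable fun u => ρ (t + u - y) := by
      have := hρ.comp_add_right (t - y)
      refine this.congr (Filter.Eventually.of_forall fun u => ?_)
      simp only; congr 1; ring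
    have e1 : ∫ u in Set.Ioi y, ρ (t + u - y) ≤ ∫ u, ρ u := by
      calc _ ≤ ∫ u, ρ (t + u - y) :=
            setIntegral_le_integral hs (Filter.Eventually.of_forall fun u => hρ0 _)
        _ = ∫ u, ρ (u + (t - y)) := by
            refine integral_congr_ae (Filter.Eventually.of_forall fun u => ?_)
            simp only; congr 1; ring
        _ = _ := integral_add_right_eq_self _ _
    have e2 : ∫ u in Set.Ioi y, (a t * b u - c t * d u) ≤ ∫ u in Set.Ioi y,
        (((α * k t) * ρ u - (α * ρ t) * k u) + I t * (β * ρ (t + u - y))) := by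
      refine setIntegral_mono_on ?_ ?_ measurableSet_Ioi fun u hu => ?_
      · exact (hb.integrableOn.const_mul _).sub (hd.integrableOn.const_mul _)
      · exact ((hρ.integrableOn.const_mul _).sub (hk.integrableOn.const_mul _)).add
          ((hs.integrableOn.const_mul _).const_mul _)
      · have := h t u ht hu
        linarith
    have e5 : ∫ u in Set.Ioi y, (((α * k t) * ρ u - (α * ρ t) * k u) +
        I t * (β * ρ (t + u - y))) = (∫ u in Set.Ioi y, ((α * k t) * ρ u - (α * ρ t) * k u)) +
        ∫ u in Set.Ioi y, I t * (β * ρ (t + u - y)) :=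
      integral_add ((hρ.integrableOn.const_mul _).sub (hk.integrableOn.const_mul _))
      ((hs.integrableOn.const_mul _).const_mul _)
    rw [e5, integral_sub (hb.integrableOn.const_mul _) (hd.integrableOn.const_mul _),
      integral_sub (hρ.integrableOn.const_mul _) (hk.integrableOn.const_mul _),
      integral_const_mul, integral_const_mul, integral_const_mul, integral_const_mul,
      integral_const_mul, integral_const_mul] at e2
    have e3 := mul_le_mul_of_nonneg_left (mul_le_mul_of_nonneg_left e1 hβ) (hI0 t)
    linarith
  have h2 := setIntegral_mono_on (μ := volume)
    ((ha.integrableOn.mul_const _).sub (hc.integrableOn.mul_const _))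
    ((((hk.const_mul α).integrableOn.mul_const _).sub
      ((hρ.const_mul α).integrableOn.mul_const _)).add (hIi.integrableOn.mul_const _))
    measurableSet_Iic h1
  have e4 : ∫ t in Set.Iic y, I t = 1 := by
    rw [hI, setIntegral_indicator measurableSet_Ioc]
    have : Set.Iic y ∩ Set.Ioc (y - 1) y = Set.Ioc (y - 1) y := by
      ext x; simp only [Set.mem_inter_iff, Set.mem_Iic, Set.mem_Ioc]; tauto
    rw [this]; simp
  simp only [Pi.add_apply, Pi.sub_apply] at h2
  have e5 : ∫ t in Set.Iic y, ((α * k t) * (∫ u in Set.Ioi y, ρ u) -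
      (α * ρ t) * (∫ u in Set.Ioi y, k u) + I t * (β * ∫ u, ρ u)) =
      (∫ t in Set.Iic y, ((α * k t) * (∫ u in Set.Ioi y, ρ u) -
        (α * ρ t) * (∫ u in Set.Ioi y, k u))) + ∫ t in Set.Iic y, I t * (β * ∫ u, ρ u) :=
    integral_add (((hk.const_mul α).integrableOn.mul_const _).sub
      ((hρ.const_mul α).integrableOn.mul_const _)) (hIi.integrableOn.mul_const _)
  rw [e5, integral_sub (ha.integrableOn.mul_const _) (hc.integrableOn.mul_const _),
    integral_sub ((hk.const_mul α).integrableOn.mul_const _)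
      ((hρ.const_mul α).integrableOn.mul_const _),
    integral_mul_const, integral_mul_const, integral_mul_const, integral_mul_const,
    integral_mul_const, e4, integral_const_mul, integral_const_mul] at h2
  linarith

lemma deriv_nonneg_of_right {f : ℝ → ℝ} {f' : ℝ} (h : HasDerivAt f f' 0) (h0 : f 0 = 0)
    (hf : ∀ x, 0 ≤ x → 0 ≤ f x) : 0 ≤ f' := by
  refine ge_of_tendsto h.tendsto_slope_zero_right ?_
  filter_upwards [self_mem_nhdsWithin] with t ht
  simp only [zero_add, h0, sub_zero, smul_eq_mul]
  exact mul_nonneg (inv_nonneg.2 (le_of_lt ht)) (hf t (le_of_lt ht))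

lemma NiceD.hasDerivAt_partial {p p' Z : ℝ → ℝ} (hp : NiceD p p') (hZ : Nice Z) (y s : ℝ) :
    HasDerivAt (fun s => ∫ t in Set.Iic y, Z t * p (s - t))
      (∫ t in Set.Iic y, Z t * p' (s - t)) s :=
  hasDerivAt_setIntegral_cv hp hZ (S := Set.Iic y)
    ((continuous_partial_cv hp.int hp.cont hZ).comp (f := fun s : ℝ => (s, y)) (by fun_prop)) s

lemma NiceD.hasDerivAt_cv {p p' Z : ℝ → ℝ} (hp : NiceD p p') (hZ : Nice Z) (s : ℝ) :
    HasDerivAt (cv Z p) (∫ t, Z t * p' (s - t)) s := by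
  have := hasDerivAt_setIntegral_cv hp hZ (S := Set.univ)
    (by simpa using continuous_cv hp.int hp.cont hZ) s
  simp only [Measure.restrict_univ] at this
  exact this

lemma hasDerivAt_cdf {g : ℝ → ℝ} (hg : Integrable g) (hc : Continuous g) (y : ℝ) :
    HasDerivAt (fun y => ∫ x in Set.Iic y, g x) (g y) y := by
  have h : (fun r => ∫ x in Set.Iic r, g x) =
      fun r => (∫ x in Set.Iic (0:ℝ), g x) + ∫ x in (0:ℝ)..r, g x := by
    funext r
    have := intervalIntegral.integral_Iic_sub_Iic (a := 0) (b := r) (μ := volume) (f := g)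
      hg.integrableOn hg.integrableOn
    linarith
  rw [h]
  exact (intervalIntegral.integral_hasDerivAt_right hg.intervalIntegrable
    (hc.stronglyMeasurableAtFilter _ _) hc.continuousAt).const_add _

/-- Log-concave comparison: shifting the total sum cannot move the split faster. -/
lemma NiceD.partial_ge {q q' W : ℝ → ℝ} (hq : NiceD q q') (hW : Nice W) (hWl : LC W) (y s : ℝ) :
    0 ≤ ((∫ t in Set.Iic y, W t * q' (s - t)) + W y * q (s - y)) * cv W q s -
      (∫ t in Set.Iic y, W t * q (s - t)) * ∫ t, W t * q' (s - t) := by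
  set Φ : ℝ → ℝ := fun h => (∫ t in Set.Iic y, W t * q (s + h - t)) * cv W q s -
    (∫ t in Set.Iic (y - h), W t * q (s - t)) * cv W q (s + h) with hΦ
  refine deriv_nonneg_of_right (f := Φ) ?_ (by simp [hΦ]) ?_
  · have h1 : HasDerivAt (fun h => ∫ t in Set.Iic y, W t * q (s + h - t))
        (∫ t in Set.Iic y, W t * q' (s - t)) 0 := by
      have := hq.hasDerivAt_partial hW y (s + 0)
      simpa using this.comp_const_add s 0
    have h2 : HasDerivAt (fun h => cv W q (s + h)) (∫ t, W t * q' (s - t)) 0 := by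
      have := hq.hasDerivAt_cv hW (s + 0)
      simpa using this.comp_const_add s 0
    have h3 : HasDerivAt (fun h => ∫ t in Set.Iic (y - h), W t * q (s - t))
        (-(W y * q (s - y))) 0 := by
      have hWc := hW.cont
      have hqc := hq.nice.cont
      have := hasDerivAt_cdf (hW.mul_shift hq.nice s) (by fun_prop) (y - 0)
      simpa using this.comp_const_sub y 0
    have := (h1.mul_const (cv W q s)).sub (h3.mul h2)
    refine this.congr_deriv ?_
    simp
    ring
  · intro h hh
    have hi : Integrable fun x => W (x + h) * q (s + h - (x + h)) :=
      (hW.mul_shift hq.nice (s + h)).comp_add_right h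
    have := cdf_le_of_likelihood_ratio hi (hW.mul_shift hq.nice s) (fun a b hab => by
      have := hWl a b h hab hh
      rw [show s + h - (a + h) = s - a by ring, show s + h - (b + h) = s - b by ring]
      have h3 : 0 ≤ q (s - a) * q (s - b) := (mul_pos (hq.nice.pos _) (hq.nice.pos _)).le
      nlinarith [mul_le_mul_of_nonneg_left this h3]) (y - h)
    rw [integral_add_right_eq_self (fun x => W x * q (s + h - x)),
      ← integral_Iic_add (fun x => W x * q (s + h - x)), sub_add_cancel] at this
    change _ * cv W q (s + h) ≤ _ * cv W q s at this
    simp only [hΦ]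
    linarith

lemma LC.mul_reflect {W q : ℝ → ℝ} (hW : Nice W) (hq : Nice q) (hWl : LC W) (hql : LC q)
    (s : ℝ) : LC fun t => W t * q (s - t) := by
  intro a b t hab ht
  have h1 := hWl a b t hab ht
  have h2 := hql (s - (b + t)) (s - (a + t)) t (by linarith) ht
  rw [show s - (a + t) + t = s - a by ring, show s - (b + t) + t = s - b by ring] at h2
  have h3 := mul_le_mul h1 h2 (mul_pos (hq.pos _) (hq.pos _)).le
    (mul_pos (hW.pos _) (hW.pos _)).le
  simp only
  linarith

lemma setIntegral_Iic_add_Ioi {f : ℝ → ℝ} (hf : Integrable f) (y : ℝ) :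
    (∫ t in Set.Iic y, f t) + ∫ t in Set.Ioi y, f t = ∫ t, f t := by
  have := integral_add_compl (μ := volume) (measurableSet_Iic (a := y)) hf
  rwa [Set.compl_Iic] at this

set_option maxHeartbeats 1000000 in
/-- Speed of the quantiles for a bounded perturbation of a log-concave pair. -/
lemma split_estimate {p p' q q' Z W φ' d : ℝ → ℝ} {lam B M : ℝ} (hlam : 0 < lam) (hB : 0 ≤ B)
    (hM : 1 ≤ M) (hp : NiceD p p') (hq : NiceD q q') (hZ : Nice Z) (hW : Nice W)
    (hWl : LC W) (hql : LC q) (hq' : ∀ x, q' x = -φ' x * q x)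
    (hp' : ∀ x, p' x = -(φ' x + d x) * p x) (hd : ∀ x, |d x| ≤ B)
    (hφ : ∀ x y, x ≤ y → lam * (y - x) ≤ φ' y - φ' x)
    (hpq : ∀ x, p x ≤ M * q x) (hqp : ∀ x, q x ≤ M * p x)
    (hZW : ∀ x, Z x ≤ M * W x) (hWZ : ∀ x, W x ≤ M * Z x) (s y : ℝ) :
    |(∫ t in Set.Iic y, Z t * p' (s - t)) * cv Z p s -
      (∫ t in Set.Iic y, Z t * p (s - t)) * ∫ t, Z t * p' (s - t)| ≤
      M ^ 8 * (1 + 2 * B / lam + 2 * B) * (Z y * p (s - y)) * cv Z p s := by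
  have hM0 : 0 < M := by linarith
  set ρ : ℝ → ℝ := fun t => Z t * p (s - t) with hρ
  set a : ℝ → ℝ := fun t => Z t * p' (s - t) with ha
  set ρc : ℝ → ℝ := fun t => W t * q (s - t) with hρc
  set k : ℝ → ℝ := fun t => -(W t * q' (s - t)) with hk
  have iρ : Integrable ρ := hZ.mul_shift hp.nice s
  have ia : Integrable a := hZ.mul_int_shift hp.int s
  have iρc : Integrable ρc := hW.mul_shift hq.nice s
  have ik : Integrable k := (hW.mul_int_shift hq.int s).neg
  have pρ : ∀ t, 0 < ρ t := fun t => mul_pos (hZ.pos _) (hp.nice.pos _)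
  have pρc : ∀ t, 0 < ρc t := fun t => mul_pos (hW.pos _) (hq.nice.pos _)
  have c1 : ∀ t, ρ t ≤ M ^ 2 * ρc t := fun t => by
    have := mul_le_mul (hZW t) (hpq (s - t)) (hp.nice.pos _).le
      (mul_pos hM0 (hW.pos _)).le
    simp only [hρ, hρc]; nlinarith
  have c2 : ∀ t, ρc t ≤ M ^ 2 * ρ t := fun t => by
    have := mul_le_mul (hWZ t) (hqp (s - t)) (hq.nice.pos _).le
      (mul_pos hM0 (hZ.pos _)).le
    simp only [hρ, hρc]; nlinarith
  set α := M ^ 4 * (1 + 2 * B / lam) with hα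
  set β := M ^ 4 * (2 * B) * ρc y with hβ
  have hβ0 : 0 ≤ β := by have := (pρc y).le; positivity
  have key : ∀ t u, t ≤ y → y < u → |a t * ρ u - ρ t * a u| ≤ α * (k t * ρc u - ρc t * k u) +
      (Set.Ioc (y - 1) y).indicator (fun _ => (1:ℝ)) t * (β * ρc (t + u - y)) := by
    intro t u ht hu
    set g := φ' (s - t) - φ' (s - u) with hg
    have hgl : lam * (u - t) ≤ g := by
      have := hφ (s - u) (s - t) (by linarith)
      rw [hg]; linarith [show s - t - (s - u) = u - t by ring ▸ this]
    have hg0 : 0 ≤ g := le_trans (mul_nonneg hlam.le (by linarith)) hgl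
    have e1 : a t * ρ u - ρ t * a u = ρ t * ρ u * (-g - d (s - t) + d (s - u)) := by
      simp only [ha, hρ, hp', hg]; ring
    have e2 : k t * ρc u - ρc t * k u = ρc t * ρc u * g := by
      simp only [hk, hρc, hq', hg]; ring
    have e3 : |(-g - d (s - t) + d (s - u))| ≤ g + 2 * B := by
      have h1 := abs_le.1 (hd (s - t)); have h2 := abs_le.1 (hd (s - u))
      rw [abs_le]; constructor <;> linarith
    have T0 : 0 ≤ ρc t * ρc u := (mul_pos (pρc t) (pρc u)).le
    have e4 : ρ t * ρ u ≤ M ^ 4 * (ρc t * ρc u) := by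
      have := mul_le_mul (c1 t) (c1 u) (pρ u).le (mul_nonneg (by positivity) (pρc t).le)
      nlinarith
    have e5 : |a t * ρ u - ρ t * a u| ≤ M ^ 4 * (ρc t * ρc u) * (g + 2 * B) := by
      rw [e1, abs_mul, abs_of_pos (mul_pos (pρ t) (pρ u))]
      exact mul_le_mul e4 e3 (abs_nonneg _) (by positivity)
    rw [e2]
    refine e5.trans ?_
    have hαe : α * (ρc t * ρc u * g) = M ^ 4 * (ρc t * ρc u) * (g + 2 * B * (g / lam)) := by
      rw [hα]; field_simp
    rw [hαe]
    by_cases hty : t ≤ y - 1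
    · have : (Set.Ioc (y - 1) y).indicator (fun _ => (1:ℝ)) t = 0 :=
        Set.indicator_of_notMem (by simp [hty]) _
      rw [this, zero_mul, add_zero]
      have : 1 ≤ g / lam := by rw [le_div_iff₀ hlam]; nlinarith
      have h2 : 2 * B * 1 ≤ 2 * B * (g / lam) := by gcongr
      have : g + 2 * B ≤ g + 2 * B * (g / lam) := by linarith
      gcongr
    · have : (Set.Ioc (y - 1) y).indicator (fun _ => (1:ℝ)) t = 1 :=
        Set.indicator_of_mem (Set.mem_Ioc.2 ⟨by linarith, ht⟩) _
      rw [this, one_mul]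
      have h1 := LC.mul_reflect hW hq.nice hWl hql s t (t + u - y) (y - t) (by linarith)
        (by linarith)
      simp only at h1
      rw [show t + u - y + (y - t) = u by ring, show t + (y - t) = y by ring] at h1
      change ρc t * ρc u ≤ ρc y * ρc (t + u - y) at h1
      have h2 : 0 ≤ g / lam := by positivity
      have h3 : M ^ 4 * (2 * B) * (ρc t * ρc u) ≤ M ^ 4 * (2 * B) * (ρc y * ρc (t + u - y)) := by
        gcongr
      have h4 : 0 ≤ M ^ 4 * (ρc t * ρc u) * (2 * B * (g / lam)) := by positivity
      rw [hβ]; nlinarith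
  have I1 := double_integral_le ia iρ iρ ia ik iρc (fun x => (pρc x).le) hβ0
    fun t u ht hu => (le_abs_self _).trans (key t u ht hu)
  have I2 := double_integral_le (α := α) iρ ia ia iρ ik iρc (fun x => (pρc x).le) hβ0
    fun t u ht hu => by
      have := (neg_le_abs _).trans (key t u ht hu)
      linarith
  have sρ := setIntegral_Iic_add_Ioi iρ y
  have sa := setIntegral_Iic_add_Ioi ia y
  have sρc := setIntegral_Iic_add_Ioi iρc y
  have sk := setIntegral_Iic_add_Ioi ik y
  have P := hq.partial_ge hW hWl y s
  have k1 : ∫ t in Set.Iic y, k t = -∫ t in Set.Iic y, W t * q' (s - t) := integral_neg _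
  have k2 : ∫ t, k t = -∫ t, W t * q' (s - t) := integral_neg _
  change 0 ≤ (_ + ρc y) * (∫ t, ρc t) - (∫ t in Set.Iic y, ρc t) * _ at P
  change |_ * (∫ t, ρ t) - _| ≤ _ * ρ y * (∫ t, ρ t)
  set KU := ∫ t in Set.Iic y, k t
  set KV := ∫ t in Set.Ioi y, k t
  set RU := ∫ t in Set.Iic y, ρc t
  set RV := ∫ t in Set.Ioi y, ρc t
  set U := ∫ t in Set.Iic y, ρ t
  set V := ∫ t in Set.Ioi y, ρ t
  set U' := ∫ t in Set.Iic y, a t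
  set V' := ∫ t in Set.Ioi y, a t
  have Tc0 : 0 ≤ ∫ t, ρc t := integral_nonneg fun t => (pρc t).le
  have T0 : 0 ≤ ∫ t, ρ t := integral_nonneg fun t => (pρ t).le
  have TT : ∫ t, ρc t ≤ M ^ 2 * ∫ t, ρ t := by
    rw [← integral_const_mul]
    exact integral_mono iρc (iρ.const_mul _) c2
  have E1 : KU * RV - RU * KV ≤ ρc y * ∫ t, ρc t := by
    have : KU * RV - RU * KV = KU * (∫ t, ρc t) - RU * ∫ t, k t := by
      rw [← sρc, ← sk]; ring
    rw [this, k2, k1]; linarith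
  have hα0 : 0 ≤ α := by positivity
  have E2 : α * (KU * RV - RU * KV) + β * ∫ t, ρc t ≤
      M ^ 8 * (1 + 2 * B / lam + 2 * B) * ρ y * ∫ t, ρ t := by
    have h1 := mul_le_mul_of_nonneg_left E1 hα0
    have h2 : ρc y * (∫ t, ρc t) ≤ M ^ 4 * (ρ y * ∫ t, ρ t) := by
      have := mul_le_mul (c2 y) TT Tc0 (mul_nonneg (by positivity) (pρ y).le)
      nlinarith
    have h3 : M ^ 4 * (1 + 2 * B / lam + 2 * B) * (ρc y * ∫ t, ρc t) ≤
        M ^ 4 * (1 + 2 * B / lam + 2 * B) * (M ^ 4 * (ρ y * ∫ t, ρ t)) := by gcongr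
    calc _ ≤ M ^ 4 * (1 + 2 * B / lam + 2 * B) * (ρc y * ∫ t, ρc t) := by
          rw [hβ]; rw [hα] at h1 ⊢; nlinarith
      _ ≤ _ := h3
      _ = _ := by ring
  rw [← sa]
  rw [← sρ] at E2 ⊢
  rw [abs_le]
  constructor
  · linarith
  · linarith

/-- Quantiles of a bounded perturbation of a log-concave pair are Lipschitz in the total. -/
lemma quantile_lip_of_split {p p' Z : ℝ → ℝ} {C : ℝ} (hC : 0 ≤ C) (hp : NiceD p p') (hZ : Nice Z)
    (h : ∀ s y, |(∫ t in Set.Iic y, Z t * p' (s - t)) * cv Z p s -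
      (∫ t in Set.Iic y, Z t * p (s - t)) * ∫ t, Z t * p' (s - t)| ≤
      C * (Z y * p (s - y)) * cv Z p s)
    (s t w r r' : ℝ) (h1 : ∫ x in Set.Iic r, Z x * p (s - x) = w * cv Z p s)
    (h2 : ∫ x in Set.Iic r', Z x * p (t - x) = w * cv Z p t) :
    |r - r'| ≤ C * |s - t| ∧ |(s - r) - (t - r')| ≤ (1 + C) * |s - t| := by
  have hZc := hZ.cont
  have hpc := hp.nice.cont
  have hpos : ∀ s, 0 < cv Z p s := hZ.cv_pos hp.nice
  have main : ∀ ε : ℝ, ∀ r s, HasDerivAt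
      (fun s => (∫ x in Set.Iic (r + ε * s), Z x * p (s - x)) / cv Z p s)
      ((((∫ t in Set.Iic (r + ε * s), Z t * p' (s - t)) + ε *
        (Z (r + ε * s) * p (s - (r + ε * s)))) * cv Z p s -
      (∫ t in Set.Iic (r + ε * s), Z t * p (s - t)) * ∫ t, Z t * p' (s - t)) /
      (cv Z p s) ^ 2) s := by
    intro ε r s
    refine HasDerivAt.div ?_ (hp.hasDerivAt_cv hZ s) (hpos s).ne'
    refine hasDerivAt_along_line (f := fun s y => ∫ x in Set.Iic y, Z x * p (s - x))
      (g₁ := fun s y => ∫ x in Set.Iic y, Z x * p' (s - x)) (g₂ := fun s y => Z y * p (s - y))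
      (fun s y => hp.hasDerivAt_partial hZ y s) (fun s y => ?_)
      (continuous_partial_cv hp.int hp.cont hZ) (by fun_prop) r ε s
    exact hasDerivAt_cdf (hZ.mul_shift hp.nice s) (by fun_prop) y
  have mono : ∀ r, Monotone
      (fun s => (∫ x in Set.Iic (r + C * s), Z x * p (s - x)) / cv Z p s) := by
    intro r
    refine monotone_of_hasDerivAt_nonneg (main C r) fun s => ?_
    refine div_nonneg ?_ (sq_nonneg _)
    have := (abs_le.1 (h s (r + C * s))).1
    linarith
  have anti : ∀ r, Antitone
      (fun s => (∫ x in Set.Iic (r + (-C) * s), Z x * p (s - x)) / cv Z p s) := by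
    intro r
    refine antitone_of_hasDerivAt_nonpos (main (-C) r) fun s => ?_
    refine div_nonpos_of_nonpos_of_nonneg ?_ (sq_nonneg _)
    have := (abs_le.1 (h s (r + (-C) * s))).2
    linarith
  have key : ∀ s t r r', s ≤ t → ∫ x in Set.Iic r, Z x * p (s - x) = w * cv Z p s →
      ∫ x in Set.Iic r', Z x * p (t - x) = w * cv Z p t → |r - r'| ≤ C * (t - s) := by
    intro s t r r' hst h1 h2
    have sm := strictMono_cdf (fun x => mul_pos (hZ.pos x) (hp.nice.pos (t - x)))
      (hZ.mul_shift hp.nice t)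
    have a1 := mono (r - C * s) hst
    have a2 := anti (r + C * s) hst
    simp only at a1 a2
    rw [show r - C * s + C * s = r by ring, h1, mul_div_cancel_right₀ _ (hpos s).ne',
      le_div_iff₀ (hpos t), ← h2] at a1
    rw [show r + C * s + -C * s = r by ring, h1, mul_div_cancel_right₀ _ (hpos s).ne',
      div_le_iff₀ (hpos t), ← h2] at a2
    have b1 := sm.le_iff_le.1 a1
    have b2 := sm.le_iff_le.1 a2
    rw [abs_le]; constructor <;> linarith
  have fin : |r - r'| ≤ C * |s - t| := by
    rcases le_total s t with hst | hst
    · rw [abs_sub_comm s t, abs_of_nonneg (sub_nonneg.2 hst)]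
      exact key s t r r' hst h1 h2
    · rw [abs_of_nonneg (sub_nonneg.2 hst), abs_sub_comm]
      exact key t s r' r hst h2 h1
  refine ⟨fin, ?_⟩
  calc |(s - r) - (t - r')| = |(s - t) - (r - r')| := by ring_nf
    _ ≤ |s - t| + |r - r'| := abs_sub _ _
    _ ≤ _ := by linarith

/-- A potential `ψ` at `C¹`-distance at most `B` from a uniformly convex potential `φ`. -/
structure PertPot (lam B : ℝ) (φ φ' ψ ψ' : ℝ → ℝ) : Prop where
  conv : ConvPot lam φ φ'
  deriv : ∀ x, HasDerivAt ψ (ψ' x) x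
  cont : Continuous ψ'
  close : ∀ x, |ψ x - φ x| ≤ B
  close' : ∀ x, |ψ' x - φ' x| ≤ B

namespace PertPot
variable {lam B : ℝ} {φ φ' ψ ψ' : ℝ → ℝ}

lemma nonneg (h : PertPot lam B φ φ' ψ ψ') : 0 ≤ B := (abs_nonneg _).trans (h.close 0)

lemma tilt (h : PertPot lam B φ φ' ψ ψ') (b : ℝ) : PertPot lam B (fun x => φ x + b * x)
    (fun x => φ' x + b) (fun x => ψ x + b * x) (fun x => ψ' x + b) where
  conv := h.conv.tilt b
  deriv x := by simpa using (h.deriv x).fun_add ((hasDerivAt_id x).const_mul b)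
  cont := h.cont.add continuous_const
  close x := by simpa using h.close x
  close' x := by simpa using h.close' x

lemma continuous (h : PertPot lam B φ φ' ψ ψ') : Continuous ψ :=
  continuous_iff_continuousAt.2 fun x => (h.deriv x).continuousAt

lemma le (h : PertPot lam B φ φ' ψ ψ') (x : ℝ) : exp (-ψ x) ≤ exp B * exp (-φ x) := by
  rw [← exp_add]
  exact exp_le_exp.2 (by have := (abs_le.1 (h.close x)).1; linarith)

lemma ge (h : PertPot lam B φ φ' ψ ψ') (x : ℝ) : exp (-φ x) ≤ exp B * exp (-ψ x) := by
  rw [← exp_add]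
  exact exp_le_exp.2 (by have := (abs_le.1 (h.close x)).2; linarith)

lemma nice (h : PertPot lam B φ φ' ψ ψ') : Nice fun x => exp (-ψ x) where
  pos x := exp_pos _
  cont := by have := h.continuous; fun_prop
  int := by
    refine (h.conv.integrable.const_mul (exp B)).mono' ?_ ?_
    · have := h.continuous
      exact Continuous.aestronglyMeasurable (by fun_prop)
    · refine Filter.Eventually.of_forall fun x => ?_
      rw [Real.norm_of_nonneg (exp_pos _).le]
      exact h.le x
  bdd := by
    obtain ⟨M, hM⟩ := h.conv.nice.bdd
    exact ⟨exp B * M, fun x => (h.le x).trans (by gcongr; exact hM x)⟩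

lemma abs_deriv_le (h : PertPot lam B φ φ' ψ ψ') (x : ℝ) :
    |-ψ' x * exp (-ψ x)| ≤ exp B * (|-φ' x * exp (-φ x)| + B * exp (-φ x)) := by
  rw [abs_mul, abs_mul, abs_neg, abs_neg, abs_of_pos (exp_pos _), abs_of_pos (exp_pos _)]
  have h1 : |ψ' x| ≤ |φ' x| + B := by
    have := abs_add_le (φ' x) (ψ' x - φ' x)
    rw [add_sub_cancel] at this
    linarith [h.close' x]
  calc |ψ' x| * exp (-ψ x) ≤ (|φ' x| + B) * (exp B * exp (-φ x)) :=
        mul_le_mul h1 (h.le x) (exp_pos _).le (by have := h.nonneg; positivity)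
    _ = _ := by ring

lemma niceD (h : PertPot lam B φ φ' ψ ψ') :
    NiceD (fun x => exp (-ψ x)) fun x => -ψ' x * exp (-ψ x) where
  nice := h.nice
  deriv x := by
    refine ((h.deriv x).fun_neg.exp).congr_deriv ?_
    ring
  cont := by have := h.continuous; have := h.cont; fun_prop
  int := by
    refine ((h.conv.integrable_deriv.abs.add (h.conv.integrable.const_mul B)).const_mul
      (exp B)).mono' ?_ (Filter.Eventually.of_forall fun x => h.abs_deriv_le x)
    have := h.continuous; have := h.cont
    exact Continuous.aestronglyMeasurable (by fun_prop)

end PertPot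

lemma ConvPot.niceD {lam : ℝ} {φ φ' : ℝ → ℝ} (h : ConvPot lam φ φ') :
    NiceD (fun x => exp (-φ x)) fun x => -φ' x * exp (-φ x) :=
  PertPot.niceD (B := 0) ⟨h, h.deriv, h.cont, by simp, by simp⟩

lemma cv_le_cv {Z W p q : ℝ → ℝ} {M M' : ℝ} (hM : 0 ≤ M) (hZ : Nice Z) (hW : Nice W)
    (hp : Nice p) (hq : Nice q) (h : ∀ x, Z x ≤ M * W x) (h' : ∀ x, p x ≤ M' * q x) (s : ℝ) :
    cv Z p s ≤ M * M' * cv W q s := by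
  rw [cv, cv, ← integral_const_mul]
  refine integral_mono (hZ.mul_shift hp s) ((hW.mul_shift hq s).const_mul _) fun t => ?_
  have := mul_le_mul (h t) (h' (s - t)) (hp.pos _).le (mul_nonneg hM (hW.pos _).le)
  simp only
  linarith

/-- Product densities with perturbed convex potentials have Lipschitz samples. -/
lemma exists_samples_of_pertPot {lam B : ℝ} (hlam : 0 < lam) (hB : 0 ≤ B) (n : ℕ) :
    ∃ A : ℝ, 0 ≤ A ∧ ∀ φ φ' ψ ψ' : Fin (n + 1) → ℝ → ℝ,
      (∀ i, PertPot lam B (φ i) (φ' i) (ψ i) (ψ' i)) →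
      ∃ Z W, Nice Z ∧ Nice W ∧ LC W ∧ (∀ x, Z x ≤ exp ((n + 1) * B) * W x) ∧
        (∀ x, W x ≤ exp ((n + 1) * B) * Z x) ∧ Samples (fun i x => exp (-ψ i x)) Z A := by
  induction n with
  | zero =>
    refine ⟨1, zero_le_one, fun φ φ' ψ ψ' h => ⟨fun x => exp (-ψ 0 x), fun x => exp (-φ 0 x),
      (h 0).nice, (h 0).conv.nice, (h 0).conv.lc, ?_, ?_, ?_⟩⟩
    · simpa using (h 0).le
    · simpa using (h 0).ge
    · exact Samples.single (ι := Fin 1) (p := fun i x => exp (-ψ i x)) (h 0).nice.cont.measurable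
  | succ n ih =>
    obtain ⟨A, hA, ih⟩ := ih
    set M := exp ((n + 1) * B) with hM
    have hM1 : 1 ≤ M := one_le_exp (by positivity)
    have hBM : exp B ≤ M := exp_le_exp.2 (by nlinarith [(n.cast_nonneg : (0:ℝ) ≤ n)])
    set C := M ^ 8 * (1 + 2 * B / lam + 2 * B) with hC
    have hC0 : 0 ≤ C := by positivity
    refine ⟨max (A * C) (1 * (1 + C)), le_max_of_le_left (by positivity), fun φ φ' ψ ψ' h => ?_⟩
    obtain ⟨Z, W, hZ, hW, hWl, hZW, hWZ, hS⟩ := ih (fun i => φ i.castSucc) (fun i => φ' i.castSucc)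
      (fun i => ψ i.castSucc) (fun i => ψ' i.castSucc) fun i => h _
    have hl := h (Fin.last _)
    set p := fun x => exp (-ψ (Fin.last _) x) with hp
    set q := fun x => exp (-φ (Fin.last _) x) with hq
    have hMM : exp ((((n + 1 : ℕ) : ℝ) + 1) * B) = M * exp B := by
      rw [hM, ← exp_add]; congr 1; push_cast; ring
    refine ⟨cv Z p, cv W q, hZ.cv hl.nice, hW.cv hl.conv.nice,
      LC_cv hW hl.conv.nice hWl hl.conv.lc, fun x => ?_, fun x => ?_, ?_⟩
    · rw [hMM]
      exact cv_le_cv (by positivity) hZ hW hl.nice hl.conv.nice hZW hl.le x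
    · rw [hMM]
      exact cv_le_cv (by positivity) hW hZ hl.conv.nice hl.nice hWZ hl.ge x
    · have hsplit := split_estimate (d := fun x => ψ' (Fin.last _) x - φ' (Fin.last _) x)
        hlam hB hM1 hl.niceD hl.conv.niceD hZ hW hWl hl.conv.lc
        (fun x => rfl) (fun x => by ring) hl.close' hl.conv.mono
        (fun x => (hl.le x).trans (by gcongr)) (fun x => (hl.ge x).trans (by gcongr)) hZW hWZ
      have h1 : Samples (ι := Fin 1) (fun i => p) p 1 :=
        Samples.single (ι := Fin 1) (p := fun i => p) hl.nice.cont.measurable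
      have := Samples.node hA zero_le_one (fun i => (h _).nice.cont.measurable)
        (fun i => hl.nice.cont.measurable) hZ hl.nice hS h1
        (quantile_lip_of_split hC0 hl.niceD hZ hsplit)
      refine Samples.reindex (finSumFinEquiv (m := n + 1) (n := 1))
        (fun i => (h i).nice.cont.measurable) ?_
      convert this using 1
      funext i
      rcases i with i | i
      · simp; rfl
      · have : i = 0 := Subsingleton.elim _ _
        subst this
        simp [hp]; rfl

/-- Fourier transform of a real function on the line. -/
def ft (g : ℝ → ℝ) (z : ℝ) : ℂ := ∫ y, Complex.exp ((-2 * π * y * z : ℝ) * Complex.I) * (g y : ℂ)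

lemma ft_eq_fourier (g : ℝ → ℝ) (z : ℝ) :
    ft g z = FourierTransform.fourier (fun y => (g y : ℂ)) z := by
  rw [fourier_real_eq_integral_exp_smul]; rfl

lemma integrable_exp_mul {g : ℝ → ℝ} (hg : Integrable g) (z : ℝ) :
    Integrable fun y => Complex.exp ((-2 * π * y * z : ℝ) * Complex.I) * (g y : ℂ) := by
  refine hg.ofReal.bdd_mul (c := 1) ?_ ?_
  · exact Continuous.aestronglyMeasurable (by fun_prop)
  · exact Filter.Eventually.of_forall fun y => (Complex.norm_exp_ofReal_mul_I _).le

lemma continuous_ft {g : ℝ → ℝ} (hg : Integrable g) : Continuous (ft g) := by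
  refine continuous_of_dominated (bound := fun y => |g y|) ?_ ?_ hg.abs ?_
  · exact fun z => (integrable_exp_mul hg z).aestronglyMeasurable
  · refine fun z => Filter.Eventually.of_forall fun y => ?_
    rw [norm_mul, Complex.norm_exp_ofReal_mul_I, one_mul, Complex.norm_real, Real.norm_eq_abs]
  · refine Filter.Eventually.of_forall fun y => ?_
    fun_prop

lemma norm_ft_le (g : ℝ → ℝ) (z : ℝ) : ‖ft g z‖ ≤ ∫ y, |g y| := by
  refine (norm_integral_le_integral_norm _).trans_eq ?_
  refine integral_congr_ae (Filter.Eventually.of_forall fun y => ?_)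
  simp only [norm_mul, Complex.norm_exp_ofReal_mul_I, one_mul, Complex.norm_real,
    Real.norm_eq_abs]

lemma NiceD.norm_ft_mul_le {g g' : ℝ → ℝ} (h : NiceD g g') (z : ℝ) :
    |z| * ‖ft g z‖ ≤ ∫ y, |g' y| := by
  have hd : _root_.deriv (fun y => (g y : ℂ)) = fun y => (g' y : ℂ) :=
    funext fun y => ((h.deriv y).ofReal_comp).deriv
  have h1 := congrFun (Real.fourier_deriv (f := fun y => (g y : ℂ)) h.nice.int.ofReal
    (fun y => ((h.deriv y).ofReal_comp).differentiableAt) (by rw [hd]; exact h.int.ofReal)) z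
  rw [hd, ← ft_eq_fourier, ← ft_eq_fourier] at h1
  have h2 := norm_ft_le g' z
  rw [h1, norm_smul] at h2
  simp only [norm_mul, Complex.norm_ofNat, Complex.norm_real, Complex.norm_I, mul_one,
    Real.norm_eq_abs, abs_of_pos pi_pos] at h2
  have : |z| * ‖ft g z‖ ≤ 2 * π * |z| * ‖ft g z‖ := by
    have := pi_gt_three
    have h0 : 0 ≤ |z| * ‖ft g z‖ := by positivity
    nlinarith
  linarith

lemma re_exp_mul_ft {g : ℝ → ℝ} (hg : Integrable g) (a z : ℝ) :
    (Complex.exp (a * Complex.I) * ft g z).re = ∫ y, cos (a - 2 * π * y * z) * g y := by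
  rw [ft, ← integral_const_mul, ← Complex.reCLM_apply,
    ← Complex.reCLM.integral_comp_comm ((integrable_exp_mul hg z).const_mul _)]
  refine integral_congr_ae (Filter.Eventually.of_forall fun y => ?_)
  simp only [Complex.reCLM_apply]
  rw [← mul_assoc, ← Complex.exp_add, ← add_mul, ← Complex.ofReal_add, Complex.re_mul_ofReal,
    Complex.exp_ofReal_mul_I_re]
  congr 2; ring

lemma one_sub_norm_ft_two_mul {g : ℝ → ℝ} (hg : Integrable g) (h0 : ∀ y, 0 ≤ g y)
    (h1 : ∫ y, g y = 1) (z : ℝ) : 1 - ‖ft g (2 * z)‖ ≤ 4 * (1 - ‖ft g z‖) := by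
  set a := -(ft g z).arg with ha
  have e1 : ‖ft g z‖ = (Complex.exp (a * Complex.I) * ft g z).re := by
    have h2 : (ft g z) = ‖ft g z‖ * Complex.exp ((ft g z).arg * Complex.I) :=
      (Complex.norm_mul_exp_arg_mul_I _).symm
    conv_rhs => rw [h2]
    rw [mul_left_comm, ← Complex.exp_add, ha]
    simp
  have e2 : (Complex.exp ((2 * a : ℝ) * Complex.I) * ft g (2 * z)).re ≤ ‖ft g (2 * z)‖ := by
    refine (Complex.re_le_norm _).trans ?_
    rw [norm_mul, Complex.norm_exp_ofReal_mul_I, one_mul]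
  rw [re_exp_mul_ft hg] at e1 e2
  have ic : ∀ b w, Integrable fun y => cos (b - 2 * π * y * w) * g y := fun b w => by
    refine hg.bdd_mul (c := 1) (Continuous.aestronglyMeasurable (by fun_prop)) ?_
    exact Filter.Eventually.of_forall fun y => by simpa using abs_cos_le_one _
  have e3 : ∫ y, (g y - cos (2 * a - 2 * π * y * (2 * z)) * g y) ≤
      ∫ y, 4 * (g y - cos (a - 2 * π * y * z) * g y) := by
    refine integral_mono (hg.sub (ic _ _)) ((hg.sub (ic _ _)).const_mul _) fun y => ?_
    simp only
    rw [show 2 * a - 2 * π * y * (2 * z) = 2 * (a - 2 * π * y * z) by ring, cos_two_mul]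
    have := mul_nonneg (sq_nonneg (1 - cos (a - 2 * π * y * z))) (h0 y)
    nlinarith
  rw [integral_const_mul, integral_sub hg (ic _ _), integral_sub hg (ic _ _), h1] at e3
  linarith

lemma one_sub_norm_ft_pow {g : ℝ → ℝ} (hg : Integrable g) (h0 : ∀ y, 0 ≤ g y)
    (h1 : ∫ y, g y = 1) (j : ℕ) (z : ℝ) :
    1 - ‖ft g (2 ^ j * z)‖ ≤ 4 ^ j * (1 - ‖ft g z‖) := by
  induction j with
  | zero => simp
  | succ j ih =>
    have := one_sub_norm_ft_two_mul hg h0 h1 (2 ^ j * z)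
    rw [pow_succ', mul_assoc, pow_succ']
    linarith

/-- A probability density with mean zero and quantitative smoothness and moment bounds. -/
structure GoodDens (C : ℝ) (g g' : ℝ → ℝ) : Prop where
  niceD : NiceD g g'
  int_one : ∫ y, g y = 1
  int_cube : Integrable fun y => |y| ^ 3 * g y
  mean : ∫ y, y * g y = 0
  cube : ∫ y, |y| ^ 3 * g y ≤ C
  tv : ∫ y, |g' y| ≤ C

namespace GoodDens
variable {C : ℝ} {g g' : ℝ → ℝ}

lemma int_pow (h : GoodDens C g g') {k : ℕ} (hk : k ≤ 3) : Integrable fun y => |y| ^ k * g y := by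
  refine (h.niceD.nice.int.add h.int_cube).mono' ?_ (Filter.Eventually.of_forall fun y => ?_)
  · have := h.niceD.nice.cont
    exact Continuous.aestronglyMeasurable (by fun_prop)
  · have hg := h.niceD.nice.pos y
    rw [Real.norm_of_nonneg (by positivity)]
    have : |y| ^ k ≤ 1 + |y| ^ 3 := by
      rcases le_total |y| 1 with h1 | h1
      · have := pow_le_one₀ (n := k) (abs_nonneg y) h1
        have : 0 ≤ |y| ^ 3 := by positivity
        linarith
      · have := pow_le_pow_right₀ h1 hk
        linarith
    simp only [Pi.add_apply]
    nlinarith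

lemma norm_le (h : GoodDens C g g') (hC : 1 ≤ C) (z : ℝ) :
    ‖ft g z‖ ≤ 1 - min 1 (z ^ 2) / (32 * C ^ 2) := by
  have hC0 : 0 < C := by linarith
  have big : ∀ w, 2 * C ≤ |w| → ‖ft g w‖ ≤ 1 / 2 := fun w hw => by
    have := (h.niceD.norm_ft_mul_le w).trans h.tv
    have h2 : 2 * C * ‖ft g w‖ ≤ |w| * ‖ft g w‖ := by gcongr
    nlinarith
  have gp := fun y => (h.niceD.nice.pos y).le
  have dj := one_sub_norm_ft_pow h.niceD.nice.int gp h.int_one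
  by_cases hz : 2 * C ≤ |z|
  · have := big z hz
    have h2 : min 1 (z ^ 2) / (32 * C ^ 2) ≤ 1 / 2 := by
      rw [div_le_iff₀ (by positivity)]
      have := min_le_left 1 (z ^ 2)
      nlinarith
    linarith
  push Not at hz
  rcases eq_or_ne z 0 with rfl | hz0
  · have := norm_ft_le g 0
    simp only [abs_of_nonneg (gp _), h.int_one] at this
    simpa using this
  have hzp : 0 < |z| := abs_pos.2 hz0
  obtain ⟨n, hn1, hn2⟩ := exists_nat_pow_near (x := 2 * C / |z|) (y := (2:ℝ))
    (by rw [le_div_iff₀ hzp]; linarith) one_lt_two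
  rw [le_div_iff₀ hzp] at hn1
  rw [div_lt_iff₀ hzp] at hn2
  have h1 := big (2 ^ (n + 1) * z) (by
    rw [abs_mul, abs_of_pos (by positivity : (0:ℝ) < 2 ^ (n + 1))]; exact hn2.le)
  have h2 := dj (n + 1) z
  have h3 : (4:ℝ) ^ (n + 1) * z ^ 2 ≤ 16 * C ^ 2 := by
    have : (2 ^ n * |z|) ^ 2 ≤ (2 * C) ^ 2 := by gcongr
    rw [mul_pow, sq_abs, ← pow_mul, mul_comm n 2, pow_mul] at this
    norm_num at this
    rw [pow_succ]; nlinarith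
  have h5 : 0 ≤ 1 - ‖ft g z‖ := by
    have := norm_ft_le g z
    simp only [abs_of_nonneg (gp _), h.int_one] at this
    linarith
  have h4 : min 1 (z ^ 2) / (32 * C ^ 2) ≤ 1 - ‖ft g z‖ := by
    refine (div_le_div_of_nonneg_right (min_le_right _ _) (by positivity)).trans ?_
    rw [div_le_iff₀ (by positivity)]
    have h6 : z ^ 2 * (1 / 2) ≤ z ^ 2 * (4 ^ (n + 1) * (1 - ‖ft g z‖)) := by
      gcongr; linarith
    nlinarith [mul_le_mul_of_nonneg_right h3 h5]
  linarith

end GoodDens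

lemma norm_exp_sub_taylor_le (u : ℝ) :
    ‖Complex.exp (u * Complex.I) - (1 + u * Complex.I - (u : ℂ) ^ 2 / 2)‖ ≤ 4 * |u| ^ 3 := by
  rcases le_total |u| 1 with h | h
  · have := Complex.exp_bound (x := u * Complex.I) (by simpa using h) (n := 3) (by norm_num)
    have e : ∑ m ∈ Finset.range 3, ((u : ℂ) * Complex.I) ^ m / (m.factorial : ℂ) =
        1 + u * Complex.I - (u : ℂ) ^ 2 / 2 := by
      simp [Finset.sum_range_succ, mul_pow]; ring
    rw [e] at this
    refine this.trans ?_
    simp only [norm_mul, Complex.norm_real, Complex.norm_I, mul_one, Real.norm_eq_abs]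
    rw [mul_comm]
    gcongr
    norm_num [Nat.factorial]
  · calc _ ≤ ‖Complex.exp (u * Complex.I)‖ + ‖(1 + u * Complex.I - (u : ℂ) ^ 2 / 2)‖ :=
          norm_sub_le _ _
      _ ≤ 1 + ((‖(1:ℂ)‖ + ‖(u : ℂ) * Complex.I‖) + ‖(u : ℂ) ^ 2 / 2‖) := by
          rw [Complex.norm_exp_ofReal_mul_I]
          gcongr
          exact (norm_sub_le _ _).trans (by gcongr; exact norm_add_le _ _)
      _ = 1 + (1 + |u| + |u| ^ 2 / 2) := by simp
      _ ≤ _ := by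
          have h2 : |u| ≤ |u| ^ 3 := le_self_pow₀ h (by norm_num)
          have h3 : |u| ^ 2 ≤ |u| ^ 3 := pow_le_pow_right₀ h (by norm_num)
          linarith

lemma GoodDens.taylor {C : ℝ} {g g' : ℝ → ℝ} (h : GoodDens C g g') (z : ℝ) :
    ‖ft g z - ((1 - (4 * π ^ 2 * ∫ y, |y| ^ 2 * g y) * z ^ 2 / 2 : ℝ) : ℂ)‖ ≤
      4 * (2 * π) ^ 3 * C * |z| ^ 3 := by
  have gp := fun y => (h.niceD.nice.pos y).le
  have i0 := h.niceD.nice.int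
  have i2 := h.int_pow (k := 2) (by norm_num)
  have i1 : Integrable fun y => y * g y := by
    refine (h.int_pow (k := 1) (by norm_num)).mono' ?_ (Filter.Eventually.of_forall fun y => ?_)
    · have := h.niceD.nice.cont
      exact Continuous.aestronglyMeasurable (by fun_prop)
    · rw [norm_mul, Real.norm_eq_abs, Real.norm_of_nonneg (gp y), pow_one]
  have e1 : ((1 - (4 * π ^ 2 * ∫ y, |y| ^ 2 * g y) * z ^ 2 / 2 : ℝ) : ℂ) =
      ∫ y, (((g y : ℝ) : ℂ) + (-2 * π * z * Complex.I) * ((y * g y : ℝ) : ℂ) -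
        ((2 * π ^ 2 * z ^ 2 : ℝ) : ℂ) * ((|y| ^ 2 * g y : ℝ) : ℂ)) := by
    rw [integral_sub (i0.ofReal.add (i1.ofReal.const_mul _)) (i2.ofReal.const_mul _),
      integral_add i0.ofReal (i1.ofReal.const_mul _), integral_const_mul, integral_const_mul,
      integral_complex_ofReal, integral_complex_ofReal, integral_complex_ofReal, h.int_one, h.mean]
    push_cast; ring
  have iF : Integrable fun y => (((g y : ℝ) : ℂ) +
      (-2 * π * z * Complex.I) * ((y * g y : ℝ) : ℂ) -
        ((2 * π ^ 2 * z ^ 2 : ℝ) : ℂ) * ((|y| ^ 2 * g y : ℝ) : ℂ)) :=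
    (i0.ofReal.add (i1.ofReal.const_mul _)).sub (i2.ofReal.const_mul _)
  rw [e1, ft, ← integral_sub (integrable_exp_mul i0 z) iF]
  calc _ ≤ ∫ y, 4 * (2 * π) ^ 3 * |z| ^ 3 * (|y| ^ 3 * g y) := by
        refine norm_integral_le_of_norm_le (h.int_cube.const_mul _)
          (Filter.Eventually.of_forall fun y => ?_)
        have := norm_exp_sub_taylor_le (-2 * π * y * z)
        have e2 : Complex.exp ((-2 * π * y * z : ℝ) * Complex.I) * (g y : ℂ) -
            (((g y : ℝ) : ℂ) + (-2 * π * z * Complex.I) * ((y * g y : ℝ) : ℂ) -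
        ((2 * π ^ 2 * z ^ 2 : ℝ) : ℂ) * ((|y| ^ 2 * g y : ℝ) : ℂ)) =
          (Complex.exp ((-2 * π * y * z : ℝ) * Complex.I) -
            (1 + (-2 * π * y * z : ℝ) * Complex.I - ((-2 * π * y * z : ℝ) : ℂ) ^ 2 / 2)) *
            (g y : ℂ) := by
          rw [sq_abs]; push_cast; ring
        rw [e2, norm_mul, Complex.norm_real, Real.norm_of_nonneg (gp y)]
        calc _ ≤ 4 * |-2 * π * y * z| ^ 3 * g y := by gcongr; exact gp y
          _ = _ := by
            rw [abs_mul, abs_mul, abs_mul, abs_neg, abs_of_pos pi_pos,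
              abs_of_pos (by norm_num : (0:ℝ) < 2)]; ring
    _ = 4 * (2 * π) ^ 3 * |z| ^ 3 * ∫ y, |y| ^ 3 * g y := integral_const_mul _ _
    _ ≤ 4 * (2 * π) ^ 3 * |z| ^ 3 * C := by gcongr; exact h.cube
    _ = _ := by ring

lemma GoodDens.var_le {C : ℝ} {g g' : ℝ → ℝ} (h : GoodDens C g g') :
    0 ≤ ∫ y, |y| ^ 2 * g y ∧ ∫ y, |y| ^ 2 * g y ≤ 1 + C := by
  have gp := fun y => (h.niceD.nice.pos y).le
  refine ⟨integral_nonneg fun y => mul_nonneg (by positivity) (gp y), ?_⟩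
  calc _ ≤ ∫ y, (g y + |y| ^ 3 * g y) := by
        refine integral_mono (h.int_pow (by norm_num)) (h.niceD.nice.int.add h.int_cube)
          fun y => ?_
        have : |y| ^ 2 ≤ 1 + |y| ^ 3 := by
          nlinarith [abs_nonneg y, sq_nonneg (|y| - 1), mul_nonneg (abs_nonneg y) (sq_nonneg (|y| - 1))]
        have := mul_le_mul_of_nonneg_right this (gp y)
        simp only
        linarith
    _ = 1 + ∫ y, |y| ^ 3 * g y := by rw [integral_add h.niceD.nice.int h.int_cube, h.int_one]
    _ ≤ _ := by linarith [h.cube]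

lemma norm_prod_sub_prod_mul_le {ι : Type} (s : Finset ι) {h g : ι → ℂ} {M ε : ℝ} (hM : 0 ≤ M)
    (hh : ∀ i, ‖h i‖ ≤ M) (hg : ∀ i, ‖g i‖ ≤ M) (hε : ∀ i, ‖h i - g i‖ ≤ ε) :
    M * ‖∏ i ∈ s, h i - ∏ i ∈ s, g i‖ ≤ s.card * ε * M ^ s.card := by
  classical
  induction s using Finset.induction_on with
  | empty => simp
  | insert a s ha ih =>
    rw [Finset.prod_insert ha, Finset.prod_insert ha, Finset.card_insert_of_notMem ha]
    have e : h a * ∏ i ∈ s, h i - g a * ∏ i ∈ s, g i =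
      (h a - g a) * ∏ i ∈ s, h i + g a * (∏ i ∈ s, h i - ∏ i ∈ s, g i) := by ring
    have hp : ‖∏ i ∈ s, h i‖ ≤ M ^ s.card := by
      rw [norm_prod]
      exact (Finset.prod_le_prod (fun i _ => norm_nonneg _) fun i _ => hh i).trans_eq (by simp)
    have hε0 : 0 ≤ ε := (norm_nonneg _).trans (hε a)
    have h1 : ‖(h a - g a) * ∏ i ∈ s, h i‖ ≤ ε * M ^ s.card := by
      rw [norm_mul]; exact mul_le_mul (hε a) hp (norm_nonneg _) hε0
    have h2 : ‖g a * (∏ i ∈ s, h i - ∏ i ∈ s, g i)‖ ≤ M * ‖∏ i ∈ s, h i - ∏ i ∈ s, g i‖ := by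
      rw [norm_mul]; exact mul_le_mul_of_nonneg_right (hg a) (norm_nonneg _)
    have h3 : ‖h a * ∏ i ∈ s, h i - g a * ∏ i ∈ s, g i‖ ≤
        ε * M ^ s.card + s.card * ε * M ^ s.card := by
      rw [e]; exact (norm_add_le _ _).trans (add_le_add h1 (h2.trans ih))
    calc _ ≤ M * (ε * M ^ s.card + s.card * ε * M ^ s.card) := by gcongr
      _ = _ := by push_cast; ring

lemma sq_mul_norm_prod_le {k : ℕ} (hk : 4 ≤ k) {h : Fin k → ℂ} {z C ρ : ℝ} (hC : 1 ≤ C)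
    (hρ : ρ ≤ 1) (h1 : ∀ i, ‖h i‖ ≤ ρ) (h2 : ∀ i, |z| * ‖h i‖ ≤ C) :
    z ^ 2 * ‖∏ i, h i‖ ≤ ρ ^ (k - 4) * (2 * C ^ 4 * (1 + z ^ 2)⁻¹) := by
  have hρ0 : 0 ≤ ρ := (norm_nonneg _).trans (h1 ⟨0, by omega⟩)
  rcases eq_or_ne z 0 with rfl | hz
  · simp; positivity
  have hzp : 0 < |z| := abs_pos.2 hz
  set R := min ρ (C / |z|) with hR
  have hR0 : 0 ≤ R := le_min hρ0 (by positivity)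
  have hR1 : R ≤ ρ := min_le_left _ _
  have hR2 : R * |z| ≤ C := (le_div_iff₀ hzp).1 (min_le_right _ _)
  have hp : ‖∏ i, h i‖ ≤ R ^ k := by
    rw [norm_prod]
    have hR' : ∀ i, ‖h i‖ ≤ R := fun i =>
      le_min (h1 i) (by rw [le_div_iff₀ hzp, mul_comm]; exact h2 i)
    exact (Finset.prod_le_prod (fun i _ => norm_nonneg _) fun i _ => hR' i).trans_eq (by simp)
  have hk' : R ^ k ≤ ρ ^ (k - 4) * R ^ 4 := by
    conv_lhs => rw [show k = (k - 4) + 4 by omega, pow_add]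
    gcongr
  have h5 : (1 + z ^ 2) * z ^ 2 * R ^ 4 ≤ 2 * C ^ 4 := by
    have a1 : (R * |z|) ^ 2 ≤ C ^ 2 := by gcongr
    have a2 : (R * |z|) ^ 4 ≤ C ^ 4 := by gcongr
    have a3 : C ^ 2 ≤ C ^ 4 := pow_le_pow_right₀ hC (by norm_num)
    have a4 : R ^ 2 ≤ 1 := pow_le_one₀ hR0 (hR1.trans hρ)
    have a5 : (R * |z|) ^ 4 = z ^ 4 * R ^ 4 := by
      rw [mul_pow, show |z| ^ 4 = (|z| ^ 2) ^ 2 by ring, sq_abs]; ring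
    rw [mul_pow, sq_abs] at a1
    have a6 : R ^ 2 * (R ^ 2 * z ^ 2) ≤ 1 * C ^ 2 :=
      mul_le_mul a4 a1 (by positivity) zero_le_one
    rw [a5] at a2
    nlinarith
  calc _ ≤ z ^ 2 * (ρ ^ (k - 4) * R ^ 4) := by gcongr; exact hp.trans hk'
    _ = ρ ^ (k - 4) * (((1 + z ^ 2) * z ^ 2 * R ^ 4) * (1 + z ^ 2)⁻¹) := by
        have : (1 + z ^ 2) ≠ 0 := by positivity
        field_simp
    _ ≤ _ := by gcongr

/-- Pointwise lower bound for the integrand of the second derivative at the peak. -/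
lemma re_sq_mul_prod_ge {k : ℕ} (hk : 4 ≤ k) {h : Fin k → ℂ} {v : Fin k → ℝ} {z C c : ℝ}
    (hC : 1 ≤ C) (hc : 0 < c) (hc1 : c ≤ 1) (hkC : 4 * C ≤ c ^ 2 * k) (hv : ∀ i, 0 ≤ v i ∧ v i ≤ C)
    (h1 : ∀ i, |z| * ‖h i‖ ≤ C) (h2 : ∀ i, ‖h i‖ ≤ 1 - c * min 1 (z ^ 2))
    (h3 : ∀ i, ‖h i - ((1 - v i * z ^ 2 / 2 : ℝ) : ℂ)‖ ≤ C * |z| ^ 3) :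
    (Set.Ioc 0 (1 / √(k * C))).indicator (fun z : ℝ => z ^ 2 / 2) z
      - 2 * k * C * (|z| ^ 5 * exp (-(c * k / 2) * z ^ 2))
      - (1 - c * (c / (2 * C)) ^ 2) ^ (k - 4) * (2 * C ^ 4 * (1 + z ^ 2)⁻¹) ≤
    ((z : ℂ) ^ 2 * ∏ i, h i).re := by
  have hk0 : (0:ℝ) < k := by positivity
  have hC0 : 0 < C := by linarith
  set c0 := c / (2 * C) with hc0
  have hc00 : 0 < c0 := by positivity
  have hc0h : c0 ≤ 1 / 2 := by rw [hc0, div_le_div_iff₀ (by positivity) (by norm_num)]; linarith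
  have hρ1 : 1 - c * c0 ^ 2 ≤ 1 := by have : 0 ≤ c * c0 ^ 2 := by positivity
                                      linarith
  have hρ0 : 0 ≤ 1 - c * c0 ^ 2 := by nlinarith
  have hdc : 1 / √(k * C) ≤ c0 := by
    rw [div_le_iff₀ (by positivity), ← Real.sqrt_sq hc00.le, ← Real.sqrt_mul (by positivity)]
    rw [Real.one_le_sqrt, hc0]
    rw [div_pow, div_mul_eq_mul_div, one_le_div (by positivity)]
    nlinarith
  have T0 : 0 ≤ (1 - c * c0 ^ 2) ^ (k - 4) * (2 * C ^ 4 * (1 + z ^ 2)⁻¹) := by positivity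
  have G0 : 0 ≤ 2 * k * C * (|z| ^ 5 * exp (-(c * k / 2) * z ^ 2)) := by positivity
  have hre : ((z : ℂ) ^ 2 * ∏ i, h i).re = z ^ 2 * (∏ i, h i).re := by
    rw [← Complex.ofReal_pow, Complex.re_ofReal_mul]
  rcases le_or_gt |z| c0 with hz | hz
  · have hz2 : z ^ 2 ≤ c0 ^ 2 := by rw [← sq_abs]; gcongr
    have hz1 : z ^ 2 ≤ 1 := by nlinarith
    rw [min_eq_right hz1] at h2
    set g : Fin k → ℝ := fun i => 1 - v i * z ^ 2 / 2 with hg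
    set M := 1 - c * z ^ 2 / 2 with hM
    have hMh : 1 / 2 ≤ M := by nlinarith
    have hCz : C * z ^ 2 ≤ 1 / 2 := by
      have : C * z ^ 2 ≤ C * c0 ^ 2 := by gcongr
      have e : C * c0 ^ 2 = c * c / (4 * C) := by rw [hc0]; field_simp; norm_num
      rw [e] at this
      refine this.trans ?_
      rw [div_le_div_iff₀ (by positivity) (by norm_num)]
      nlinarith
    have hg0 : ∀ i, 1 / 2 ≤ g i := fun i => by
      have : v i * z ^ 2 ≤ C * z ^ 2 := mul_le_mul_of_nonneg_right (hv i).2 (sq_nonneg z)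
      simp only [hg]; linarith
    have hz3 : C * |z| ^ 3 ≤ c * z ^ 2 / 2 := by
      have : C * |z| ^ 3 ≤ C * c0 * z ^ 2 := by
        rw [← sq_abs z]
        have : |z| * |z| ^ 2 ≤ c0 * |z| ^ 2 := by gcongr
        nlinarith
      have e : C * c0 = c / 2 := by rw [hc0]; field_simp
      rw [e] at this; linarith
    have hgM : ∀ i, ‖(g i : ℂ)‖ ≤ M := fun i => by
      have a : ‖(g i : ℂ)‖ ≤ ‖h i‖ + ‖h i - (g i : ℂ)‖ := by
        rw [← norm_neg (h i - (g i : ℂ))]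
        refine le_trans (le_of_eq ?_) (norm_add_le _ _)
        congr 1; ring
      linarith [h2 i, h3 i]
    have hhM : ∀ i, ‖h i‖ ≤ M := fun i => (h2 i).trans (by rw [hM]; nlinarith [sq_nonneg z])
    have tel := norm_prod_sub_prod_mul_le Finset.univ (by linarith) hhM hgM h3
    have hMk : M ^ k ≤ exp (-(c * k / 2) * z ^ 2) := by
      calc M ^ k ≤ (exp (-(c * z ^ 2 / 2))) ^ k := by
            have := add_one_le_exp (-(c * z ^ 2 / 2))
            gcongr; rw [hM]; linarith
        _ = _ := by rw [← exp_nat_mul]; congr 1; ring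
    rw [Finset.card_univ, Fintype.card_fin] at tel
    have tel2 : ‖∏ i, h i - ∏ i, (g i : ℂ)‖ ≤ 2 * (k * (C * |z| ^ 3) * M ^ k) := by
      have := mul_le_mul_of_nonneg_right hMh (norm_nonneg (∏ i, h i - ∏ i, (g i : ℂ)))
      linarith
    have hgre : (∏ i, h i).re ≥ (∏ i, g i) - 2 * (k * (C * |z| ^ 3) * M ^ k) := by
      have a := (Complex.abs_re_le_norm (∏ i, h i - ∏ i, (g i : ℂ))).trans tel2
      rw [Complex.sub_re, ← Complex.ofReal_prod, Complex.ofReal_re] at a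
      linarith [(abs_le.1 a).1]
    have hgp : (Set.Ioc 0 (1 / √(k * C))).indicator (fun z : ℝ => z ^ 2 / 2) z ≤
        z ^ 2 * ∏ i, g i := by
      refine Set.indicator_apply_le' (fun hzm => ?_) fun _ =>
        mul_nonneg (sq_nonneg z) (Finset.prod_nonneg fun i _ => by linarith [hg0 i])
      have b1 : z ^ 2 * (k * C) ≤ 1 := by
        have := hzm.2
        rw [le_div_iff₀ (by positivity)] at this
        calc z ^ 2 * (k * C) = (z * √(k * C)) ^ 2 := by
              rw [mul_pow, Real.sq_sqrt (by positivity)]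
          _ ≤ 1 ^ 2 := by gcongr; exact mul_nonneg hzm.1.le (by positivity)
          _ = 1 := one_pow 2
      have b2 : 1 / 2 ≤ ∏ i, g i := by
        have b3 : (1 - C * z ^ 2 / 2) ^ k ≤ ∏ i, g i := by
          calc (1 - C * z ^ 2 / 2) ^ k = ∏ i : Fin k, (1 - C * z ^ 2 / 2) := by simp
            _ ≤ _ := by
              refine Finset.prod_le_prod (fun i _ => by linarith) fun i _ => ?_
              have : v i * z ^ 2 ≤ C * z ^ 2 := mul_le_mul_of_nonneg_right (hv i).2 (sq_nonneg z)
              simp only [hg]; linarith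
        have b4 := one_add_mul_le_pow (a := -(C * z ^ 2 / 2)) (by linarith) k
        rw [← sub_eq_add_neg] at b4
        nlinarith
      nlinarith [sq_nonneg z]
    rw [hre]
    have hz5 : |z| ^ 5 = z ^ 2 * |z| ^ 3 := by rw [← sq_abs z]; ring
    have f1 : z ^ 2 * (2 * (k * (C * |z| ^ 3) * M ^ k)) ≤
        2 * k * C * (|z| ^ 5 * exp (-(c * k / 2) * z ^ 2)) := by
      rw [hz5]
      calc z ^ 2 * (2 * (k * (C * |z| ^ 3) * M ^ k)) = 2 * k * C * (z ^ 2 * |z| ^ 3 * M ^ k) := by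
            ring
        _ ≤ _ := by gcongr
    have f2 := mul_le_mul_of_nonneg_left hgre (sq_nonneg z)
    linarith
  · have hind : (Set.Ioc 0 (1 / √(k * C))).indicator (fun z : ℝ => z ^ 2 / 2) z = 0 := by
      refine Set.indicator_of_notMem (fun hzm => ?_) _
      rw [abs_of_pos hzm.1] at hz
      linarith [hzm.2]
    rw [hind, hre]
    have hmin : c0 ^ 2 ≤ min 1 (z ^ 2) := by
      refine le_min (by nlinarith) ?_
      rw [← sq_abs z]; gcongr
    have := sq_mul_norm_prod_le hk hC hρ1
      (fun i => (h2 i).trans (by nlinarith : 1 - c * min 1 (z ^ 2) ≤ 1 - c * c0 ^ 2)) h1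
    have a := (abs_le.1 (Complex.abs_re_le_norm (∏ i, h i))).1
    have := mul_le_mul_of_nonneg_left a (sq_nonneg z)
    linarith

lemma integrable_abs_pow_mul_exp {b : ℝ} (hb : 0 < b) :
    Integrable fun z : ℝ => |z| ^ 5 * exp (-b * z ^ 2) := by
  refine (integrable_rpow_mul_exp_neg_mul_sq hb (s := 5) (by norm_num)).norm.congr
    (Filter.Eventually.of_forall fun z => ?_)
  simp only [norm_mul, Real.norm_eq_abs, abs_exp]
  congr 1
  rw [show (5:ℝ) = ((5:ℕ):ℝ) by norm_num, Real.rpow_natCast, abs_pow]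

lemma integral_abs_pow_mul_exp {b : ℝ} (hb : 0 < b) :
    ∫ z : ℝ, |z| ^ 5 * exp (-b * z ^ 2) = (∫ z : ℝ, |z| ^ 5 * exp (-1 * z ^ 2)) / b ^ 3 := by
  have := Measure.integral_comp_mul_left (fun z : ℝ => |z| ^ 5 * exp (-1 * z ^ 2)) (√b)
  have hs : 0 < √b := Real.sqrt_pos.2 hb
  have e : ∀ z : ℝ, |√b * z| ^ 5 * exp (-1 * (√b * z) ^ 2) =
      √b ^ 5 * (|z| ^ 5 * exp (-b * z ^ 2)) := fun z => by
    rw [abs_mul, abs_of_pos hs, mul_pow, mul_pow, Real.sq_sqrt hb.le]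
    rw [show -1 * (b * z ^ 2) = -b * z ^ 2 by ring]; ring
  simp only [e] at this
  rw [integral_const_mul, abs_of_pos (inv_pos.2 hs), smul_eq_mul] at this
  rw [_root_.eq_div_iff (by positivity)]
  have h6 : b ^ 3 = √b ^ 5 * √b := by
    conv_lhs => rw [← Real.sq_sqrt hb.le]
    ring
  rw [h6, mul_comm, mul_right_comm, this]
  field_simp

/-- The main term dominates for many sites. -/
lemma exists_main_term_pos {C c J : ℝ} (hC : 1 ≤ C) (hc : 0 < c) (hc1 : c ≤ 1) :
    ∃ k0 : ℕ, ∀ k : ℕ, k0 ≤ k → 4 ≤ k ∧ 4 * C ≤ c ^ 2 * k ∧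
      0 < (1 / √(k * C)) ^ 3 / 6 - 2 * k * C * (J / (c * k / 2) ^ 3) -
        (1 - c * (c / (2 * C)) ^ 2) ^ (k - 4) * (2 * C ^ 4 * π) := by
  have hC0 : 0 < C := by linarith
  set ρ := 1 - c * (c / (2 * C)) ^ 2 with hρ
  have hq : (c / (2 * C)) ^ 2 ≤ 1 / 4 := by
    have : c / (2 * C) ≤ 1 / 2 := by
      rw [div_le_div_iff₀ (by positivity) (by norm_num)]; linarith
    calc _ ≤ (1 / 2 : ℝ) ^ 2 := by gcongr
      _ = _ := by norm_num
  have hq0 : 0 < (c / (2 * C)) ^ 2 := by positivity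
  have hρ0 : 0 < ρ := by rw [hρ]; nlinarith
  have hρ1 : ρ < 1 := by rw [hρ]; nlinarith
  have t1 : Filter.Tendsto (fun k : ℕ => √(k:ℝ) * (1 / (6 * √C ^ 3)) - 16 * C * J / c ^ 3)
      Filter.atTop Filter.atTop := by
    refine Filter.tendsto_atTop_add_const_right _ _ (Filter.Tendsto.atTop_mul_const (by positivity) ?_)
    exact Real.tendsto_sqrt_atTop.comp tendsto_natCast_atTop_atTop
  have t2 := (tendsto_pow_const_mul_const_pow_of_abs_lt_one 2 (r := ρ)
    (by rw [abs_of_pos hρ0]; exact hρ1)).mul_const (2 * C ^ 4 * π / ρ ^ 4)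
  rw [zero_mul] at t2
  have e1 := t1.eventually_gt_atTop 1
  have e2 := t2.eventually_lt_const one_pos
  have e3 := (tendsto_natCast_atTop_atTop (R := ℝ)).eventually_ge_atTop (4 * C / c ^ 2)
  obtain ⟨k0, hk0⟩ := Filter.eventually_atTop.1
    (((e1.and e2).and e3).and (Filter.eventually_ge_atTop 4))
  refine ⟨k0, fun k hk => ?_⟩
  obtain ⟨⟨⟨h1, h2⟩, h3⟩, h4⟩ := hk0 k hk
  have hkp : (0:ℝ) < k := by positivity
  refine ⟨h4, ?_, ?_⟩
  · rw [div_le_iff₀ (by positivity)] at h3; linarith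
  · have hsk : √(k:ℝ) ^ 2 = k := Real.sq_sqrt hkp.le
    have hsp : 0 < √(k:ℝ) := Real.sqrt_pos.2 hkp
    have hsC : 0 < √C := Real.sqrt_pos.2 hC0
    have key : (k:ℝ) ^ 2 * ((1 / √(k * C)) ^ 3 / 6 - 2 * k * C * (J / (c * k / 2) ^ 3) -
        ρ ^ (k - 4) * (2 * C ^ 4 * π)) = (√(k:ℝ) * (1 / (6 * √C ^ 3)) - 16 * C * J / c ^ 3) -
        (k:ℝ) ^ 2 * ρ ^ k * (2 * C ^ 4 * π / ρ ^ 4) := by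
      have hp : ρ ^ k = ρ ^ (k - 4) * ρ ^ 4 := by rw [← pow_add]; congr 1; omega
      have a1 : (k:ℝ) ^ 2 * ((1 / √(k * C)) ^ 3 / 6) = √(k:ℝ) * (1 / (6 * √C ^ 3)) := by
        rw [Real.sqrt_mul hkp.le]
        nth_rewrite 1 [← hsk]
        field_simp
      have a2 : (k:ℝ) ^ 2 * (2 * k * C * (J / (c * k / 2) ^ 3)) = 16 * C * J / c ^ 3 := by
        field_simp; ring
      have a3 : (k:ℝ) ^ 2 * (ρ ^ (k - 4) * (2 * C ^ 4 * π)) =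
        (k:ℝ) ^ 2 * ρ ^ k * (2 * C ^ 4 * π / ρ ^ 4) := by
        rw [hp]; field_simp
      rw [mul_sub, mul_sub, a1, a2, a3]
    have : 0 < (k:ℝ) ^ 2 * ((1 / √(k * C)) ^ 3 / 6 - 2 * k * C * (J / (c * k / 2) ^ 3) -
        ρ ^ (k - 4) * (2 * C ^ 4 * π)) := by rw [key]; linarith
    exact pos_of_mul_pos_right this (by positivity)

lemma exists_re_integral_pos {C c : ℝ} (hC : 1 ≤ C) (hc : 0 < c) (hc1 : c ≤ 1) :
    ∃ k0 : ℕ, ∀ k : ℕ, k0 ≤ k → ∀ (h : Fin k → ℝ → ℂ) (v : Fin k → ℝ),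
      (∀ i, Continuous (h i)) → (∀ i, 0 ≤ v i ∧ v i ≤ C) →
      (∀ i z, |z| * ‖h i z‖ ≤ C) → (∀ i z, ‖h i z‖ ≤ 1 - c * min 1 (z ^ 2)) →
      (∀ i z, ‖h i z - ((1 - v i * z ^ 2 / 2 : ℝ) : ℂ)‖ ≤ C * |z| ^ 3) →
      (∀ z : ℝ, ‖(z : ℂ) ^ 2 * ∏ i, h i z‖ ≤ 2 * C ^ 4 * (1 + z ^ 2)⁻¹) ∧
      (∀ z : ℝ, ‖∏ i, h i z‖ ≤ 1) ∧
      0 < (∫ z : ℝ, (z : ℂ) ^ 2 * ∏ i, h i z).re := by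
  obtain ⟨k0, hk0⟩ := exists_main_term_pos (J := ∫ z : ℝ, |z| ^ 5 * exp (-1 * z ^ 2)) hC hc hc1
  refine ⟨k0, fun k hk h v hcont hv h1 h2 h3 => ?_⟩
  obtain ⟨hk4, hkC, hmain⟩ := hk0 k hk
  have hkp : (0:ℝ) < k := by positivity
  have hle1 : ∀ i z, ‖h i z‖ ≤ 1 := fun i z => (h2 i z).trans (by
    have : 0 ≤ c * min 1 (z ^ 2) := mul_nonneg hc.le (le_min zero_le_one (sq_nonneg z))
    linarith)
  have hb : ∀ z : ℝ, ‖(z : ℂ) ^ 2 * ∏ i, h i z‖ ≤ 2 * C ^ 4 * (1 + z ^ 2)⁻¹ := fun z => by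
    have := sq_mul_norm_prod_le hk4 hC le_rfl (fun i => hle1 i z) (fun i => h1 i z)
    rw [one_pow, one_mul] at this
    rwa [norm_mul, norm_pow, Complex.norm_real, Real.norm_eq_abs, sq_abs]
  refine ⟨hb, fun z => ?_, ?_⟩
  · rw [norm_prod]
    exact Finset.prod_le_one (fun i _ => norm_nonneg _) fun i _ => hle1 i z
  have hgi : Integrable fun z : ℝ => (z : ℂ) ^ 2 * ∏ i, h i z := by
    refine (integrable_inv_one_add_sq.const_mul (2 * C ^ 4)).mono' ?_
      (Filter.Eventually.of_forall hb)
    have : Continuous fun z : ℝ => (z : ℂ) ^ 2 * ∏ i, h i z := by fun_prop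
    exact this.aestronglyMeasurable
  set d := 1 / √(k * C) with hd
  have hd0 : 0 ≤ d := by positivity
  have hκ : 0 < c * k / 2 := by positivity
  have iA : Integrable ((Set.Ioc 0 d).indicator fun z : ℝ => z ^ 2 / 2) := by
    rw [integrable_indicator_iff measurableSet_Ioc]
    exact (Continuous.integrableOn_Icc (by fun_prop)).mono_set Set.Ioc_subset_Icc_self
  have iB := (integrable_abs_pow_mul_exp hκ).const_mul (2 * k * C)
  have iAB : Integrable fun z : ℝ => (Set.Ioc 0 d).indicator (fun z : ℝ => z ^ 2 / 2) z
      - 2 * k * C * (|z| ^ 5 * exp (-(c * k / 2) * z ^ 2)) := iA.sub iB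
  have iD := (integrable_inv_one_add_sq.const_mul (2 * C ^ 4)).const_mul
    ((1 - c * (c / (2 * C)) ^ 2) ^ (k - 4))
  have vA : ∫ z, (Set.Ioc 0 d).indicator (fun z : ℝ => z ^ 2 / 2) z = d ^ 3 / 6 := by
    rw [integral_indicator measurableSet_Ioc, ← intervalIntegral.integral_of_le hd0,
      intervalIntegral.integral_div, integral_pow]
    norm_num; ring
  have e1 : ∫ z, ((Set.Ioc 0 d).indicator (fun z : ℝ => z ^ 2 / 2) z
      - 2 * k * C * (|z| ^ 5 * exp (-(c * k / 2) * z ^ 2))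
      - (1 - c * (c / (2 * C)) ^ 2) ^ (k - 4) * (2 * C ^ 4 * (1 + z ^ 2)⁻¹)) =
      d ^ 3 / 6 - 2 * k * C * ((∫ z : ℝ, |z| ^ 5 * exp (-1 * z ^ 2)) / (c * k / 2) ^ 3) -
        (1 - c * (c / (2 * C)) ^ 2) ^ (k - 4) * (2 * C ^ 4 * π) := by
    rw [integral_sub iAB iD, integral_sub iA iB, vA, integral_const_mul,
      integral_const_mul, integral_const_mul, integral_univ_inv_one_add_sq,
      integral_abs_pow_mul_exp hκ]
  have e2 : (∫ z : ℝ, (z : ℂ) ^ 2 * ∏ i, h i z).re = ∫ z : ℝ, ((z : ℂ) ^ 2 * ∏ i, h i z).re :=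
    (integral_re hgi).symm
  rw [e2]
  refine (e1 ▸ hmain).trans_le (integral_mono ((iA.sub iB).sub iD) hgi.re fun z => ?_)
  exact re_sq_mul_prod_ge hk4 hC hc hc1 hkC hv (fun i => h1 i z) (fun i => h2 i z)
    (fun i => h3 i z)

namespace ConvPot
variable {lam : ℝ} {φ φ' : ℝ → ℝ}

lemma min_at_crit (h : ConvPot lam φ φ') {x₀ : ℝ} (h0 : φ' x₀ = 0) (x : ℝ) : φ x₀ ≤ φ x := by
  have := h.lower_bound x₀ x
  rw [h0] at this
  have : 0 ≤ lam / 2 * (x - x₀) ^ 2 := by have := h.lam_pos; positivity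
  linarith

lemma scale_le (h : ConvPot lam φ φ') (h0 : φ 0 = 0) {θ : ℝ} (hθ : 0 ≤ θ) (hθ1 : θ ≤ 1) (t : ℝ) :
    φ (θ * t) ≤ θ * φ t := by
  have a := h.lower_bound (θ * t) t
  have b := h.lower_bound (θ * t) 0
  have hl := h.lam_pos
  have a' : 0 ≤ lam / 2 * (t - θ * t) ^ 2 := by positivity
  have b' : 0 ≤ lam / 2 * (0 - θ * t) ^ 2 := by positivity
  rw [h0] at b
  have a2 : θ * (φ (θ * t) + φ' (θ * t) * (t - θ * t)) ≤ θ * φ t :=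
    mul_le_mul_of_nonneg_left (by linarith) hθ
  have b2 : (1 - θ) * (φ (θ * t) + φ' (θ * t) * (0 - θ * t)) ≤ 0 :=
    mul_nonpos_of_nonneg_of_nonpos (by linarith) (by linarith)
  linarith

lemma abs_mul_exp_le (h : ConvPot lam φ φ') (h0 : φ 0 = 0) (h0' : φ' 0 = 0) (t : ℝ) :
    |t| * exp (-φ t) ≤ ∫ x, exp (-φ x) := by
  set s := Set.uIcc 0 t with hs
  have hi := h.integrable
  calc |t| * exp (-φ t) = ∫ x in s, exp (-φ t) := by
        rw [setIntegral_const, smul_eq_mul, hs, measureReal_def, Real.volume_interval]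
        simp
    _ ≤ ∫ x in s, exp (-φ x) := by
        refine setIntegral_mono_on (integrableOn_const (by
          rw [hs, Real.volume_interval]; exact ENNReal.ofReal_ne_top)) hi.integrableOn
          measurableSet_uIcc fun x hx => ?_
        rw [exp_le_exp, neg_le_neg_iff]
        have h00 : 0 ≤ φ t := by have := h.min_at_crit h0' t; linarith
        rw [hs, ← segment_eq_uIcc] at hx
        obtain ⟨a, b, ha, hb, hab, rfl⟩ := hx
        have := h.scale_le h0 hb (by linarith) t
        simp only [smul_eq_mul, mul_zero, zero_add]
        nlinarith
    _ ≤ _ := setIntegral_le_integral hi (Filter.Eventually.of_forall fun x => (exp_pos _).le)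

lemma cube_le (h : ConvPot lam φ φ') (h0 : φ 0 = 0) (h0' : φ' 0 = 0) (t : ℝ) :
    |t| ^ 3 * exp (-φ t) ≤ 64 * (∫ x, exp (-φ x)) ^ 3 * exp (-φ (1 / 4 * t)) := by
  have a := h.abs_mul_exp_le h0 h0' (1 / 4 * t)
  have b := h.scale_le h0 (θ := 1 / 4) (by norm_num) (by norm_num) t
  have c : exp (-φ t) ≤ exp (-φ (1 / 4 * t)) ^ 3 * exp (-φ (1 / 4 * t)) := by
    rw [← exp_nat_mul, ← exp_add, exp_le_exp]; push_cast; linarith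
  calc _ ≤ |t| ^ 3 * (exp (-φ (1 / 4 * t)) ^ 3 * exp (-φ (1 / 4 * t))) := by gcongr
    _ = 64 * (|1 / 4 * t| * exp (-φ (1 / 4 * t))) ^ 3 * exp (-φ (1 / 4 * t)) := by
        rw [abs_mul, abs_of_pos (by norm_num : (0:ℝ) < 1 / 4)]; ring
    _ ≤ _ := by gcongr

lemma int_cube (h : ConvPot lam φ φ') (h0 : φ 0 = 0) (h0' : φ' 0 = 0) :
    Integrable (fun t => |t| ^ 3 * exp (-φ t)) ∧
    ∫ t, |t| ^ 3 * exp (-φ t) ≤ 256 * (∫ x, exp (-φ x)) ^ 4 := by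
  have hc := h.continuous
  have i1 : Integrable fun t => 64 * (∫ x, exp (-φ x)) ^ 3 * exp (-φ (1 / 4 * t)) :=
    (h.integrable.comp_mul_left' (by norm_num)).const_mul _
  have i2 : Integrable fun t => |t| ^ 3 * exp (-φ t) := by
    refine i1.mono' (by fun_prop) (Filter.Eventually.of_forall fun t => ?_)
    rw [Real.norm_of_nonneg (by positivity)]
    exact h.cube_le h0 h0' t
  refine ⟨i2, (integral_mono i2 i1 (h.cube_le h0 h0')).trans_eq ?_⟩
  rw [integral_const_mul, Measure.integral_comp_mul_left (fun x => exp (-φ x))]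
  norm_num; ring

lemma integral_pos (h : ConvPot lam φ φ') : 0 < ∫ x, exp (-φ x) :=
  integral_exp_pos h.integrable

lemma integral_le (h : ConvPot lam φ φ') (h0 : φ 0 = 0) (h0' : φ' 0 = 0) :
    ∫ x, exp (-φ x) ≤ √(π / (lam / 2)) := by
  rw [← integral_gaussian]
  refine integral_mono h.integrable (integrable_exp_neg_mul_sq (half_pos h.lam_pos)) fun x => ?_
  have := h.gauss_bound h0' x
  simpa [h0] using this

lemma exp_tilt_le (h : ConvPot lam φ φ') (h0 : φ 0 = 0) (h0' : φ' 0 = 0) {β L : ℝ} (hβ : |β| ≤ L)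
    (t : ℝ) : exp (-(φ t + β * t)) ≤ exp (2 * L ^ 2 / lam) * exp (-φ (1 / 2 * t)) := by
  have hl := h.lam_pos
  rw [← exp_add, exp_le_exp]
  have a := h.scale_le h0 (θ := 1 / 2) (by norm_num) (by norm_num) t
  have b := h.lower_bound 0 (1 / 2 * t)
  rw [h0, h0'] at b
  have c : -(β * t) ≤ L * |t| := by
    have := neg_abs_le (β * t)
    rw [abs_mul] at this
    have := mul_le_mul_of_nonneg_right hβ (abs_nonneg t)
    linarith
  have d : L * |t| ≤ 2 * L ^ 2 / lam + lam / 8 * t ^ 2 := by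
    have e : 2 * L ^ 2 / lam + lam / 8 * t ^ 2 - L * |t| = (4 * L - lam * |t|) ^ 2 / (8 * lam) := by
      rw [← sq_abs t]; field_simp; ring
    have : 0 ≤ (4 * L - lam * |t|) ^ 2 / (8 * lam) := by positivity
    linarith
  linarith

/-- The width of the density changes by a bounded factor under bounded tilts. -/
lemma width_tilt_le (h : ConvPot lam φ φ') {x₀ x₁ β L : ℝ} (h0 : φ' x₀ = 0) (h1 : φ' x₁ + β = 0)
    (hβ : |β| ≤ L) :
    ∫ x, exp (-((φ x + β * x) - (φ x₁ + β * x₁))) ≤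
      2 * exp (2 * L ^ 2 / lam) * ∫ x, exp (-(φ x - φ x₀)) := by
  have hs := h.shift x₀ (φ x₀)
  have hs0 : φ (x₀ + 0) - φ x₀ = 0 := by simp
  have hs0' : φ' (x₀ + 0) = 0 := by simpa using h0
  have hm := (h.tilt β).min_at_crit h1 x₀
  have e1 : ∀ x, exp (-((φ (x₀ + x) + β * (x₀ + x)) - (φ x₁ + β * x₁))) ≤
      exp (2 * L ^ 2 / lam) * exp (-(φ (x₀ + 1 / 2 * x) - φ x₀)) := fun x => by
    refine le_trans (exp_le_exp.2 ?_) (hs.exp_tilt_le hs0 hs0' hβ x)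
    linarith
  have i1 : Integrable fun x => exp (-((φ (x₀ + x) + β * (x₀ + x)) - (φ x₁ + β * x₁))) :=
    ((h.tilt β).shift x₀ (φ x₁ + β * x₁)).integrable
  have i2 : Integrable fun x => exp (2 * L ^ 2 / lam) * exp (-(φ (x₀ + 1 / 2 * x) - φ x₀)) :=
    (hs.integrable.comp_mul_left' (R := 1 / 2) (by norm_num)).const_mul _
  rw [← integral_add_left_eq_self (fun x => exp (-((φ x + β * x) - (φ x₁ + β * x₁)))) x₀,
    ← integral_add_left_eq_self (fun x => exp (-(φ x - φ x₀))) x₀]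
  refine (integral_mono i1 i2 e1).trans_eq ?_
  rw [integral_const_mul, Measure.integral_comp_mul_left (fun x => exp (-(φ (x₀ + x) - φ x₀)))]
  norm_num; ring

end ConvPot

/-- Scale-invariant control of a density `p` at length scale `r` around its mean. -/
structure WidthBound (C r : ℝ) (p p' : ℝ → ℝ) : Prop where
  niceD : NiceD p p'
  int_cube : Integrable fun x => |x| ^ 3 * p x
  cube : ∫ x, |x - (∫ y, y * p y) / ∫ y, p y| ^ 3 * p x ≤ C * r ^ 3 * ∫ x, p x
  tv : r * ∫ x, |p' x| ≤ C * ∫ x, p x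

namespace PertPot
variable {lam B : ℝ} {φ φ' ψ ψ' : ℝ → ℝ}

lemma widthBound (h : PertPot lam B φ φ' ψ ψ') (h0 : φ 0 = 0) (h0' : φ' 0 = 0) :
    WidthBound (4 * (256 * exp (2 * B) + (1 + 256 * exp (2 * B)) ^ 3)
      + exp (2 * B) * (2 + B * √(π / (lam / 2)))) (∫ x, exp (-φ x))
      (fun x => exp (-ψ x)) fun x => -ψ' x * exp (-ψ x) := by
  set N := ∫ x, exp (-φ x) with hN
  set P := ∫ x, exp (-ψ x) with hP
  have hN0 : 0 < N := h.conv.integral_pos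
  have hP0 : 0 < P := integral_exp_pos h.nice.int
  have hB := h.nonneg
  have hNP : N ≤ exp B * P := by
    rw [hN, hP, ← integral_const_mul]
    exact integral_mono h.conv.integrable (h.nice.int.const_mul _) h.ge
  obtain ⟨iq, cq⟩ := h.conv.int_cube h0 h0'
  have hc := h.continuous
  have ple : ∀ t, |t| ^ 3 * exp (-ψ t) ≤ exp B * (|t| ^ 3 * exp (-φ t)) := fun t => by
    have := mul_le_mul_of_nonneg_left (h.le t) (by positivity : 0 ≤ |t| ^ 3)
    linarith
  have ip : Integrable fun t => |t| ^ 3 * exp (-ψ t) := by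
    refine (iq.const_mul (exp B)).mono' (by fun_prop) (Filter.Eventually.of_forall fun t => ?_)
    rw [Real.norm_of_nonneg (by positivity)]
    exact ple t
  have e2B : exp (2 * B) = exp B * exp B := by rw [← exp_add]; ring_nf
  have cp : ∫ t, |t| ^ 3 * exp (-ψ t) ≤ 256 * exp (2 * B) * N ^ 3 * P := by
    calc _ ≤ ∫ t, exp B * (|t| ^ 3 * exp (-φ t)) := integral_mono ip (iq.const_mul _) ple
      _ = exp B * ∫ t, |t| ^ 3 * exp (-φ t) := integral_const_mul _ _
      _ ≤ exp B * (256 * N ^ 4) := by gcongr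
      _ = exp B * (256 * N ^ 3 * N) := by ring
      _ ≤ exp B * (256 * N ^ 3 * (exp B * P)) := by gcongr
      _ = _ := by rw [e2B]; ring
  set K := 256 * exp (2 * B) with hK
  have hK0 : 0 < K := by positivity
  set m := (∫ y, y * exp (-ψ y)) / P with hm
  have hmN : |m| ≤ (1 + K) * N := by
    rw [hm, abs_div, abs_of_pos hP0, div_le_iff₀ hP0]
    calc |∫ y, y * exp (-ψ y)| ≤ ∫ y, (N * exp (-ψ y) + 1 / N ^ 2 * (|y| ^ 3 * exp (-ψ y))) := by
          rw [← Real.norm_eq_abs]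
          refine norm_integral_le_of_norm_le ((h.nice.int.const_mul _).add (ip.const_mul _))
            (Filter.Eventually.of_forall fun y => ?_)
          rw [norm_mul, Real.norm_eq_abs, Real.norm_of_nonneg (exp_pos _).le, ← mul_assoc,
            ← add_mul]
          gcongr
          rcases le_or_gt |y| N with hy | hy
          · have : 0 ≤ 1 / N ^ 2 * |y| ^ 3 := by positivity
            linarith
          · have : |y| ≤ 1 / N ^ 2 * |y| ^ 3 := by
              rw [one_div, ← div_eq_inv_mul, le_div_iff₀ (by positivity)]
              calc |y| * N ^ 2 ≤ |y| * |y| ^ 2 := by gcongr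
                _ = _ := by ring
            linarith
      _ = N * P + 1 / N ^ 2 * ∫ t, |t| ^ 3 * exp (-ψ t) := by
          rw [integral_add (h.nice.int.const_mul _) (ip.const_mul _), integral_const_mul,
            integral_const_mul]
      _ ≤ N * P + 1 / N ^ 2 * (K * N ^ 3 * P) := by gcongr
      _ = _ := by field_simp
  have hD1 : 0 ≤ exp (2 * B) * (2 + B * √(π / (lam / 2))) := by positivity
  have hD2 : 0 ≤ 4 * (K + (1 + K) ^ 3) := by positivity
  refine ⟨h.niceD, ip, ?_, ?_⟩
  · calc ∫ x, |x - m| ^ 3 * exp (-ψ x) ≤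
          ∫ x, (4 * (|x| ^ 3 * exp (-ψ x)) + 4 * |m| ^ 3 * exp (-ψ x)) := by
          refine integral_mono_of_nonneg (Filter.Eventually.of_forall fun x => by positivity)
            ((ip.const_mul _).add (h.nice.int.const_mul _)) (Filter.Eventually.of_forall fun x => ?_)
          have : |x - m| ^ 3 ≤ 4 * |x| ^ 3 + 4 * |m| ^ 3 := by
            calc |x - m| ^ 3 ≤ (|x| + |m|) ^ 3 := by
                  gcongr; exact abs_sub x m
              _ ≤ 4 * |x| ^ 3 + 4 * |m| ^ 3 := by
                  have a := abs_nonneg x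
                  have b := abs_nonneg m
                  nlinarith [mul_nonneg (add_nonneg a b) (sq_nonneg (|x| - |m|))]
          have := mul_le_mul_of_nonneg_right this (exp_pos (-ψ x)).le
          simp only
          linarith
      _ = 4 * (∫ x, |x| ^ 3 * exp (-ψ x)) + 4 * |m| ^ 3 * P := by
          rw [integral_add (ip.const_mul _) (h.nice.int.const_mul _), integral_const_mul,
            integral_const_mul]
      _ ≤ 4 * (K * N ^ 3 * P) + 4 * ((1 + K) * N) ^ 3 * P := by gcongr
      _ = (4 * (K + (1 + K) ^ 3)) * (N ^ 3 * P) := by ring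
      _ ≤ _ := by
          rw [mul_assoc _ (N ^ 3) P]
          exact mul_le_mul_of_nonneg_right (by linarith) (by positivity)
  · have hNle := h.conv.integral_le h0 h0'
    have itv := h.conv.integral_abs_deriv h0'
    rw [h0] at itv
    calc N * ∫ x, |-ψ' x * exp (-ψ x)| ≤
          N * ∫ x, exp B * (|-φ' x * exp (-φ x)| + B * exp (-φ x)) := by
          refine mul_le_mul_of_nonneg_left ?_ hN0.le
          exact integral_mono h.niceD.int.abs
            ((h.conv.integrable_deriv.abs.add (h.conv.integrable.const_mul B)).const_mul _)
            h.abs_deriv_le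
      _ = N * (exp B * (2 + B * N)) := by
          rw [integral_const_mul, integral_add h.conv.integrable_deriv.abs
            (h.conv.integrable.const_mul B), itv, integral_const_mul, ← hN]
          simp
      _ ≤ (exp B * P) * (exp B * (2 + B * √(π / (lam / 2)))) := by gcongr
      _ = (exp (2 * B) * (2 + B * √(π / (lam / 2)))) * P := by rw [e2B]; ring
      _ ≤ _ := by gcongr; linarith

end PertPot

lemma NiceD.affine {p p' : ℝ → ℝ} (h : NiceD p p') {c r : ℝ} (hc : 0 < c) (hr : r ≠ 0) (b : ℝ) :
    NiceD (fun x => c * p (b + r * x)) fun x => c * (p' (b + r * x) * r) where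
  nice :=
    { pos := fun x => mul_pos hc (h.nice.pos _)
      cont := by have := h.nice.cont; fun_prop
      int := ((h.nice.int.comp_add_left b).comp_mul_left' hr).const_mul c
      bdd := by
        obtain ⟨M, hM⟩ := h.nice.bdd
        exact ⟨c * M, fun x => mul_le_mul_of_nonneg_left (hM _) hc.le⟩ }
  deriv x := by
    have h1 : HasDerivAt (fun x : ℝ => b + r * x) r x := by
      simpa using ((hasDerivAt_id x).const_mul r).const_add b
    exact ((h.deriv (b + r * x)).comp x h1).const_mul c
  cont := by have := h.cont; fun_prop
  int := (((h.int.comp_add_left b).comp_mul_left' hr).mul_const r).const_mul c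

lemma abs_add_pow_three_le (x y : ℝ) : |x + y| ^ 3 ≤ 4 * |x| ^ 3 + 4 * |y| ^ 3 := by
  calc |x + y| ^ 3 ≤ (|x| + |y|) ^ 3 := by
        gcongr; exact abs_add_le x y
    _ ≤ _ := by
        have a := abs_nonneg x
        have b := abs_nonneg y
        nlinarith [mul_nonneg (add_nonneg a b) (sq_nonneg (|x| - |y|))]

lemma integral_comp_affine (F : ℝ → ℝ) (b : ℝ) {r : ℝ} (hr : 0 < r) :
    ∫ x, F (b + r * x) = r⁻¹ * ∫ x, F x := by
  rw [Measure.integral_comp_mul_left (fun x => F (b + x)) r, integral_add_left_eq_self,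
    abs_of_pos (inv_pos.2 hr), smul_eq_mul]

namespace WidthBound
variable {C r : ℝ} {p p' : ℝ → ℝ}

lemma int_id (h : WidthBound C r p p') : Integrable fun x => x * p x := by
  have hc := h.niceD.nice.cont
  refine (h.niceD.nice.int.add h.int_cube).mono' (by fun_prop)
    (Filter.Eventually.of_forall fun x => ?_)
  have hp := h.niceD.nice.pos x
  simp only [Pi.add_apply]
  rw [norm_mul, Real.norm_eq_abs, Real.norm_of_nonneg hp.le]
  have : |x| ≤ 1 + |x| ^ 3 := by
    rcases le_or_gt |x| 1 with h1 | h1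
    · have : 0 ≤ |x| ^ 3 := by positivity
      linarith
    · have := le_self_pow₀ h1.le (n := 3) (by norm_num)
      linarith
  nlinarith

lemma int_cube_sub (h : WidthBound C r p p') (m : ℝ) : Integrable fun x => |x + m| ^ 3 * p x := by
  have hc := h.niceD.nice.cont
  refine ((h.int_cube.const_mul 4).add (h.niceD.nice.int.const_mul (4 * |m| ^ 3))).mono'
    (by fun_prop) (Filter.Eventually.of_forall fun x => ?_)
  have hp := (h.niceD.nice.pos x).le
  simp only [Pi.add_apply]
  rw [Real.norm_of_nonneg (by positivity)]
  have := mul_le_mul_of_nonneg_right (abs_add_pow_three_le x m) hp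
  linarith

lemma int_pos (h : WidthBound C r p p') : 0 < ∫ x, p x := by
  rw [integral_pos_iff_support_of_nonneg (fun x => (h.niceD.nice.pos x).le) h.niceD.nice.int]
  have : Function.support p = Set.univ :=
    Set.eq_univ_of_forall fun x => (h.niceD.nice.pos x).ne'
  rw [this]; simp

lemma shift (h : WidthBound C r p p') {c : ℝ} (hc : 0 < c) (b : ℝ) :
    WidthBound C r (fun x => c * p (b + x)) fun x => c * p' (b + x) := by
  have hP := h.int_pos
  have e0 : ∫ x, c * p (b + x) = c * ∫ x, p x := by
    rw [integral_const_mul, integral_add_left_eq_self]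
  have e1 : ∫ x, x * (c * p (b + x)) = c * ((∫ x, x * p x) - b * ∫ x, p x) := by
    have := integral_add_left_eq_self (fun x => (x - b) * p x) b (μ := volume)
    simp only [add_sub_cancel_left] at this
    calc _ = ∫ x, c * (x * p (b + x)) := by congr 1; ext x; ring
      _ = _ := by
        rw [integral_const_mul, this]
        simp only [sub_mul]
        rw [integral_sub h.int_id (h.niceD.nice.int.const_mul b), integral_const_mul]
  have em : (∫ y, y * (c * p (b + y))) / (∫ y, c * p (b + y)) =
      (∫ y, y * p y) / (∫ y, p y) - b := by
    rw [e0, e1]; field_simp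
  constructor
  · have := h.niceD.affine hc one_ne_zero b
    simpa using this
  · have := ((h.int_cube_sub (-b)).comp_add_left b).const_mul c
    refine this.congr (Filter.Eventually.of_forall fun x => ?_)
    simp only
    rw [show b + x + -b = x by ring]; ring
  · rw [em, e0]
    set m := (∫ y, y * p y) / ∫ y, p y
    have := integral_add_left_eq_self (fun x => |x - m| ^ 3 * p x) b (μ := volume)
    calc ∫ x, |x - (m - b)| ^ 3 * (c * p (b + x)) =
          ∫ x, c * (|b + x - m| ^ 3 * p (b + x)) := by
          congr 1; ext x; rw [show x - (m - b) = b + x - m by ring]; ring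
      _ = c * ∫ x, |x - m| ^ 3 * p x := by rw [integral_const_mul, this]
      _ ≤ c * (C * r ^ 3 * ∫ x, p x) := by gcongr; exact h.cube
      _ = _ := by ring
  · rw [e0]
    calc r * ∫ x, |c * p' (b + x)| = c * (r * ∫ x, |p' x|) := by
          simp only [abs_mul, abs_of_pos hc]
          rw [integral_const_mul, integral_add_left_eq_self (fun x => |p' x|)]; ring
      _ ≤ c * (C * ∫ x, p x) := mul_le_mul_of_nonneg_left h.tv hc.le
      _ = _ := by ring

lemma change_scale (h : WidthBound C r p p') (hC : 0 ≤ C) (hr : 0 < r) {D r₀ : ℝ} (hD : 1 ≤ D)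
    (h1 : r ≤ D * r₀) (h2 : r₀ ≤ D * r) : WidthBound (C * D ^ 3) r₀ p p' := by
  have hP := h.int_pos
  have hr0 : 0 < r₀ := pos_of_mul_pos_right (hr.trans_le h1) (by linarith)
  refine ⟨h.niceD, h.int_cube, h.cube.trans ?_, ?_⟩
  · calc _ ≤ C * (D * r₀) ^ 3 * ∫ x, p x := by gcongr
      _ = _ := by ring
  · have i0 : 0 ≤ ∫ x, |p' x| := integral_nonneg fun x => abs_nonneg _
    calc _ ≤ (D * r) * ∫ x, |p' x| := by gcongr
      _ = D * (r * ∫ x, |p' x|) := by ring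
      _ ≤ D * (C * ∫ x, p x) := mul_le_mul_of_nonneg_left h.tv (by linarith)
      _ = C * D ^ 1 * ∫ x, p x := by ring
      _ ≤ _ := by gcongr; norm_num

lemma mono (h : WidthBound C r p p') (hr : 0 ≤ r) {C' : ℝ} (hC : C ≤ C') :
    WidthBound C' r p p' := by
  have hP := h.int_pos
  refine ⟨h.niceD, h.int_cube, h.cube.trans ?_, h.tv.trans ?_⟩ <;> gcongr

lemma goodDens (h : WidthBound C r p p') (hr : 0 < r) :
    GoodDens C (fun y => r / (∫ x, p x) * p ((∫ x, x * p x) / (∫ x, p x) + r * y))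
      (fun y => r / (∫ x, p x) * (p' ((∫ x, x * p x) / (∫ x, p x) + r * y) * r)) := by
  have hP := h.int_pos
  set P := ∫ x, p x with hPdef
  set m := (∫ x, x * p x) / P with hm
  have hrP : 0 < r / P := by positivity
  have gen : ∀ (F : ℝ → ℝ) (k : ℕ), ∫ y, F (r * y) * (r / P * p (m + r * y)) =
      (∫ x, F (x - m) * p x) / P := fun F k => by
    have := integral_comp_affine (fun x => F (x - m) * p x) m hr
    simp only [add_sub_cancel_left] at this
    calc _ = ∫ y, r / P * (F (r * y) * p (m + r * y)) := by congr 1; ext y; ring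
      _ = _ := by rw [integral_const_mul, this]; field_simp
  refine ⟨h.niceD.affine hrP hr.ne' m, ?_, ?_, ?_, ?_, ?_⟩
  · rw [integral_const_mul, integral_comp_affine p m hr, ← hPdef]; field_simp
  · have := (((h.int_cube_sub (-m)).comp_add_left m).comp_mul_left' hr.ne').const_mul
      (r / P / r ^ 3)
    refine this.congr (Filter.Eventually.of_forall fun y => ?_)
    simp only
    rw [show m + r * y + -m = r * y by ring, abs_mul, abs_of_pos hr]
    field_simp
  · have := gen (fun x => x / r) 0
    calc _ = ∫ y, r * y / r * (r / P * p (m + r * y)) := by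
          congr 1; ext y; rw [mul_div_cancel_left₀ _ hr.ne']
      _ = (∫ x, (x - m) / r * p x) / P := this
      _ = (∫ x, r⁻¹ * (x * p x - m * p x)) / P := by
          congr 2; ext x; field_simp
      _ = 0 := by
          rw [integral_const_mul, integral_sub h.int_id (h.niceD.nice.int.const_mul m),
            integral_const_mul, hm, ← hPdef]
          field_simp; simp
  · have := gen (fun x => |x / r| ^ 3) 0
    calc _ = ∫ y, |r * y / r| ^ 3 * (r / P * p (m + r * y)) := by
          congr 1; ext y; rw [mul_div_cancel_left₀ _ hr.ne']
      _ = (∫ x, |(x - m) / r| ^ 3 * p x) / P := this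
      _ = (∫ x, (r ^ 3)⁻¹ * (|x - m| ^ 3 * p x)) / P := by
          congr 2; ext x; rw [abs_div, abs_of_pos hr]; field_simp
      _ = (r ^ 3)⁻¹ * (∫ x, |x - m| ^ 3 * p x) / P := by rw [integral_const_mul]
      _ ≤ (r ^ 3)⁻¹ * (C * r ^ 3 * P) / P := by gcongr; exact h.cube
      _ = C := by field_simp
  · calc _ = ∫ y, r / P * r * |p' (m + r * y)| := by
          congr 1; ext y; rw [abs_mul, abs_mul, abs_of_pos hrP, abs_of_pos hr]; ring
      _ = r / P * r * (r⁻¹ * ∫ x, |p' x|) := by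
          rw [integral_const_mul, integral_comp_affine (fun x => |p' x|) m hr]
      _ = (r * ∫ x, |p' x|) / P := by field_simp
      _ ≤ C := by rw [div_le_iff₀ hP]; exact h.tv

end WidthBound

lemma PertPot.shift {lam B : ℝ} {φ φ' ψ ψ' : ℝ → ℝ} (h : PertPot lam B φ φ' ψ ψ') (c d : ℝ) :
    PertPot lam B (fun x => φ (c + x) - d) (fun x => φ' (c + x)) (fun x => ψ (c + x) - d)
      (fun x => ψ' (c + x)) where
  conv := h.conv.shift c d
  deriv x := (HasDerivAt.comp_const_add c x (h.deriv (c + x))).sub_const d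
  cont := by have := h.cont; fun_prop
  close x := by simpa using h.close (c + x)
  close' x := h.close' (c + x)

lemma PertPot.widthBound_crit {lam B : ℝ} {φ φ' ψ ψ' : ℝ → ℝ} (h : PertPot lam B φ φ' ψ ψ')
    {x₀ : ℝ} (h0 : φ' x₀ = 0) :
    WidthBound (4 * (256 * exp (2 * B) + (1 + 256 * exp (2 * B)) ^ 3)
      + exp (2 * B) * (2 + B * √(π / (lam / 2)))) (∫ x, exp (-(φ x - φ x₀)))
      (fun x => exp (-ψ x)) fun x => -ψ' x * exp (-ψ x) := by
  have := ((h.shift x₀ (φ x₀)).widthBound (by simp) (by simpa using h0)).shift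
    (exp_pos (-φ x₀)) (-x₀)
  rw [integral_add_left_eq_self (fun x => exp (-(φ x - φ x₀))) x₀] at this
  convert this using 2 with x x
  · rw [add_neg_cancel_left, ← exp_add]; ring_nf
  · rw [add_neg_cancel_left, mul_left_comm, ← exp_add]; ring_nf

/-- Uniform control of all boundedly tilted single-site densities at a common length scale. -/
lemma exists_goodDens (lam B L : ℝ) (hlam : 0 < lam) (hB : 0 ≤ B) : ∃ C : ℝ, 1 ≤ C ∧
    ∀ φ φ' ψ ψ' : ℝ → ℝ, PertPot lam B φ φ' ψ ψ' → ∃ r : ℝ, 0 < r ∧ ∀ β : ℝ, |β| ≤ L →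
      ∃ p', WidthBound C r (fun x => exp (-(ψ x + β * x))) p' := by
  set C0 := 4 * (256 * exp (2 * B) + (1 + 256 * exp (2 * B)) ^ 3)
      + exp (2 * B) * (2 + B * √(π / (lam / 2))) with hC0
  have hC00 : 0 ≤ C0 := by positivity
  set D := 2 * exp (2 * L ^ 2 / lam) with hD
  have hD1 : 1 ≤ D := by
    have : 1 ≤ exp (2 * L ^ 2 / lam) := one_le_exp (by positivity)
    linarith
  refine ⟨max 1 (C0 * D ^ 3), le_max_left _ _, fun φ φ' ψ ψ' h => ?_⟩
  obtain ⟨x₀, h0⟩ := h.conv.exists_crit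
  have hr : 0 < ∫ x, exp (-(φ x - φ x₀)) := by
    have := (h.conv.shift 0 (φ x₀)).integral_pos
    simpa using this
  refine ⟨∫ x, exp (-(φ x - φ x₀)), hr, fun β hβ => ?_⟩
  obtain ⟨x₁, h1⟩ := (h.conv.tilt β).exists_crit
  refine ⟨_,
    (((h.tilt β).widthBound_crit h1).change_scale hC00 ?_ hD1 ?_ ?_).mono hr.le (le_max_right _ _)⟩
  · have := ((h.conv.tilt β).shift 0 (φ x₁ + β * x₁)).integral_pos
    simpa using this
  · exact h.conv.width_tilt_le h0 h1 hβ
  · have := (h.conv.tilt β).width_tilt_le (β := -β) (x₀ := x₁) (x₁ := x₀) (L := L) h1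
      (by simpa using h0) (by simpa using hβ)
    simpa using this

lemma ConcaveOn.rearrange {l : ℝ → ℝ} (h : ConcaveOn ℝ Set.univ l) {a b t : ℝ} (hab : a ≤ b)
    (ht : 0 ≤ t) : l a + l (b + t) ≤ l (a + t) + l b := by
  rcases eq_or_lt_of_le (by linarith : 0 ≤ b + t - a) with h0 | h0
  · have h1 : t = 0 := by linarith
    subst h1
    simp
  · set d := b + t - a with hd
    have k1 := h.2 (Set.mem_univ a) (Set.mem_univ (b + t)) 
      (div_nonneg (by linarith : 0 ≤ b - a) h0.le) (div_nonneg ht h0.le)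
      (by rw [← add_div, div_eq_one_iff_eq h0.ne']; linarith)
    have k2 := h.2 (Set.mem_univ a) (Set.mem_univ (b + t)) 
      (div_nonneg ht h0.le) (div_nonneg (by linarith : 0 ≤ b - a) h0.le)
      (by rw [← add_div, div_eq_one_iff_eq h0.ne']; linarith)
    simp only [smul_eq_mul] at k1 k2
    have e1 : (b - a) / d * a + t / d * (b + t) = a + t := by
      field_simp; rw [hd]; ring
    have e2 : t / d * a + (b - a) / d * (b + t) = b := by
      field_simp; rw [hd]; ring
    rw [e1] at k1
    rw [e2] at k2
    have e3 : (b - a) / d + t / d = 1 := by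
      rw [← add_div, div_eq_one_iff_eq h0.ne']; linarith
    have : (b - a) / d * l a + t / d * l (b + t) + (t / d * l a + (b - a) / d * l (b + t)) =
      ((b - a) / d + t / d) * (l a + l (b + t)) := by ring
    rw [e3] at this
    linarith

/-- A positive function is log-concave as soon as at every point some exponential tilt of it has
nonpositive second derivative. -/
lemma LC_of_tilt {Z : ℝ → ℝ} (hZ : ∀ x, 0 < Z x)
    (h : ∀ s₀, ∃ r c σ : ℝ, ∃ (G' : ℝ → ℝ) (G2 : ℝ), 0 < r ∧ 0 < c ∧
      (∀ y, HasDerivAt (fun y => c * (Z (s₀ + r * y) * exp (σ * (s₀ + r * y)))) (G' y) y) ∧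
      HasDerivAt G' G2 0 ∧ G2 ≤ 0) : LC Z := by
  have key : ∀ s₀, (∃ d, HasDerivAt (fun s => log (Z s)) d s₀) ∧
      ∃ d2, HasDerivAt (deriv fun s => log (Z s)) d2 s₀ ∧ d2 ≤ 0 := by
    intro s₀
    obtain ⟨r, c, σ, G', G2, hr, hc, hG, hG', h2⟩ := h s₀
    set G : ℝ → ℝ := fun y => c * (Z (s₀ + r * y) * exp (σ * (s₀ + r * y))) with hGd
    have Gp : ∀ y, 0 < G y := fun y => mul_pos hc (mul_pos (hZ _) (exp_pos _))
    have haff : ∀ s, HasDerivAt (fun s => (s - s₀) / r) (1 / r) s := fun s =>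
      ((hasDerivAt_id s).sub_const s₀).div_const r
    have e : ∀ s, log (Z s) = log (G ((s - s₀) / r)) - log c - σ * s := fun s => by
      have hs : s₀ + r * ((s - s₀) / r) = s := by field_simp; ring
      rw [hGd]
      simp only
      rw [hs, Real.log_mul hc.ne' (mul_pos (hZ _) (exp_pos _)).ne',
        Real.log_mul (hZ s).ne' (exp_pos _).ne', Real.log_exp]
      ring
    have d1 : ∀ s, HasDerivAt (fun s => log (Z s))
        (G' ((s - s₀) / r) * (1 / r) / G ((s - s₀) / r) - σ) s := fun s => by
      have a0 : HasDerivAt (fun s => G ((s - s₀) / r)) (G' ((s - s₀) / r) * (1 / r)) s :=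
        HasDerivAt.comp (h₂ := G) s (hG ((s - s₀) / r)) (haff s)
      have a := (a0.log (Gp _).ne').sub_const (log c)
      have b := a.fun_sub ((hasDerivAt_id s).const_mul σ)
      have b' := b.congr_deriv (by rw [mul_one])
      exact b'.congr_of_eventuallyEq (Filter.Eventually.of_forall e)
    refine ⟨⟨_, d1 s₀⟩, ?_⟩
    have hd : (deriv fun s => log (Z s)) =
        fun s => G' ((s - s₀) / r) * (1 / r) / G ((s - s₀) / r) - σ :=
      funext fun s => (d1 s).deriv
    rw [hd]
    have h0 : (s₀ - s₀) / r = 0 := by simp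
    have b1 : HasDerivAt (fun s => G' ((s - s₀) / r)) (G2 * (1 / r)) s₀ :=
      HasDerivAt.comp (h₂ := G') s₀ (by rw [h0]; exact hG') (haff s₀)
    have b2 : HasDerivAt (fun s => G ((s - s₀) / r)) (G' 0 * (1 / r)) s₀ :=
      HasDerivAt.comp (h₂ := G) s₀ (by rw [h0]; exact hG 0) (haff s₀)
    have b3 := ((b1.mul_const (1 / r)).fun_div b2 (Gp _).ne').sub_const σ
    refine ⟨_, b3, ?_⟩
    rw [h0]
    refine div_nonpos_of_nonpos_of_nonneg ?_ (sq_nonneg _)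
    have c1 : G2 * (1 / r) * (1 / r) * G 0 ≤ 0 := by
      have := mul_nonneg (mul_nonneg (one_div_nonneg.2 hr.le) (one_div_nonneg.2 hr.le)) (Gp 0).le
      nlinarith
    nlinarith [sq_nonneg (G' 0 * (1 / r))]
  have hc : ConcaveOn ℝ Set.univ fun s => log (Z s) := by
    refine concaveOn_univ_of_deriv2_nonpos (fun s => ?_) (fun s => ?_) fun s => ?_
    · obtain ⟨d, hd⟩ := (key s).1; exact hd.differentiableAt
    · obtain ⟨d, hd, -⟩ := (key s).2; exact hd.differentiableAt
    · obtain ⟨d, hd, h0⟩ := (key s).2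
      simp only [Function.iterate_succ, Function.iterate_zero, Function.comp_apply, id]
      rw [hd.deriv]; exact h0
  intro a b t hab ht
  have := hc.rearrange hab ht
  rw [← Real.log_mul (hZ _).ne' (hZ _).ne', ← Real.log_mul (hZ _).ne' (hZ _).ne'] at this
  exact (Real.log_le_log_iff (mul_pos (hZ _) (hZ _)) (mul_pos (hZ _) (hZ _))).1 this

lemma exists_deriv_of_ft {G : ℝ → ℝ} (hc : Continuous G) (hi : Integrable G) {Φ : ℝ → ℂ}
    (hΦ : ∀ z, ft G z = Φ z) (i0 : Integrable Φ) (i1 : Integrable fun z : ℝ => z • Φ z)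
    (i2 : Integrable fun z : ℝ => (z : ℂ) ^ 2 * Φ z) :
    ∃ G' : ℝ → ℝ, (∀ y, HasDerivAt G (G' y) y) ∧
      HasDerivAt G' (-(4 * π ^ 2 * (∫ z : ℝ, (z : ℂ) ^ 2 * Φ z).re)) 0 := by
  set g : ℝ → ℂ := fun y => (G y : ℂ) with hg
  have hF : FourierTransform.fourier g = Φ := funext fun z => by rw [← hΦ, ft_eq_fourier]
  have inv := Continuous.fourierInv_fourier_eq (f := g) (by fun_prop) hi.ofReal (hF ▸ i0)
  rw [hF] at inv
  have eG : ∀ y, G y = (FourierTransform.fourier Φ (-y)).re := fun y => by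
    rw [← Real.fourierInv_eq_fourier_neg, inv]; simp [hg]
  set Φ1 : ℝ → ℂ := fun x => (-2 * ↑π * Complex.I * ↑x) • Φ x with hΦ1
  have j1 : Integrable Φ1 := by
    refine (i1.const_mul (-2 * ↑π * Complex.I)).congr (Filter.Eventually.of_forall fun z => ?_)
    simp only [hΦ1, smul_eq_mul, Complex.real_smul]; ring
  have j2 : Integrable fun x : ℝ => x • Φ1 x := by
    refine (i2.const_mul (-2 * ↑π * Complex.I)).congr (Filter.Eventually.of_forall fun z => ?_)
    simp only [hΦ1, smul_eq_mul, Complex.real_smul]; ring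
  have D1 := Real.hasDerivAt_fourier i0 i1
  have D2 := Real.hasDerivAt_fourier j1 j2
  have re_neg : ∀ (H : ℝ → ℂ) (H' : ℂ) (y : ℝ), HasDerivAt H H' (-y) →
      HasDerivAt (fun y => (H (-y)).re) (-H').re y := fun H H' y hH => by
    have a := HasDerivAt.scomp y hH (hasDerivAt_neg y)
    have b := Complex.reCLM.hasFDerivAt.comp_hasDerivAt y a
    refine b.congr_deriv ?_
    simp
  refine ⟨fun y => (-FourierTransform.fourier Φ1 (-y)).re, fun y => ?_, ?_⟩
  · exact (re_neg _ _ y (D1 (-y))).congr_of_eventuallyEq (Filter.Eventually.of_forall eG)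
  · have := (re_neg _ _ 0 (D2 (-0))).fun_neg
    simp only [Complex.neg_re] at this ⊢
    refine this.congr_deriv ?_
    rw [neg_neg, neg_zero, Real.fourier_eq']
    have e : ∀ v : ℝ, Complex.exp (↑(-2 * π * inner ℝ v 0) * Complex.I) •
        (-2 * ↑π * Complex.I * ↑v) • Φ1 v = ((-(4 * π ^ 2) : ℝ) : ℂ) * ((v : ℂ) ^ 2 * Φ v) := by
      intro v
      simp only [inner_zero_right, mul_zero, Complex.ofReal_zero, zero_mul, Complex.exp_zero,
        one_smul, hΦ1, smul_eq_mul]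
      push_cast
      linear_combination (4 * π ^ 2 * (v : ℂ) ^ 2 * Φ v) * Complex.I_sq
    simp only [e]
    rw [integral_const_mul, Complex.re_ofReal_mul]
    ring

lemma Samples.integral_sum {ι : Type} [Fintype ι] {p : ι → ℝ → ℝ} {Z : ℝ → ℝ} {A : ℝ}
    (h : Samples p Z A) (hp : ∀ i, Nice (p i)) (hZ : Nice Z) {θ : ℝ → ℂ} (hθ : Continuous θ) :
    ∫ s, (Z s : ℂ) * θ s = ∫ x : ι → ℝ, (∏ i, (p i (x i) : ℂ)) * θ (∑ i, x i) := by
  obtain ⟨Ω, _, P, _, X, hXm, -, hsum, hF⟩ := h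
  have hpm : ∀ i, Measurable (p i) := fun i => (hp i).cont.measurable
  have m1 : Measurable fun x : ι → ℝ => ∏ i, ENNReal.ofReal (p i (x i)) :=
    Finset.measurable_prod _ fun i _ => ((hpm i).comp (measurable_pi_apply i)).ennreal_ofReal
  have m2 : Measurable fun s => ENNReal.ofReal (Z s) := hZ.cont.measurable.ennreal_ofReal
  have m3 : Measurable fun x : ι → ℝ => ∑ i, x i :=
    Finset.measurable_sum _ fun i _ => measurable_pi_apply i
  have hmap : Measure.map (fun x : ι → ℝ => ∑ i, x i)
      (volume.withDensity fun x => ∏ i, ENNReal.ofReal (p i (x i))) =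
      volume.withDensity fun s => ENNReal.ofReal (Z s) := by
    ext S hS
    rw [Measure.map_apply m3 hS, withDensity_apply _ (m3 hS), withDensity_apply _ hS,
      ← lintegral_indicator (m3 hS), ← lintegral_indicator hS]
    have := hF (fun x => S.indicator 1 (∑ i, x i)) ((measurable_one.indicator hS).comp m3)
    calc _ = ∫⁻ x : ι → ℝ, S.indicator 1 (∑ i, x i) * ∏ i, ENNReal.ofReal (p i (x i)) := by
          congr 1; ext x
          by_cases hx : ∑ i, x i ∈ S <;> simp [Set.indicator, hx]
      _ = _ := by
          rw [this]
          congr 1; ext s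
          simp only [hsum, lintegral_const, measure_univ, mul_one]
          by_cases hx : s ∈ S <;> simp [Set.indicator, hx]
  have a1 := integral_withDensity_eq_integral_toReal_smul (μ := volume) m2
    (Filter.Eventually.of_forall fun s => ENNReal.ofReal_lt_top) θ
  have a2 := integral_withDensity_eq_integral_toReal_smul (μ := volume) m1
    (Filter.Eventually.of_forall fun s => ENNReal.prod_lt_top fun i _ => ENNReal.ofReal_lt_top)
    fun x : ι → ℝ => θ (∑ i, x i)
  rw [← hmap, integral_map m3.aemeasurable hθ.aestronglyMeasurable, a2] at a1
  calc _ = ∫ s, (ENNReal.ofReal (Z s)).toReal • θ s := by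
        congr 1; ext s
        rw [ENNReal.toReal_ofReal (hZ.pos s).le, Complex.real_smul]
    _ = _ := by
        rw [← a1]
        congr 1; ext x
        rw [ENNReal.toReal_prod, Complex.real_smul]
        congr 1
        push_cast
        exact Finset.prod_congr rfl fun i _ => by rw [ENNReal.toReal_ofReal ((hp i).pos _).le]

lemma Samples.integral_exp {ι : Type} [Fintype ι] {p : ι → ℝ → ℝ} {Z : ℝ → ℝ} {A : ℝ}
    (h : Samples p Z A) (hp : ∀ i, Nice (p i)) (hZ : Nice Z) (w : ℂ) :
    ∫ s, (Z s : ℂ) * Complex.exp (w * s) = ∏ i, ∫ x, (p i x : ℂ) * Complex.exp (w * x) := by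
  rw [h.integral_sum hp hZ (θ := fun s => Complex.exp (w * s)) (by fun_prop),
    ← integral_fintype_prod_volume_eq_prod]
  congr 1; ext x
  rw [Finset.prod_mul_distrib, ← Complex.exp_sum]
  push_cast
  rw [Finset.mul_sum]

lemma Samples.integral_rexp {ι : Type} [Fintype ι] {p : ι → ℝ → ℝ} {Z : ℝ → ℝ} {A : ℝ}
    (h : Samples p Z A) (hp : ∀ i, Nice (p i)) (hZ : Nice Z) (σ : ℝ) :
    ∫ s, Z s * exp (σ * s) = ∏ i, ∫ x, p i x * exp (σ * x) := by
  have := h.integral_exp hp hZ σ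
  have e : ∀ q : ℝ → ℝ, ∫ s, (q s : ℂ) * Complex.exp (σ * s) =
      ((∫ s, q s * exp (σ * s) : ℝ) : ℂ) := fun q => by
    rw [← integral_complex_ofReal]; push_cast; rfl
  simp only [e] at this
  exact_mod_cast this

lemma integral_mul_exp_pos {q : ℝ → ℝ} (hq : ∀ x, 0 < q x) {σ : ℝ}
    (hi : Integrable fun x => q x * exp (σ * x)) : 0 < ∫ x, q x * exp (σ * x) := by
  have hp : ∀ x, 0 < q x * exp (σ * x) := fun x => mul_pos (hq x) (exp_pos _)
  rw [integral_pos_iff_support_of_nonneg (fun x => (hp x).le) hi]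
  have : Function.support (fun x => q x * exp (σ * x)) = Set.univ :=
    Set.eq_univ_of_forall fun x => (hp x).ne'
  rw [this]; simp

lemma hasDerivAt_integral_exp {q : ℝ → ℝ} (hq : Nice q)
    (hi : ∀ σ : ℝ, Integrable fun x => q x * exp (σ * x)) (σ : ℝ) :
    HasDerivAt (fun σ => ∫ x, q x * exp (σ * x)) (∫ x, x * (q x * exp (σ * x))) σ := by
  set μ := volume.withDensity fun s => ENNReal.ofReal (q s) with hμ
  have m2 : Measurable fun s => ENNReal.ofReal (q s) := hq.cont.measurable.ennreal_ofReal
  have conv : ∀ F : ℝ → ℝ, ∫ x, F x ∂μ = ∫ x, q x * F x := fun F => by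
    rw [hμ, integral_withDensity_eq_integral_toReal_smul m2
      (Filter.Eventually.of_forall fun s => ENNReal.ofReal_lt_top)]
    congr 1; ext x
    rw [ENNReal.toReal_ofReal (hq.pos x).le, smul_eq_mul]
  have hs : ProbabilityTheory.integrableExpSet id μ = Set.univ := by
    refine Set.eq_univ_of_forall fun t => ?_
    show Integrable _ μ
    rw [hμ, integrable_withDensity_iff m2
      (Filter.Eventually.of_forall fun s => ENNReal.ofReal_lt_top)]
    refine (hi t).congr (Filter.Eventually.of_forall fun x => ?_)
    simp only [id]
    rw [ENNReal.toReal_ofReal (hq.pos x).le, mul_comm]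
  have := ProbabilityTheory.hasDerivAt_mgf (X := id) (μ := μ) (t := σ) (by rw [hs]; simp)
  rw [conv] at this
  have e1 : ProbabilityTheory.mgf id μ = fun σ => ∫ x, q x * exp (σ * x) :=
    funext fun σ => conv _
  rw [e1] at this
  refine this.congr_deriv ?_
  congr 1; ext x; simp only [id]; ring

/-- Existence of the tilt which centres the product density at a given value of the sum. -/
lemma exists_tilt {ι : Type} [Fintype ι] {p : ι → ℝ → ℝ} {Z : ℝ → ℝ} {A : ℝ}
    (h : Samples p Z A) (hp : ∀ i, Nice (p i)) (hZ : Nice Z)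
    (hi : ∀ i, ∀ σ : ℝ, Integrable fun x => p i x * exp (σ * x)) (s₀ : ℝ) :
    ∃ σ : ℝ, ∑ i, (∫ x, x * (p i x * exp (σ * x))) / (∫ x, p i x * exp (σ * x)) = s₀ := by
  have Mpos : ∀ i σ, 0 < ∫ x, p i x * exp (σ * x) := fun i σ =>
    integral_mul_exp_pos (hp i).pos (hi i σ)
  have iZ : ∀ σ : ℝ, Integrable fun s => Z s * exp (σ * s) := fun σ => by
    by_contra hc
    have e := h.integral_rexp hp hZ σ
    rw [integral_undef hc] at e
    exact (Finset.prod_pos fun i _ => Mpos i σ).ne e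
  set M : ℝ → ℝ := fun σ => exp (-(σ * s₀)) * ∏ i, ∫ x, p i x * exp (σ * x) with hM
  have hMZ : ∀ σ, M σ = ∫ s, Z s * exp (σ * (s - s₀)) := fun σ => by
    rw [hM]
    simp only
    rw [← h.integral_rexp hp hZ σ, ← integral_const_mul]
    congr 1; ext s
    rw [mul_left_comm, ← exp_add]; ring_nf
  have hd := fun i σ => hasDerivAt_integral_exp (hp i) (hi i) σ
  have hMc : Continuous M := by
    refine Continuous.mul (by fun_prop) (continuous_finsetProd _ fun i _ => ?_)
    exact continuous_iff_continuousAt.2 fun σ => (hd i σ).continuousAt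
  have iZ' : ∀ σ : ℝ, Integrable fun s => Z s * exp (σ * (s - s₀)) := fun σ => by
    refine ((iZ σ).const_mul (exp (-(σ * s₀)))).congr (Filter.Eventually.of_forall fun s => ?_)
    simp only
    rw [mul_left_comm, ← exp_add]; ring_nf
  have lower : ∀ S : Set ℝ, MeasurableSet S → (∀ σ : ℝ, (∀ s ∈ S, |σ| ≤ σ * (s - s₀)) →
      (∫ s in S, Z s) * exp |σ| ≤ M σ) := fun S hS σ hσ => by
    rw [hMZ, ← integral_mul_const]
    refine le_trans ?_ (setIntegral_le_integral (s := S) (iZ' σ)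
      (Filter.Eventually.of_forall fun s => mul_nonneg (hZ.pos s).le (exp_pos _).le))
    refine setIntegral_mono_on (hZ.int.mul_const _).integrableOn (iZ' σ).integrableOn hS
      fun s hs => ?_
    exact mul_le_mul_of_nonneg_left (exp_le_exp.2 (hσ s hs)) (hZ.pos s).le
  have spos : ∀ S : Set ℝ, MeasurableSet S → 0 < volume S → 0 < ∫ s in S, Z s := fun S hS hv => by
    rw [setIntegral_pos_iff_support_of_nonneg_ae
      (Filter.Eventually.of_forall fun s => (hZ.pos s).le) hZ.int.integrableOn]
    have : Function.support Z = Set.univ := Set.eq_univ_of_forall fun x => (hZ.pos x).ne'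
    rwa [this, Set.univ_inter]
  set c := min (∫ s in Set.Ici (s₀ + 1), Z s) (∫ s in Set.Iic (s₀ - 1), Z s) with hc
  have c0 : 0 < c := lt_min (spos _ measurableSet_Ici (by simp)) (spos _ measurableSet_Iic (by simp))
  have low : ∀ σ, c * exp |σ| ≤ M σ := fun σ => by
    rcases le_total 0 σ with hσ | hσ
    · refine le_trans (mul_le_mul_of_nonneg_right (min_le_left _ _) (exp_pos _).le)
        (lower _ measurableSet_Ici σ fun s hs => ?_)
      rw [abs_of_nonneg hσ]
      have : s₀ + 1 ≤ s := hs
      nlinarith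
    · refine le_trans (mul_le_mul_of_nonneg_right (min_le_right _ _) (exp_pos _).le)
        (lower _ measurableSet_Iic σ fun s hs => ?_)
      rw [abs_of_nonpos hσ]
      have : s ≤ s₀ - 1 := hs
      nlinarith
  have hT : Filter.Tendsto M (Filter.cocompact ℝ) Filter.atTop := by
    refine Filter.tendsto_atTop_mono low (Filter.Tendsto.const_mul_atTop c0 ?_)
    exact tendsto_exp_atTop.comp tendsto_norm_cocompact_atTop
  obtain ⟨σ, hσ⟩ := hMc.exists_forall_le hT
  refine ⟨σ, ?_⟩
  have hl : HasDerivAt (fun σ => ∑ i, log (∫ x, p i x * exp (σ * x)) - σ * s₀)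
      (∑ i, (∫ x, x * (p i x * exp (σ * x))) / (∫ x, p i x * exp (σ * x)) - s₀) σ := by
    have a := HasDerivAt.fun_sum (u := Finset.univ) fun i _ => (hd i σ).log (Mpos i σ).ne'
    have b := a.fun_sub ((hasDerivAt_id σ).mul_const s₀)
    exact b.congr_deriv (by rw [one_mul])
  have hlM : ∀ σ, ∑ i, log (∫ x, p i x * exp (σ * x)) - σ * s₀ = log (M σ) := fun σ => by
    rw [hM]
    simp only
    rw [Real.log_mul (exp_pos _).ne' (Finset.prod_pos fun i _ => Mpos i σ).ne', Real.log_exp,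
      Real.log_prod (fun i _ => (Mpos i σ).ne')]
    ring
  have hmin : IsLocalMin (fun σ => ∑ i, log (∫ x, p i x * exp (σ * x)) - σ * s₀) σ := by
    refine Filter.Eventually.of_forall fun τ => ?_
    simp only [hlM]
    exact Real.log_le_log (lt_of_lt_of_le (mul_pos c0 (exp_pos _)) (low σ)) (hσ τ)
  have := hmin.hasDerivAt_eq_zero hl
  linarith

lemma ft_affine (q : ℝ → ℝ) (c m z : ℝ) {r : ℝ} (hr : 0 < r) :
    ft (fun y => c * q (m + r * y)) z =
      ((c / r : ℝ) : ℂ) * Complex.exp (m * ((2 * π * z / r : ℝ) * Complex.I)) *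
        ∫ x, (q x : ℂ) * Complex.exp (-((2 * π * z / r : ℝ) * Complex.I) * x) := by
  set w : ℂ := (2 * π * z / r : ℝ) * Complex.I with hw
  set F : ℝ → ℂ := fun x => (c * Complex.exp (m * w)) * ((q x : ℂ) * Complex.exp (-w * x)) with hF
  have e1 : ft (fun y => c * q (m + r * y)) z = ∫ y, F (m + r * y) := by
    unfold ft
    congr 1; ext y
    simp only [hF]
    have : Complex.exp ((-2 * π * y * z : ℝ) * Complex.I) =
        Complex.exp (m * w) * Complex.exp (-w * ((m + r * y : ℝ) : ℂ)) := by
      rw [← Complex.exp_add]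
      congr 1
      have hr' : (r : ℂ) ≠ 0 := by exact_mod_cast hr.ne'
      rw [hw]
      push_cast
      field_simp
      ring
    rw [this]
    push_cast
    ring
  rw [e1, Measure.integral_comp_mul_left (fun x => F (m + x)) r, integral_add_left_eq_self,
    abs_of_pos (inv_pos.2 hr), hF, integral_const_mul, Complex.real_smul]
  push_cast
  ring

lemma Samples.integrable_exp {ι : Type} [Fintype ι] {p : ι → ℝ → ℝ} {Z : ℝ → ℝ} {A : ℝ}
    (h : Samples p Z A) (hp : ∀ i, Nice (p i)) (hZ : Nice Z) {σ : ℝ}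
    (hi : ∀ i, Integrable fun x => p i x * exp (σ * x)) : Integrable fun s => Z s * exp (σ * s) := by
  by_contra hc
  have e := h.integral_rexp hp hZ σ
  rw [integral_undef hc] at e
  exact (Finset.prod_pos fun i _ => integral_mul_exp_pos (hp i).pos (hi i)).ne e

lemma exists_LC {lam B : ℝ} (L : ℝ) (hlam : 0 < lam) (hB : 0 ≤ B) : ∃ k0 : ℕ, ∀ k : ℕ, k0 ≤ k →
    ∀ φ φ' ψ ψ' : ℝ → ℝ, PertPot lam B φ φ' ψ ψ' → ∀ a : Fin k → ℝ, (∀ i, |a i| ≤ L) →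
      ∀ (Z : ℝ → ℝ) (A : ℝ), Nice Z → Samples (fun i x => exp (-(ψ x + a i * x))) Z A → LC Z := by
  obtain ⟨C, hC, hgd⟩ := exists_goodDens lam B L hlam hB
  have hpi := Real.pi_gt_three
  have hpi2 : 9 ≤ π ^ 2 := by nlinarith
  have hpi3 : π ^ 2 ≤ π ^ 3 := pow_le_pow_right₀ (by linarith) (by norm_num)
  set D := 4 * (2 * π) ^ 3 * (1 + C) with hD
  have hD' : D = 32 * π ^ 3 * (1 + C) := by rw [hD]; ring
  have hCD : C ≤ D := by rw [hD']; nlinarith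
  set c := 1 / (32 * C ^ 2) with hc
  have hC2 : 1 ≤ C ^ 2 := by nlinarith
  obtain ⟨k0, hk0⟩ := exists_re_integral_pos (C := D) (c := c) (by linarith) (by positivity)
    (by rw [hc, div_le_one (by positivity)]; linarith)
  refine ⟨k0, fun k hk φ φ' ψ ψ' hP a ha Z A hZ hS => ?_⟩
  set p : Fin k → ℝ → ℝ := fun i x => exp (-(ψ x + a i * x)) with hp
  have hpn : ∀ i, Nice (p i) := fun i => (hP.tilt (a i)).nice
  have hpe : ∀ i (σ : ℝ), (fun x => p i x * exp (σ * x)) =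
      fun x => exp (-((ψ x + -σ * x) + a i * x)) := fun i σ => by
    ext x; rw [hp]; simp only; rw [← exp_add]; ring_nf
  have hpi : ∀ i (σ : ℝ), Integrable fun x => p i x * exp (σ * x) := fun i σ => by
    rw [hpe]; exact ((hP.tilt (-σ)).tilt (a i)).nice.int
  refine LC_of_tilt hZ.pos fun s₀ => ?_
  obtain ⟨σ, hσ⟩ := exists_tilt hS hpn hZ hpi s₀
  obtain ⟨r, hr, hw⟩ := hgd _ _ _ _ (hP.tilt (-σ))
  choose p' hp' using fun i => hw (a i) (ha i)
  simp only [← hpe] at hp'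
  set P : Fin k → ℝ := fun i => ∫ x, p i x * exp (σ * x) with hPd
  set mn : Fin k → ℝ := fun i => (∫ x, x * (p i x * exp (σ * x))) / P i with hmn
  have hPp : ∀ i, 0 < P i := fun i => (hp' i).int_pos
  set g : Fin k → ℝ → ℝ := fun i y => r / P i * (p i (mn i + r * y) * exp (σ * (mn i + r * y)))
    with hg
  have hG : ∀ i, GoodDens C (g i) (fun y => r / P i * (p' i (mn i + r * y) * r)) :=
    fun i => (hp' i).goodDens hr
  obtain ⟨b1, b2, b3⟩ := hk0 k hk (fun i => ft (g i)) (fun i => 4 * π ^ 2 * ∫ y, |y| ^ 2 * g i y)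
    (fun i => continuous_ft (hG i).niceD.nice.int)
    (fun i => by
      obtain ⟨v0, v1⟩ := (hG i).var_le
      refine ⟨by positivity, ?_⟩
      have : 4 * π ^ 2 * ∫ y, |y| ^ 2 * g i y ≤ 4 * π ^ 2 * (1 + C) := by gcongr
      rw [hD']
      nlinarith)
    (fun i z => ((hG i).niceD.norm_ft_mul_le z).trans ((hG i).tv.trans hCD))
    (fun i z => by
      have := (hG i).norm_le hC z
      rw [hc, div_mul_eq_mul_div, one_mul]; exact this)
    (fun i z => by
      refine ((hG i).taylor z).trans ?_
      rw [hD]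
      have : C ≤ 1 + C := by linarith
      gcongr)
  set Φ : ℝ → ℂ := fun z => ∏ i, ft (g i) z with hΦ
  have hΦc : Continuous Φ := continuous_finsetProd _ fun i _ =>
    continuous_ft (hG i).niceD.nice.int
  set cc := r / ∏ i, P i with hcc
  have hPP : 0 < ∏ i, P i := Finset.prod_pos fun i _ => hPp i
  have iG := hS.integrable_exp hpn hZ (hpi · σ)
  have hft : ∀ z, ft (fun y => cc * (Z (s₀ + r * y) * exp (σ * (s₀ + r * y)))) z = Φ z := by
    intro z
    set w : ℂ := (2 * π * z / r : ℝ) * Complex.I with hw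
    have e1 : ∀ q : ℝ → ℝ, (∫ x, ((q x * exp (σ * x) : ℝ) : ℂ) * Complex.exp (-w * x)) =
        ∫ x, (q x : ℂ) * Complex.exp ((σ - w) * x) := fun q => by
      congr 1; ext x
      push_cast
      rw [mul_assoc, ← Complex.exp_add]; ring_nf
    rw [ft_affine (fun s => Z s * exp (σ * s)) cc s₀ z hr, e1, hS.integral_exp hpn hZ, hΦ]
    simp only [hg]
    have e2 : ∀ i, ft (fun y => r / P i * (p i (mn i + r * y) * exp (σ * (mn i + r * y)))) z =
        ((1 / P i : ℝ) : ℂ) * Complex.exp (mn i * w) *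
          ∫ x, (p i x : ℂ) * Complex.exp ((σ - w) * x) := fun i => by
      rw [ft_affine (fun s => p i s * exp (σ * s)) _ (mn i) z hr, e1,
        div_div_cancel_left' hr.ne', one_div]
    simp only [e2]
    rw [Finset.prod_mul_distrib, Finset.prod_mul_distrib, ← Complex.exp_sum, ← Finset.sum_mul,
      ← Complex.ofReal_prod, ← Complex.ofReal_sum, hσ, hcc, div_div_cancel_left' hr.ne',
      Finset.prod_div_distrib, Finset.prod_const_one, one_div]
  have hinv : Integrable fun z : ℝ => (1 + z ^ 2)⁻¹ := integrable_inv_one_add_sq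
  have b4 : ∀ z : ℝ, z ^ 2 * ‖Φ z‖ ≤ 2 * D ^ 4 * (1 + z ^ 2)⁻¹ := fun z => by
    have := b1 z
    rwa [norm_mul, norm_pow, Complex.norm_real, Real.norm_eq_abs, sq_abs] at this
  have i2 : Integrable fun z : ℝ => (z : ℂ) ^ 2 * Φ z :=
    (hinv.const_mul _).mono' (Continuous.aestronglyMeasurable (by fun_prop))
      (Filter.Eventually.of_forall b1)
  have b0 : ∀ z : ℝ, ‖Φ z‖ ≤ (1 + 2 * D ^ 4) * (1 + z ^ 2)⁻¹ := fun z => by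
    rw [← div_eq_mul_inv, le_div_iff₀ (by positivity), mul_add, mul_one, mul_comm _ (z ^ 2)]
    have h1 : (1 + z ^ 2)⁻¹ ≤ 1 := inv_le_one_of_one_le₀ (by nlinarith [sq_nonneg z])
    have h2 : 2 * D ^ 4 * (1 + z ^ 2)⁻¹ ≤ 2 * D ^ 4 := mul_le_of_le_one_right (by positivity) h1
    linarith [b2 z, b4 z]
  have i0 : Integrable Φ :=
    (hinv.const_mul _).mono' hΦc.aestronglyMeasurable (Filter.Eventually.of_forall b0)
  have i1 : Integrable fun z : ℝ => z • Φ z := by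
    refine (i0.norm.add i2.norm).mono' (Continuous.aestronglyMeasurable (by fun_prop))
      (Filter.Eventually.of_forall fun z => ?_)
    simp only [Pi.add_apply]
    rw [norm_smul, norm_mul, norm_pow, Complex.norm_real, Real.norm_eq_abs]
    nlinarith [norm_nonneg (Φ z), sq_nonneg (|z| - 1), abs_nonneg z]
  obtain ⟨G', hG1, hG2⟩ := exists_deriv_of_ft
    (G := fun y => cc * (Z (s₀ + r * y) * exp (σ * (s₀ + r * y))))
    (by have := hZ.cont; fun_prop)
    (((iG.comp_add_left s₀).comp_mul_left' hr.ne').const_mul cc) hft i0 i1 i2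
  refine ⟨r, cc, σ, G', _, hr, by positivity, hG1, hG2, ?_⟩
  have : 0 < 4 * π ^ 2 * (∫ z : ℝ, (z : ℂ) ^ 2 * Φ z).re := mul_pos (by positivity) b3
  linarith

/-- The samples for the canonical ensemble, with Lipschitz constant uniform in the number of
sites. -/
lemma exists_samples_uniform {lam B : ℝ} (L : ℝ) (hlam : 0 < lam) (hB : 0 ≤ B)
    {φ φ' ψ ψ' : ℝ → ℝ} (hP : PertPot lam B φ φ' ψ ψ') : ∃ A : ℝ, 0 ≤ A ∧ ∀ n : ℕ, 0 < n →
    ∀ a : Fin n → ℝ, (∀ i, |a i| ≤ L) →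
      ∃ Z, Nice Z ∧ Samples (fun i x => exp (-(ψ x + a i * x))) Z A := by
  obtain ⟨k1, hk1⟩ := exists_LC (lam := lam) (B := B) L hlam hB
  set k0 := k1 + 1 with hk0
  choose A hA hAS using exists_samples_of_pertPot hlam hB
  have mono : ∀ {ι : Type} [Fintype ι] {p : ι → ℝ → ℝ} {Z : ℝ → ℝ} {a b : ℝ}, a ≤ b →
      Samples p Z a → Samples p Z b := fun hab ⟨Ω, m, P, hP, X, h1, h2, h3⟩ =>
    ⟨Ω, m, P, hP, X, h1, fun s t ω i => (h2 s t ω i).trans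
      (mul_le_mul_of_nonneg_right hab (abs_nonneg _)), h3⟩
  set M := ∑ n ∈ Finset.range (2 * k0), A n with hM
  have hM0 : 0 ≤ M := Finset.sum_nonneg fun n _ => hA n
  refine ⟨M, hM0, fun n => ?_⟩
  induction n using Nat.strong_induction_on with
  | _ n ih =>
    intro hn a ha
    rcases lt_or_ge n (2 * k0) with hlt | hge
    · obtain ⟨n, rfl⟩ : ∃ l, n = l + 1 := ⟨n - 1, by omega⟩
      obtain ⟨Z, W, hZ, -, -, -, -, hS⟩ := hAS n (fun i x => φ x + a i * x) (fun i x => φ' x + a i)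
        (fun i x => ψ x + a i * x) (fun i x => ψ' x + a i) fun i => hP.tilt (a i)
      exact ⟨Z, hZ, mono (Finset.single_le_sum (f := A) (fun n _ => hA n)
        (Finset.mem_range.2 (by omega))) hS⟩
    · obtain ⟨l, rfl⟩ : ∃ l, n = k0 + l := ⟨n - k0, by omega⟩
      obtain ⟨Z, hZ, hS⟩ := ih k0 (by omega) (by omega) (fun i => a (Fin.castAdd l i))
        fun i => ha _
      obtain ⟨W, hW, hT⟩ := ih l (by omega) (by omega) (fun i => a (Fin.natAdd k0 i))
        fun i => ha _
      have pm : ∀ b : ℝ, Measurable fun x => exp (-(ψ x + b * x)) := fun b =>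
        (hP.tilt b).nice.cont.measurable
      have key := Samples.node_of_LC hM0 hM0 (fun i => pm _) (fun i => pm _) hZ hW
        (hk1 k0 (by omega) _ _ _ _ hP _ (fun i => ha _) _ _ hZ hS)
        (hk1 l (by omega) _ _ _ _ hP _ (fun i => ha _) _ _ hW hT) hS hT
      rw [max_self] at key
      refine ⟨cv Z W, hZ.cv hW, Samples.reindex finSumFinEquiv (fun i => pm _) ?_⟩
      convert key using 1
      ext i x
      rcases i with i | i <;> simp

lemma HasDerivAt.abs_le_of_eventually {f Q : ℝ → ℝ} {f' x : ℝ} (hf : HasDerivAt f f' x)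
    (hQ : ContinuousAt Q x) (h : ∀ᶠ t in nhds x, |f t - f x| ≤ Q t * |t - x|) : |f'| ≤ Q x := by
  have h1 := (hasDerivAt_iff_tendsto_slope.1 hf).abs
  have h2 : Filter.Tendsto Q (nhdsWithin x {x}ᶜ) (nhds (Q x)) := hQ.tendsto.mono_left nhdsWithin_le_nhds
  refine le_of_tendsto_of_tendsto h1 h2 ?_
  filter_upwards [h.filter_mono nhdsWithin_le_nhds, self_mem_nhdsWithin] with t ht htx
  have : 0 < |t - x| := abs_pos.2 (sub_ne_zero.2 htx)
  rw [slope_def_field, abs_div, div_le_iff₀ this]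
  exact ht

section Core

variable {V : Type} [NormedAddCommGroup V] [NormedSpace ℝ V] [FiniteDimensional ℝ V]
  [MeasurableSpace V] [BorelSpace V]

lemma integral_mul_eq_setIntegral_tsupport (η : Measure V) (f g : V → ℝ) :
    ∫ z, f z * g z ∂η = ∫ z in tsupport f, f z * g z ∂η := by
  rw [setIntegral_eq_integral_of_forall_compl_eq_zero]
  intro z hz
  rw [image_eq_zero_of_notMem_tsupport hz, zero_mul]

lemma continuous_integral_mul {η : Measure V} [IsFiniteMeasureOnCompacts η] {ρ : ℝ → V → ℝ}
    (hρ : Continuous (Function.uncurry ρ)) {f : V → ℝ} (hf : Continuous f)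
    (hfs : HasCompactSupport f) : Continuous fun s => ∫ z, f z * ρ s z ∂η := by
  simp only [fun s => integral_mul_eq_setIntegral_tsupport η f (ρ s)]
  refine continuous_parametric_integral_of_continuous (f := fun s z => f z * ρ s z) ?_ hfs
  exact (hf.comp continuous_snd).mul hρ

lemma hasDerivAt_integral_mul {η : Measure V} [IsFiniteMeasureOnCompacts η] {ρ ρ' : ℝ → V → ℝ}
    (hρ : Continuous (Function.uncurry ρ)) (hρ' : Continuous (Function.uncurry ρ'))
    (hd : ∀ s z, HasDerivAt (fun s => ρ s z) (ρ' s z) s) {f : V → ℝ} (hf : Continuous f)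
    (hfs : HasCompactSupport f) (s : ℝ) :
    HasDerivAt (fun s => ∫ z, f z * ρ s z ∂η) (∫ z, f z * ρ' s z ∂η) s := by
  have hρs : ∀ s, Continuous (ρ s) := fun s => hρ.comp (Continuous.prodMk_right s)
  have hρs' : ∀ s, Continuous (ρ' s) := fun s => hρ'.comp (Continuous.prodMk_right s)
  have hgi : ∀ g : V → ℝ, Continuous g → Integrable (fun z => f z * g z) η := fun g hg =>
    (hf.mul hg).integrable_of_hasCompactSupport (hfs.mul_right)
  obtain ⟨M, hM⟩ := ((isCompact_closedBall s (1:ℝ)).prod hfs).exists_bound_of_continuousOn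
    (f := fun q : ℝ × V => f q.2 * ρ' q.1 q.2)
    ((hf.comp continuous_snd).mul hρ').continuousOn
  refine (hasDerivAt_integral_of_dominated_loc_of_deriv_le (F := fun s z => f z * ρ s z)
    (F' := fun s z => f z * ρ' s z) (bound := (tsupport f).indicator fun _ => M)
    (s := Metric.ball s 1) (Metric.ball_mem_nhds s one_pos) ?_ (hgi _ (hρs s)) ?_ ?_ ?_ ?_).2
  · exact Filter.Eventually.of_forall fun t => (hgi _ (hρs t)).aestronglyMeasurable
  · exact (hgi _ (hρs' s)).aestronglyMeasurable
  · refine Filter.Eventually.of_forall fun z t ht => ?_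
    by_cases hz : z ∈ tsupport f
    · rw [Set.indicator_of_mem hz]
      exact hM (t, z) ⟨Metric.ball_subset_closedBall ht, hz⟩
    · rw [Set.indicator_of_notMem hz, image_eq_zero_of_notMem_tsupport hz]; simp
  · rw [integrable_indicator_iff (isClosed_tsupport f).measurableSet]
    exact integrableOn_const hfs.measure_lt_top.ne
  · exact Filter.Eventually.of_forall fun z t _ => (hd t z).const_mul _

variable {Ω : Type} [MeasurableSpace Ω] {P : Measure Ω} [IsProbabilityMeasure P]

lemma integrable_comp_of_hasCompactSupport {y : Ω → V} (hy : Measurable y) {f : V → ℝ}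
    (hf : Continuous f) (hfs : HasCompactSupport f) : Integrable (fun ω => f (y ω)) P := by
  obtain ⟨M, hM⟩ := hf.bounded_above_of_compact_support hfs
  exact Integrable.of_bound (hf.measurable.comp hy).aestronglyMeasurable M
    (Filter.Eventually.of_forall fun ω => hM _)

lemma exists_forall_abs_integral_sub_le {Y : ℝ → Ω → V} {κ : ℝ} (hκ : 0 ≤ κ)
    (hYm : ∀ s, Measurable (Y s)) (hY : ∀ s t ω, ‖Y s ω - Y t ω‖ ≤ κ * |s - t|) {f : V → ℝ}
    (hf : ContDiff ℝ 1 f) (hfs : HasCompactSupport f) (s : ℝ) {ε : ℝ} (hε : 0 < ε) :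
    ∀ᶠ t in nhds s, |∫ ω, f (Y t ω) ∂P - ∫ ω, f (Y s ω) ∂P| ≤
      κ * (∫ ω, ‖fderiv ℝ f (Y s ω)‖ ∂P + ε) * |t - s| := by
  have hc : Continuous (fderiv ℝ f) := hf.continuous_fderiv one_ne_zero
  have hcs : HasCompactSupport (fderiv ℝ f) := hfs.fderiv ℝ
  have huc : UniformContinuous (fderiv ℝ f) := hcs.uniformContinuous_of_continuous hc
  obtain ⟨δ, hδ, hδ'⟩ := Metric.uniformContinuous_iff.1 huc ε hε
  have hev : ∀ᶠ t in nhds s, κ * |t - s| < δ := by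
    have : Continuous fun t => κ * |t - s| := by fun_prop
    have h0 := this.tendsto s
    simp only [sub_self, abs_zero, mul_zero] at h0
    exact h0.eventually (gt_mem_nhds hδ)
  filter_upwards [hev] with t ht
  have pt : ∀ ω, |f (Y t ω) - f (Y s ω)| ≤
      (‖fderiv ℝ f (Y s ω)‖ + ε) * (κ * |t - s|) := fun ω => by
    have hb : ∀ z ∈ Metric.closedBall (Y s ω) (κ * |t - s|),
        ‖fderiv ℝ f z‖ ≤ ‖fderiv ℝ f (Y s ω)‖ + ε := fun z hz => by
      have := hδ' (lt_of_le_of_lt hz ht)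
      rw [dist_eq_norm] at this
      have h2 := norm_le_norm_add_norm_sub' (fderiv ℝ f z) (fderiv ℝ f (Y s ω))
      linarith
    have h0 : 0 ≤ κ * |t - s| := by positivity
    have := (convex_closedBall (Y s ω) (κ * |t - s|)).norm_image_sub_le_of_norm_fderiv_le
      (f := f) (𝕜 := ℝ) (fun z _ => (hf.differentiable one_ne_zero) z) hb
      (Metric.mem_closedBall_self h0) (y := Y t ω)
      (by rw [Metric.mem_closedBall, dist_eq_norm]; exact hY t s ω)
    refine this.trans ?_
    exact mul_le_mul_of_nonneg_left (hY t s ω) (by positivity)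
  have i1 := fun t => integrable_comp_of_hasCompactSupport (P := P) (hYm t) hf.continuous hfs
  have i2 : Integrable (fun ω => ‖fderiv ℝ f (Y s ω)‖) P :=
    integrable_comp_of_hasCompactSupport (hYm s) hc.norm hcs.norm
  rw [← integral_sub (i1 t) (i1 s)]
  refine (abs_integral_le_integral_abs).trans ?_
  refine (integral_mono ((i1 t).sub (i1 s)).abs ((i2.add (integrable_const ε)).mul_const _)
    pt).trans_eq ?_
  simp only [Pi.add_apply]
  rw [integral_mul_const, integral_add i2 (integrable_const ε)]
  simp
  ring

/-- Derivative bound for ratios of integrals against a family of densities which is realised,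
after normalisation, by a Lipschitz family of random vectors. -/
lemma abs_cov_le_of_samples {η : Measure V} [IsFiniteMeasureOnCompacts η] {ρ ρ' : ℝ → V → ℝ}
    (hρ : Continuous (Function.uncurry ρ)) (hρ' : Continuous (Function.uncurry ρ'))
    (hd : ∀ s z, HasDerivAt (fun s => ρ s z) (ρ' s z) s) {Y : ℝ → Ω → V} {κ : ℝ} (hκ : 0 ≤ κ)
    (hYm : ∀ s, Measurable (Y s)) (hY : ∀ s t ω, ‖Y s ω - Y t ω‖ ≤ κ * |s - t|) {Z : ℝ → ℝ}
    (hZc : Continuous Z) {c : ℝ} (hc : 0 < c) (hZ : ∀ s, 0 < Z s)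
    (hrel : ∀ f : V → ℝ, Continuous f → HasCompactSupport f → (∀ z, 0 ≤ f z) → ∀ s,
      c * ∫ z, f z * ρ s z ∂η = Z s * ∫ ω, f (Y s ω) ∂P) {f g : V → ℝ}
    (hf : ContDiff ℝ 1 f) (hfs : HasCompactSupport f) (hf0 : ∀ z, 0 ≤ f z)
    (hg : ContDiff ℝ 1 g) (hgs : HasCompactSupport g) (hg0 : ∀ z, 0 ≤ g z) (s : ℝ) :
    |(∫ z, f z * ρ' s z ∂η) * (∫ z, g z * ρ s z ∂η) -
        (∫ z, f z * ρ s z ∂η) * ∫ z, g z * ρ' s z ∂η| ≤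
      κ * ((∫ z, ‖fderiv ℝ f z‖ * ρ s z ∂η) * (∫ z, g z * ρ s z ∂η) +
        (∫ z, f z * ρ s z ∂η) * ∫ z, ‖fderiv ℝ g z‖ * ρ s z ∂η) := by
  have rf := hrel f hf.continuous hfs hf0
  have rg := hrel g hg.continuous hgs hg0
  have rdf := hrel _ (hf.continuous_fderiv one_ne_zero).norm (hfs.fderiv ℝ).norm
    (fun z => norm_nonneg _) s
  have rdg := hrel _ (hg.continuous_fderiv one_ne_zero).norm (hgs.fderiv ℝ).norm
    (fun z => norm_nonneg _) s
  have df := hasDerivAt_integral_mul (η := η) hρ hρ' hd hf.continuous hfs s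
  have dg := hasDerivAt_integral_mul (η := η) hρ hρ' hd hg.continuous hgs s
  set Nf : ℝ → ℝ := fun s => ∫ z, f z * ρ s z ∂η with hNf
  set Ng : ℝ → ℝ := fun s => ∫ z, g z * ρ s z ∂η with hNg
  set ef : ℝ → ℝ := fun s => ∫ ω, f (Y s ω) ∂P with hef
  set eg : ℝ → ℝ := fun s => ∫ ω, g (Y s ω) ∂P with heg
  set Df := ∫ ω, ‖fderiv ℝ f (Y s ω)‖ ∂P
  set Dg := ∫ ω, ‖fderiv ℝ g (Y s ω)‖ ∂P
  have ef0 : 0 ≤ ef s := integral_nonneg fun ω => hf0 _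
  have eg0 : 0 ≤ eg s := integral_nonneg fun ω => hg0 _
  have hdd : HasDerivAt (fun t => c * Nf t * (c * Ng s) - c * Nf s * (c * Ng t))
      (c ^ 2 * ((∫ z, f z * ρ' s z ∂η) * Ng s - Nf s * ∫ z, g z * ρ' s z ∂η)) s :=
    (((df.const_mul c).mul_const (c * Ng s)).fun_sub ((dg.const_mul c).const_mul (c * Nf s))
      ).congr_deriv (by ring)
  have key : ∀ ε : ℝ, 0 < ε →
      |c ^ 2 * ((∫ z, f z * ρ' s z ∂η) * Ng s - Nf s * ∫ z, g z * ρ' s z ∂η)| ≤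
      Z s * Z s * (κ * ((Df + ε) * eg s + ef s * (Dg + ε))) := fun ε hε => by
    refine hdd.abs_le_of_eventually
      (Q := fun t => Z s * Z t * (κ * ((Df + ε) * eg s + ef s * (Dg + ε)))) (by fun_prop) ?_
    filter_upwards [exists_forall_abs_integral_sub_le (P := P) hκ hYm hY hf hfs s hε,
      exists_forall_abs_integral_sub_le (P := P) hκ hYm hY hg hgs s hε] with t h1 h2
    have e : c * Nf t * (c * Ng s) - c * Nf s * (c * Ng t) -
        (c * Nf s * (c * Ng s) - c * Nf s * (c * Ng s)) =
        Z s * Z t * ((ef t - ef s) * eg s - ef s * (eg t - eg s)) := by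
      rw [rf t, rg s, rf s, rg t]; ring
    rw [e, abs_mul, abs_of_pos (mul_pos (hZ s) (hZ t)), mul_assoc (Z s * Z t)]
    refine mul_le_mul_of_nonneg_left ?_ (mul_pos (hZ s) (hZ t)).le
    refine (abs_sub _ _).trans ?_
    rw [abs_mul, abs_mul, abs_of_nonneg ef0, abs_of_nonneg eg0]
    have a1 := mul_le_mul_of_nonneg_right h1 eg0
    have a2 := mul_le_mul_of_nonneg_left h2 ef0
    calc _ ≤ _ := add_le_add a1 a2
      _ = _ := by ring
  have lim : |c ^ 2 * ((∫ z, f z * ρ' s z ∂η) * Ng s - Nf s * ∫ z, g z * ρ' s z ∂η)| ≤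
      Z s * Z s * (κ * ((Df + 0) * eg s + ef s * (Dg + 0))) := by
    have hcont : Continuous fun ε : ℝ => Z s * Z s * (κ * ((Df + ε) * eg s + ef s * (Dg + ε))) := by
      fun_prop
    refine ge_of_tendsto ((hcont.tendsto 0).mono_left nhdsWithin_le_nhds)
      (x := nhdsWithin 0 (Set.Ioi 0)) ?_
    filter_upwards [self_mem_nhdsWithin] with ε hε using key ε hε
  rw [abs_mul, abs_of_pos (by positivity : 0 < c ^ 2)] at lim
  have c2 : 0 < c ^ 2 := by positivity
  refine le_of_mul_le_mul_left (lim.trans_eq ?_) c2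
  have rfs := rf s
  have rgs := rg s
  rw [add_zero, add_zero]
  calc _ = κ * ((Z s * Df) * (Z s * eg s) + (Z s * ef s) * (Z s * Dg)) := by ring
    _ = _ := by rw [← rdf, ← rdg, ← rfs, ← rgs]; ring

end Core

lemma exists_cutoff (V : Type) [NormedAddCommGroup V] [NormedSpace ℝ V] [FiniteDimensional ℝ V] :
    ∃ (C : ℝ) (χ : ℕ → V → ℝ), (∀ n, ContDiff ℝ 1 (χ n)) ∧ (∀ n, HasCompactSupport (χ n)) ∧
      (∀ n z, 0 ≤ χ n z) ∧ (∀ n z, χ n z ≤ 1) ∧ (∀ n z, ‖fderiv ℝ (χ n) z‖ ≤ C / (n + 1)) ∧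
      ∀ z, Filter.Tendsto (fun n => χ n z) Filter.atTop (nhds 1) := by
  let b : ContDiffBump (0 : V) := ⟨1, 2, one_pos, one_lt_two⟩
  have hb : ContDiff ℝ 1 (b : V → ℝ) := b.contDiff
  obtain ⟨C, hC⟩ := (hb.continuous_fderiv one_ne_zero).bounded_above_of_compact_support
    (b.hasCompactSupport.fderiv ℝ)
  have hn : ∀ n : ℕ, (0:ℝ) < ((n : ℝ) + 1)⁻¹ := fun n => by positivity
  refine ⟨C, fun n z => b (((n : ℝ) + 1)⁻¹ • z), fun n => ?_, fun n => ?_, fun n z => b.nonneg,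
    fun n z => b.le_one, fun n z => ?_, fun z => ?_⟩
  · exact hb.comp (by fun_prop)
  · exact b.hasCompactSupport.comp_smul (hn n).ne'
  · rw [fderiv_comp_smul, norm_smul, Real.norm_of_nonneg (hn n).le, div_eq_inv_mul]
    exact mul_le_mul_of_nonneg_left (hC _) (hn n).le
  · obtain ⟨N, hN⟩ := exists_nat_ge ‖z‖
    refine tendsto_const_nhds.congr' ?_
    filter_upwards [Filter.eventually_ge_atTop N] with n hnN
    refine (b.one_of_mem_closedBall ?_).symm
    rw [mem_closedBall_zero_iff, norm_smul, Real.norm_of_nonneg (hn n).le, inv_mul_le_iff₀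
      (by positivity)]
    have : (N : ℝ) ≤ n := by exact_mod_cast hnN
    show ‖z‖ ≤ (n + 1) * 1
    linarith

lemma sq_integral_le_of_sq_le_mul {V : Type} [MeasurableSpace V] {μ : Measure V} {f I d : V → ℝ}
    (hf : Integrable f μ) (hf1 : ∫ z, f z ∂μ = 1) (hI : Integrable I μ) (hf0 : ∀ z, 0 ≤ f z)
    (hI0 : ∀ z, 0 ≤ I z) (hd : Measurable d) (hd0 : ∀ z, 0 ≤ d z)
    (h : ∀ z, d z ^ 2 ≤ I z * f z) :
    Integrable d μ ∧ (∫ z, d z ∂μ) ^ 2 ≤ ∫ z, I z ∂μ := by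
  have pt : ∀ t : ℝ, ∀ z, 2 * t * d z ≤ I z + t ^ 2 * f z := fun t z => by
    have h1 := hI0 z
    have h2 : 0 ≤ t ^ 2 * f z := mul_nonneg (sq_nonneg _) (hf0 z)
    refine (abs_le_of_sq_le_sq' ?_ (add_nonneg h1 h2)).2
    have h3 := mul_le_mul_of_nonneg_left (h z) (sq_nonneg t)
    nlinarith [sq_nonneg (I z - t ^ 2 * f z)]
  have id : Integrable d μ := by
    refine (hI.add hf).mono' hd.aestronglyMeasurable (Filter.Eventually.of_forall fun z => ?_)
    rw [Real.norm_of_nonneg (hd0 z)]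
    have := pt 1 z
    have := hd0 z
    simp only [Pi.add_apply]
    linarith
  refine ⟨id, ?_⟩
  have it : ∀ t : ℝ, 2 * t * ∫ z, d z ∂μ ≤ ∫ z, I z ∂μ + t ^ 2 := fun t => by
    rw [← integral_const_mul, ← mul_one (t ^ 2), ← hf1, ← integral_const_mul,
      ← integral_add hI (hf.const_mul _)]
    exact integral_mono (id.const_mul _) (hI.add (hf.const_mul _)) (pt t)
  have := it (∫ z, d z ∂μ)
  linarith

/-- Passing from compactly supported test functions to densities of finite Fisher information. -/
lemma sq_cov_le_of_compactSupport {V : Type} [NormedAddCommGroup V] [NormedSpace ℝ V]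
    [FiniteDimensional ℝ V] [MeasurableSpace V] [BorelSpace V] {μ : Measure V}
    [IsProbabilityMeasure μ] {F : V → ℝ} {κ : ℝ} (hκ : 0 ≤ κ)
    (hcore : ∀ f g : V → ℝ, ContDiff ℝ 1 f → HasCompactSupport f → (∀ z, 0 ≤ f z) →
      ContDiff ℝ 1 g → HasCompactSupport g → (∀ z, 0 ≤ g z) →
      |(∫ z, f z * F z ∂μ) * (∫ z, g z ∂μ) - (∫ z, f z ∂μ) * ∫ z, g z * F z ∂μ| ≤
        κ * ((∫ z, ‖fderiv ℝ f z‖ ∂μ) * (∫ z, g z ∂μ) +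
          (∫ z, f z ∂μ) * ∫ z, ‖fderiv ℝ g z‖ ∂μ)) {f I : V → ℝ} (hf : ContDiff ℝ 1 f)
    (hf0 : ∀ z, 0 ≤ f z) (fi : Integrable f μ) (f1 : ∫ z, f z ∂μ = 1)
    (fFi : Integrable (fun z => f z * F z) μ) (Fi : Integrable F μ) (Ii : Integrable I μ)
    (hI0 : ∀ z, 0 ≤ I z) (hI : ∀ z, ‖fderiv ℝ f z‖ ^ 2 ≤ I z * f z) :
    (∫ z, f z * F z ∂μ - ∫ z, F z ∂μ) ^ 2 ≤ κ ^ 2 * ∫ z, I z ∂μ := by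
  obtain ⟨C, χ, hχ, hχs, χ0, χ1, dχ, χt⟩ := exists_cutoff V
  have hfd : Continuous (fderiv ℝ f) := hf.continuous_fderiv one_ne_zero
  obtain ⟨di, hD⟩ := sq_integral_le_of_sq_le_mul fi f1 Ii hf0 hI0 hfd.norm.measurable
    (fun z => norm_nonneg _) hI
  set D := ∫ z, ‖fderiv ℝ f z‖ ∂μ with hDd
  have hD0 : 0 ≤ D := integral_nonneg fun z => norm_nonneg _
  have bd : ∀ {G : V → ℝ}, Integrable G μ → ∀ n, Integrable (fun z => χ n z * G z) μ := fun hG n =>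
    hG.norm.mono' ((hχ n).continuous.aestronglyMeasurable.mul hG.aestronglyMeasurable)
      (Filter.Eventually.of_forall fun z => by
        rw [norm_mul, Real.norm_of_nonneg (χ0 n z)]
        exact mul_le_of_le_one_left (norm_nonneg _) (χ1 n z))
  have lim : ∀ {G : V → ℝ}, Integrable G μ →
      Filter.Tendsto (fun n => ∫ z, χ n z * G z ∂μ) Filter.atTop (nhds (∫ z, G z ∂μ)) := fun hG => by
    refine tendsto_integral_of_dominated_convergence _ (fun n => (bd hG n).aestronglyMeasurable)
      hG.norm (fun n => Filter.Eventually.of_forall fun z => ?_)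
      (Filter.Eventually.of_forall fun z => ?_)
    · rw [norm_mul, Real.norm_of_nonneg (χ0 n z)]
      exact mul_le_of_le_one_left (norm_nonneg _) (χ1 n z)
    · simpa using (χt z).mul_const _
  have l1 := lim fi
  have l2 := lim fFi
  have l3 := lim Fi
  have l4 := lim (integrable_const (1:ℝ))
  simp only [mul_one, integral_const, probReal_univ, smul_eq_mul] at l4
  rw [f1] at l1
  have lC : Filter.Tendsto (fun n : ℕ => C / ((n : ℝ) + 1)) Filter.atTop (nhds 0) :=
    tendsto_const_nhds.div_atTop
      (Filter.tendsto_atTop_add_const_right _ _ tendsto_natCast_atTop_atTop)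
  have ineq : ∀ n : ℕ, |(∫ z, χ n z * (f z * F z) ∂μ) * (∫ z, χ n z ∂μ) -
      (∫ z, χ n z * f z ∂μ) * ∫ z, χ n z * F z ∂μ| ≤ κ * (D + 2 * (C / ((n : ℝ) + 1))) := fun n => by
    have h := hcore (fun z => χ n z * f z) (χ n) ((hχ n).mul hf) ((hχs n).mul_right)
      (fun z => mul_nonneg (χ0 n z) (hf0 z)) (hχ n) (hχs n) (χ0 n)
    simp only [mul_assoc] at h
    refine h.trans (mul_le_mul_of_nonneg_left ?_ hκ)
    have dn : ∀ z, ‖fderiv ℝ (fun z => χ n z * f z) z‖ ≤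
        ‖fderiv ℝ f z‖ + C / ((n : ℝ) + 1) * f z := fun z => by
      rw [fderiv_fun_mul ((hχ n).differentiable one_ne_zero z)
        (hf.differentiable one_ne_zero z)]
      refine (norm_add_le _ _).trans ?_
      rw [norm_smul, norm_smul, Real.norm_of_nonneg (χ0 n z), Real.norm_of_nonneg (hf0 z)]
      refine add_le_add (mul_le_of_le_one_left (norm_nonneg _) (χ1 n z)) ?_
      rw [mul_comm]
      exact mul_le_mul_of_nonneg_right (dχ n z) (hf0 z)
    have a1 : ∫ z, ‖fderiv ℝ (fun z => χ n z * f z) z‖ ∂μ ≤ D + C / ((n : ℝ) + 1) := by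
      have ib : Integrable (fun z => ‖fderiv ℝ f z‖ + C / ((n : ℝ) + 1) * f z) μ :=
        di.add (fi.const_mul _)
      refine (integral_mono_of_nonneg (Filter.Eventually.of_forall fun z => norm_nonneg _) ib
        (Filter.Eventually.of_forall dn)).trans_eq ?_
      rw [integral_add di (fi.const_mul _), integral_const_mul, f1, mul_one]
    have a2 : ∫ z, ‖fderiv ℝ (χ n) z‖ ∂μ ≤ C / ((n : ℝ) + 1) := by
      refine (integral_mono_of_nonneg (Filter.Eventually.of_forall fun z => norm_nonneg _)
        (integrable_const _) (Filter.Eventually.of_forall (dχ n))).trans_eq ?_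
      simp
    have a3 : ∫ z, χ n z ∂μ ≤ 1 := by
      refine (integral_mono_of_nonneg (Filter.Eventually.of_forall (χ0 n))
        (integrable_const _) (Filter.Eventually.of_forall (χ1 n))).trans_eq ?_
      simp
    have a4 : ∫ z, χ n z * f z ∂μ ≤ 1 := by
      refine (integral_mono (bd fi n) fi fun z => ?_).trans_eq f1
      exact mul_le_of_le_one_left (hf0 z) (χ1 n z)
    have b1 : 0 ≤ ∫ z, ‖fderiv ℝ (fun z => χ n z * f z) z‖ ∂μ :=
      integral_nonneg fun z => norm_nonneg _
    have b2 : 0 ≤ ∫ z, ‖fderiv ℝ (χ n) z‖ ∂μ := integral_nonneg fun z => norm_nonneg _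
    have c1 := mul_le_of_le_one_right b1 a3
    have c2 := mul_le_of_le_one_left b2 a4
    linarith
  have l5 : Filter.Tendsto (fun n : ℕ => |(∫ z, χ n z * (f z * F z) ∂μ) * (∫ z, χ n z ∂μ) -
      (∫ z, χ n z * f z ∂μ) * ∫ z, χ n z * F z ∂μ|) Filter.atTop
      (nhds |(∫ z, f z * F z ∂μ) * 1 - 1 * ∫ z, F z ∂μ|) :=
    ((l2.mul l4).sub (l1.mul l3)).abs
  have l6 : Filter.Tendsto (fun n : ℕ => κ * (D + 2 * (C / ((n : ℝ) + 1)))) Filter.atTop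
      (nhds (κ * (D + 2 * 0))) := ((lC.const_mul 2).const_add D).const_mul κ
  have fin := le_of_tendsto_of_tendsto' l5 l6 ineq
  rw [mul_one, one_mul, mul_zero, add_zero] at fin
  calc (∫ z, f z * F z ∂μ - ∫ z, F z ∂μ) ^ 2 = |∫ z, f z * F z ∂μ - ∫ z, F z ∂μ| ^ 2 :=
        (sq_abs _).symm
    _ ≤ (κ * D) ^ 2 := by gcongr
    _ = κ ^ 2 * D ^ 2 := by ring
    _ ≤ _ := by gcongr

lemma integral_rel_of_samples {V : Type} [NormedAddCommGroup V] [NormedSpace ℝ V]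
    [FiniteDimensional ℝ V] [MeasurableSpace V] [BorelSpace V] (η : Measure V)
    [η.IsAddHaarMeasure] {ι : Type} [Fintype ι] (T : (V × ℝ) ≃L[ℝ] (ι → ℝ))
    (hT : ∀ z t, ∑ i, T (z, t) i = t) {p : ι → ℝ → ℝ} (hp : ∀ i, Nice (p i)) {Z : ℝ → ℝ}
    (hZ : Nice Z) {Ω : Type} [MeasurableSpace Ω] {P : Measure Ω} [IsProbabilityMeasure P]
    {X : ℝ → Ω → ι → ℝ} (hXm : ∀ s, Measurable (X s)) (hXc : ∀ ω, Continuous fun s => X s ω)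
    (hsum : ∀ s ω, ∑ i, X s ω i = s)
    (hF : ∀ F : (ι → ℝ) → ℝ≥0∞, Measurable F →
      ∫⁻ x, F x * ∏ i, ENNReal.ofReal (p i (x i)) =
        ∫⁻ s, ENNReal.ofReal (Z s) * ∫⁻ ω, F (X s ω) ∂P) :
    ∃ c : ℝ, 0 < c ∧ ∀ f : V → ℝ, Continuous f → HasCompactSupport f → (∀ z, 0 ≤ f z) → ∀ s,
      c * ∫ z, f z * ∏ i, p i (T (z, s) i) ∂η = Z s * ∫ ω, f (T.symm (X s ω)).1 ∂P := by
  have hpc := fun i => (hp i).cont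
  haveI : (Measure.map T (η.prod volume)).IsAddHaarMeasure :=
    T.isAddHaarMeasure_map (η.prod volume)
  obtain ⟨c, hc0, hct, hc⟩ : ∃ c : ℝ≥0∞, c ≠ 0 ∧ c ≠ ∞ ∧
      (volume : Measure (ι → ℝ)) = c • Measure.map T (η.prod volume) :=
    ⟨_, ENNReal.coe_ne_zero.2 (Measure.addHaarScalarFactor_pos_of_isAddHaarMeasure _ _).ne',
      ENNReal.coe_ne_top, Measure.isAddLeftInvariant_eq_smul _ _⟩
  have hT2 : ∀ x, (T.symm x).2 = ∑ i, x i := fun x => by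
    have := hT (T.symm x).1 (T.symm x).2
    rw [Prod.mk.eta, T.apply_symm_apply] at this
    exact this.symm
  refine ⟨c.toReal, ENNReal.toReal_pos hc0 hct, fun f hf hfs hf0 s => ?_⟩
  set ρ : ℝ → V → ℝ := fun s z => ∏ i, p i (T (z, s) i) with hρd
  have hρ : Continuous (Function.uncurry ρ) := by
    simp only [hρd, Function.uncurry_def]
    fun_prop
  have hρ0 : ∀ s z, 0 ≤ ρ s z := fun s z => Finset.prod_nonneg fun i _ => ((hp i).pos _).le
  have hN : Continuous fun s => ∫ z, f z * ρ s z ∂η := continuous_integral_mul hρ hf hfs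
  have hN0 : ∀ s, 0 ≤ ∫ z, f z * ρ s z ∂η := fun s =>
    integral_nonneg fun z => mul_nonneg (hf0 z) (hρ0 s z)
  have hym : ∀ s, Measurable fun ω => (T.symm (X s ω)).1 := fun s =>
    (continuous_fst.comp T.symm.continuous).measurable.comp (hXm s)
  have hE : Continuous fun s => ∫ ω, f (T.symm (X s ω)).1 ∂P := by
    obtain ⟨M, hM⟩ := hf.bounded_above_of_compact_support hfs
    refine continuous_of_dominated (bound := fun _ => M)
      (fun s => (hf.measurable.comp (hym s)).aestronglyMeasurable)
      (fun s => Filter.Eventually.of_forall fun ω => hM _) (integrable_const M)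
      (Filter.Eventually.of_forall fun ω => ?_)
    have := hXc ω
    exact hf.comp (continuous_fst.comp (T.symm.continuous.comp this))
  have hE0 : ∀ s, 0 ≤ ∫ ω, f (T.symm (X s ω)).1 ∂P := fun s => integral_nonneg fun ω => hf0 _
  have hZc := hZ.cont
  have hae : (fun s => ENNReal.ofReal (c.toReal * ∫ z, f z * ρ s z ∂η)) =ᵐ[volume]
      fun s => ENNReal.ofReal (Z s * ∫ ω, f (T.symm (X s ω)).1 ∂P) := by
    refine ae_eq_of_forall_setLIntegral_eq_of_sigmaFinite
      (continuous_const.mul hN).measurable.ennreal_ofReal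
      (hZc.mul hE).measurable.ennreal_ofReal fun S hS _ => ?_
    set F : (ι → ℝ) → ℝ≥0∞ := fun x =>
      ENNReal.ofReal (f (T.symm x).1) * S.indicator 1 (T.symm x).2 with hFd
    have mind : Measurable (S.indicator (1 : ℝ → ℝ≥0∞)) := measurable_one.indicator hS
    have mf : Measurable fun z => ENNReal.ofReal (f z) := hf.measurable.ennreal_ofReal
    have mT : Measurable T.symm := T.symm.continuous.measurable
    have hFm : Measurable F :=
      (mf.comp (measurable_fst.comp mT)).mul (mind.comp (measurable_snd.comp mT))
    have e := hF F hFm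
    have mρ : Measurable (Function.uncurry ρ) := hρ.measurable
    have e1 : ∫⁻ x, F x * ∏ i, ENNReal.ofReal (p i (x i)) =
        ∫⁻ s in S, ENNReal.ofReal (c.toReal * ∫ z, f z * ρ s z ∂η) := by
      have mq : Measurable fun q : V × ℝ => ENNReal.ofReal (f q.1) * S.indicator 1 q.2 *
          ENNReal.ofReal (ρ q.2 q.1) :=
        ((mf.comp measurable_fst).mul (mind.comp measurable_snd)).mul
          (mρ.comp measurable_swap).ennreal_ofReal
      have mp : Measurable fun x : ι → ℝ => ∏ i, ENNReal.ofReal (p i (x i)) :=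
        Finset.measurable_prod _ fun i _ =>
          ((hpc i).measurable.comp (measurable_pi_apply i)).ennreal_ofReal
      have mFp : Measurable fun x => F x * ∏ i, ENNReal.ofReal (p i (x i)) := hFm.mul mp
      rw [hc, lintegral_smul_measure, lintegral_map mFp T.continuous.measurable]
      have : ∀ q : V × ℝ, F (T q) * ∏ i, ENNReal.ofReal (p i (T q i)) =
          ENNReal.ofReal (f q.1) * S.indicator 1 q.2 * ENNReal.ofReal (ρ q.2 q.1) := fun q => by
        simp only [hFd, hρd, T.symm_apply_apply, Prod.mk.eta]
        rw [ENNReal.ofReal_prod_of_nonneg fun i _ => ((hp i).pos _).le]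
      simp only [this]
      rw [lintegral_prod_symm' _ mq, ← lintegral_indicator hS, smul_eq_mul,
        ← lintegral_const_mul _ (mq.lintegral_prod_left')]
      refine lintegral_congr fun s => ?_
      by_cases hs : s ∈ S
      · simp only [Set.indicator_of_mem hs, Pi.one_apply, mul_one]
        rw [ENNReal.ofReal_mul ENNReal.toReal_nonneg, ENNReal.ofReal_toReal hct,
          ofReal_integral_eq_lintegral_ofReal]
        · congr 1
          refine lintegral_congr fun z => ?_
          rw [ENNReal.ofReal_mul (hf0 z)]
        · exact (hf.mul (hρ.comp (Continuous.prodMk_right s))).integrable_of_hasCompactSupport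
            hfs.mul_right
        · exact Filter.Eventually.of_forall fun z => mul_nonneg (hf0 z) (hρ0 s z)
      · simp [Set.indicator_of_notMem hs]
    have e2 : ∫⁻ s, ENNReal.ofReal (Z s) * ∫⁻ ω, F (X s ω) ∂P =
        ∫⁻ s in S, ENNReal.ofReal (Z s * ∫ ω, f (T.symm (X s ω)).1 ∂P) := by
      rw [← lintegral_indicator hS]
      refine lintegral_congr fun s => ?_
      simp only [hFd, hT2, hsum]
      by_cases hs : s ∈ S
      · simp only [Set.indicator_of_mem hs, Pi.one_apply, mul_one]
        rw [ENNReal.ofReal_mul (hZ.pos s).le, ofReal_integral_eq_lintegral_ofReal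
          (integrable_comp_of_hasCompactSupport (hym s) hf hfs)
          (Filter.Eventually.of_forall fun ω => hf0 _)]
      · simp [Set.indicator_of_notMem hs]
    rw [← e1, ← e2, e]
  have heq := (Continuous.ae_eq_iff_eq volume
    (ENNReal.continuous_ofReal.comp (continuous_const.mul hN))
    (ENNReal.continuous_ofReal.comp (hZc.mul hE))).1 hae
  have := congrFun heq s
  exact (ENNReal.ofReal_eq_ofReal_iff (mul_nonneg ENNReal.toReal_nonneg (hN0 s))
    (mul_nonneg (hZ.pos s).le (hE0 s))).1 this

/-- Vectors whose coordinates sum to zero. -/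
def sumZero (n : ℕ) : Submodule ℝ (EuclideanSpace ℝ (Fin n)) where
  carrier := {x | ∑ i, x i = 0}
  add_mem' {x y} hx hy := by
    simp only [Set.mem_ofPred_eq, PiLp.add_apply, Finset.sum_add_distrib] at *
    rw [hx, hy, add_zero]
  zero_mem' := by simp
  smul_mem' c x hx := by
    simp only [Set.mem_ofPred_eq, PiLp.smul_apply, smul_eq_mul, ← Finset.mul_sum] at *
    rw [hx, mul_zero]

lemma sum_eq_zero_of_mem_sumZero {n : ℕ} (z : sumZero n) : ∑ i, (z : EuclideanSpace ℝ (Fin n)) i = 0 :=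
  z.2

/-- Splitting a vector into its projection to `sumZero n` and the sum of its coordinates. -/
def sumZeroEquiv (n : ℕ) (hn : 0 < n) : (sumZero n × ℝ) ≃L[ℝ] (Fin n → ℝ) :=
  LinearEquiv.toContinuousLinearEquiv
    { toFun := fun q i => (q.1 : EuclideanSpace ℝ (Fin n)) i + q.2 / n
      map_add' := fun q q' => by ext i; simp; ring
      map_smul' := fun c q => by ext i; simp; ring
      invFun := fun x => (⟨WithLp.toLp 2 fun i => x i - (∑ j, x j) / n, by
        have : (n : ℝ) ≠ 0 := by positivity
        show ∑ i, (x i - (∑ j, x j) / n) = 0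
        rw [Finset.sum_sub_distrib, Finset.sum_const, Finset.card_univ, Fintype.card_fin,
          nsmul_eq_mul, mul_div_cancel₀ _ this, sub_self]⟩, ∑ j, x j)
      left_inv := fun q => by
        have : (n : ℝ) ≠ 0 := by positivity
        have e : ∑ j, ((q.1 : EuclideanSpace ℝ (Fin n)) j + q.2 / n) = q.2 := by
          rw [Finset.sum_add_distrib, sum_eq_zero_of_mem_sumZero, Finset.sum_const,
            Finset.card_univ, Fintype.card_fin, nsmul_eq_mul, mul_div_cancel₀ _ this, zero_add]
        refine Prod.ext (Subtype.ext ?_) e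
        ext i
        simp only [e, add_sub_cancel_right]
      right_inv := fun x => by ext i; simp }

lemma sumZeroEquiv_apply {n : ℕ} (hn : 0 < n) (z : sumZero n) (t : ℝ) (i : Fin n) :
    sumZeroEquiv n hn (z, t) i = (z : EuclideanSpace ℝ (Fin n)) i + t / n := rfl

lemma sumZeroEquiv_symm_apply {n : ℕ} (hn : 0 < n) (x : Fin n → ℝ) (i : Fin n) :
    (((sumZeroEquiv n hn).symm x).1 : EuclideanSpace ℝ (Fin n)) i = x i - (∑ j, x j) / n := rfl

lemma sum_sumZeroEquiv {n : ℕ} (hn : 0 < n) (z : sumZero n) (t : ℝ) :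
    ∑ i, sumZeroEquiv n hn (z, t) i = t := by
  have : (n : ℝ) ≠ 0 := by positivity
  simp only [sumZeroEquiv_apply]
  rw [Finset.sum_add_distrib, sum_eq_zero_of_mem_sumZero, Finset.sum_const,
    Finset.card_univ, Fintype.card_fin, nsmul_eq_mul, mul_div_cancel₀ _ this, zero_add]

lemma finrank_sumZero {n : ℕ} (hn : 0 < n) : Module.finrank ℝ (sumZero n) + 1 = n := by
  have := (sumZeroEquiv n hn).toLinearEquiv.finrank_eq
  rwa [Module.finrank_prod, Module.finrank_self, Module.finrank_fin_fun] at this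

lemma norm_sumZeroEquiv_symm_sub_le {n : ℕ} (hn : 0 < n) {A s t : ℝ} (hA : 0 ≤ A) {x y : Fin n → ℝ}
    (hx : ∑ i, x i = s) (hy : ∑ i, y i = t) (h : ∀ i, |x i - y i| ≤ A * |s - t|) :
    ‖((sumZeroEquiv n hn).symm x).1 - ((sumZeroEquiv n hn).symm y).1‖ ≤
      √n * (A + 1) * |s - t| := by
  rw [← Submodule.norm_coe, Submodule.coe_sub, EuclideanSpace.norm_eq]
  have hn1 : (1 : ℝ) ≤ n := by exact_mod_cast hn
  have b : ∀ i, ‖((((sumZeroEquiv n hn).symm x).1 : EuclideanSpace ℝ (Fin n)) -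
      (((sumZeroEquiv n hn).symm y).1 : EuclideanSpace ℝ (Fin n))) i‖ ≤ (A + 1) * |s - t| :=
    fun i => by
    rw [PiLp.sub_apply, sumZeroEquiv_symm_apply, sumZeroEquiv_symm_apply, hx, hy, Real.norm_eq_abs]
    have e : x i - s / n - (y i - t / n) = (x i - y i) - (s - t) / n := by ring
    rw [e]
    refine (abs_sub _ _).trans ?_
    have : |(s - t) / n| ≤ |s - t| := by
      rw [abs_div, abs_of_pos (by linarith : (0:ℝ) < n)]
      exact div_le_self (abs_nonneg _) hn1
    linarith [h i]
  calc _ ≤ √(∑ i : Fin n, ((A + 1) * |s - t|) ^ 2) := by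
        refine Real.sqrt_le_sqrt (Finset.sum_le_sum fun i _ => ?_)
        exact pow_le_pow_left₀ (norm_nonneg _) (b i) 2
    _ = √n * (A + 1) * |s - t| := by
        rw [Finset.sum_const, Finset.card_univ, Fintype.card_fin, nsmul_eq_mul,
          Real.sqrt_mul (by linarith), Real.sqrt_sq (by positivity), mul_assoc]

/-- The parametrisation of the hyperplane of mean `m` by `sumZero n`. -/
def hyperplaneParam (n : ℕ) (m : ℝ) (z : sumZero n) : EuclideanSpace ℝ (Fin n) :=
  (z : EuclideanSpace ℝ (Fin n)) + WithLp.toLp 2 (fun _ : Fin n => m)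

lemma hyperplaneParam_apply {n : ℕ} (m : ℝ) (z : sumZero n) (i : Fin n) :
    hyperplaneParam n m z i = (z : EuclideanSpace ℝ (Fin n)) i + m := rfl

lemma isometry_hyperplaneParam (n : ℕ) (m : ℝ) : Isometry (hyperplaneParam n m) :=
  Isometry.of_dist_eq fun z w => by
    unfold hyperplaneParam
    rw [dist_add_right, Subtype.dist_eq]

lemma range_hyperplaneParam (n : ℕ) (m : ℝ) :
    Set.range (hyperplaneParam n m) = {x | ∑ i, x i = (n : ℝ) * m} := by
  ext x
  constructor
  · rintro ⟨z, rfl⟩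
    simp only [Set.mem_ofPred_eq, hyperplaneParam_apply]
    rw [Finset.sum_add_distrib, sum_eq_zero_of_mem_sumZero, Finset.sum_const, Finset.card_univ,
      Fintype.card_fin, nsmul_eq_mul, zero_add]
  · intro hx
    refine ⟨⟨x - WithLp.toLp 2 (fun _ : Fin n => m), ?_⟩, sub_add_cancel x _⟩
    show ∑ i, (x i - m) = 0
    rw [Finset.sum_sub_distrib, Finset.sum_const, Finset.card_univ, Fintype.card_fin, nsmul_eq_mul,
      sub_eq_zero]
    exact hx

lemma withDensity_map_eq {α β : Type} [MeasurableSpace α] [MeasurableSpace β] {μ : Measure α}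
    {e : α → β} (he : Measurable e) {g : β → ℝ≥0∞} (hg : Measurable g) :
    (Measure.map e μ).withDensity g = Measure.map e (μ.withDensity (g ∘ e)) := by
  ext S hS
  rw [withDensity_apply _ hS, Measure.map_apply he hS, withDensity_apply _ (he hS),
    setLIntegral_map hS hg he]
  rfl

lemma sq_norm_fderiv_hyperplaneParam_le {n : ℕ} (m : ℝ) {f : EuclideanSpace ℝ (Fin n) → ℝ}
    (hf : Differentiable ℝ f) (hf0 : ∀ x, 0 ≤ f x) (z : sumZero n) :
    ‖fderiv ℝ (fun z => f (hyperplaneParam n m z)) z‖ ^ 2 ≤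
      fisherX n f (hyperplaneParam n m z) * f (hyperplaneParam n m z) := by
  have hd : HasFDerivAt (hyperplaneParam n m) (sumZero n).subtypeL z :=
    (sumZero n).subtypeL.hasFDerivAt.add_const (WithLp.toLp 2 (fun _ : Fin n => m))
  have hfd := (hf (hyperplaneParam n m z)).hasFDerivAt.comp z hd
  have e : fderiv ℝ (fun z => f (hyperplaneParam n m z)) z =
      (fderiv ℝ f (hyperplaneParam n m z)).comp (sumZero n).subtypeL := hfd.fderiv
  rw [e]
  set x := hyperplaneParam n m z
  unfold fisherX
  split_ifs with h0
  · have hmin : IsLocalMin f x := Filter.Eventually.of_forall fun y => by rw [h0]; exact hf0 y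
    rw [hmin.fderiv_eq_zero, ContinuousLinearMap.zero_comp, ContinuousLinearMap.opNorm_zero]
    simp
  · rw [div_mul_cancel₀ _ h0]
    set G : EuclideanSpace ℝ (Fin n) :=
      WithLp.toLp 2 fun i => gradient f x i - (∑ j, gradient f x j) / n with hG
    have hGn : ‖G‖ ^ 2 = ∑ i, (gradient f x i - (∑ j, gradient f x j) / (n : ℝ)) ^ 2 := by
      rw [EuclideanSpace.norm_sq_eq]
      simp [hG]
    rw [← hGn]
    refine pow_le_pow_left₀ (ContinuousLinearMap.opNorm_nonneg _) ?_ 2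
    refine ContinuousLinearMap.opNorm_le_bound _ (norm_nonneg _) fun w => ?_
    have e1 : ((fderiv ℝ f x).comp (sumZero n).subtypeL) w = inner ℝ G (w : EuclideanSpace ℝ (Fin n)) := by
      have : inner ℝ (gradient f x) (w : EuclideanSpace ℝ (Fin n)) = fderiv ℝ f x w := by
        unfold gradient
        rw [InnerProductSpace.toDual_symm_apply]
      rw [ContinuousLinearMap.comp_apply, Submodule.subtypeL_apply, ← this]
      simp only [PiLp.inner_apply, RCLike.inner_apply, conj_trivial, hG]
      simp only [mul_sub, Finset.sum_sub_distrib, ← Finset.sum_mul, sum_eq_zero_of_mem_sumZero,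
        zero_mul, sub_zero]
    rw [e1]
    exact norm_inner_le_norm G (w : EuclideanSpace ℝ (Fin n))

/-- Derivative of the product density along the diagonal direction. -/
lemma hasDerivAt_prod_exp {n : ℕ} (hn : 0 < n) {ψ ψ' : ℝ → ℝ} (hd : ∀ x, HasDerivAt ψ (ψ' x) x)
    (a : Fin n → ℝ) (s : ℝ) (z : sumZero n) :
    HasDerivAt (fun s => ∏ i, exp (-(ψ (sumZeroEquiv n hn (z, s) i) +
        a i * sumZeroEquiv n hn (z, s) i)))
      (-((∏ i, exp (-(ψ (sumZeroEquiv n hn (z, s) i) + a i * sumZeroEquiv n hn (z, s) i))) *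
        ((1 / n) * ∑ i, (ψ' (sumZeroEquiv n hn (z, s) i) + a i)))) s := by
  simp only [← Real.exp_sum]
  have h1 : ∀ i, HasDerivAt (fun s => sumZeroEquiv n hn (z, s) i) (1 / (n : ℝ)) s := fun i => by
    simp only [sumZeroEquiv_apply]
    exact ((hasDerivAt_id s).div_const _).const_add _
  have h2 : ∀ i ∈ Finset.univ, HasDerivAt (fun s => -(ψ (sumZeroEquiv n hn (z, s) i) +
      a i * sumZeroEquiv n hn (z, s) i))
      (-(ψ' (sumZeroEquiv n hn (z, s) i) * (1 / n) + a i * (1 / n))) s := fun i _ =>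
    (((hd _).comp s (h1 i)).add ((h1 i).const_mul _)).neg
  refine (HasDerivAt.fun_sum h2).exp.congr_deriv ?_
  rw [← mul_neg]
  congr 1
  rw [Finset.mul_sum, ← Finset.sum_neg_distrib]
  exact Finset.sum_congr rfl fun i _ => by ring

/-- Covariance estimate against compactly supported functions on the hyperplane. -/
lemma abs_cov_le_sumZero {n : ℕ} (hn : 0 < n) {ψ ψ' : ℝ → ℝ} (hd : ∀ x, HasDerivAt ψ (ψ' x) x)
    (hc' : Continuous ψ') {a : Fin n → ℝ} (hp : ∀ i, Nice fun x => exp (-(ψ x + a i * x)))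
    {A : ℝ} (hA : 0 ≤ A) {Z : ℝ → ℝ} (hZ : Nice Z)
    (hS : Samples (fun i x => exp (-(ψ x + a i * x))) Z A) (m : ℝ) (η : Measure (sumZero n))
    [η.IsAddHaarMeasure] {μ : Measure (sumZero n)} {q : ℝ} (hq : 0 ≤ q)
    (hμ : ∀ u : sumZero n → ℝ, ∫ z, u z ∂μ = q * ∫ z, u z *
      ∏ i, exp (-(ψ (hyperplaneParam n m z i) + a i * hyperplaneParam n m z i)) ∂η)
    {f g : sumZero n → ℝ} (hf : ContDiff ℝ 1 f) (hfs : HasCompactSupport f) (hf0 : ∀ z, 0 ≤ f z)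
    (hg : ContDiff ℝ 1 g) (hgs : HasCompactSupport g) (hg0 : ∀ z, 0 ≤ g z) :
    |(∫ z, f z * ((1 / n) * ∑ i, (ψ' (hyperplaneParam n m z i) + a i)) ∂μ) * (∫ z, g z ∂μ) -
        (∫ z, f z ∂μ) * ∫ z, g z * ((1 / n) * ∑ i, (ψ' (hyperplaneParam n m z i) + a i)) ∂μ| ≤
      (√n * (A + 1)) * ((∫ z, ‖fderiv ℝ f z‖ ∂μ) * (∫ z, g z ∂μ) +
        (∫ z, f z ∂μ) * ∫ z, ‖fderiv ℝ g z‖ ∂μ) := by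
  obtain ⟨Ω, mΩ, P, hP, X, hXm, hXL, hXs, hXF⟩ := hS
  have hψc : Continuous ψ := continuous_iff_continuousAt.2 fun x => (hd x).continuousAt
  have hXc : ∀ ω, Continuous fun s => X s ω := fun ω => continuous_pi fun i => by
    refine (LipschitzWith.of_dist_le_mul (K := ⟨A, hA⟩) fun s t => ?_).continuous
    rw [Real.dist_eq, Real.dist_eq]
    exact hXL s t ω i
  obtain ⟨c, hc, hrel⟩ := integral_rel_of_samples η (sumZeroEquiv n hn) (sum_sumZeroEquiv hn) hp hZ
    hXm hXc hXs hXF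
  have hTc : ∀ i, Continuous fun w : ℝ × sumZero n => sumZeroEquiv n hn (w.2, w.1) i := fun i =>
    (continuous_apply i).comp ((sumZeroEquiv n hn).continuous.comp continuous_swap)
  have hρ : Continuous (Function.uncurry fun (s : ℝ) (z : sumZero n) =>
      ∏ i, exp (-(ψ (sumZeroEquiv n hn (z, s) i) + a i * sumZeroEquiv n hn (z, s) i))) :=
    continuous_finsetProd _ fun i _ =>
      ((hψc.comp (hTc i)).add (continuous_const.mul (hTc i))).neg.rexp
  have hρ' : Continuous (Function.uncurry fun (s : ℝ) (z : sumZero n) =>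
      -((∏ i, exp (-(ψ (sumZeroEquiv n hn (z, s) i) + a i * sumZeroEquiv n hn (z, s) i))) *
        ((1 / n) * ∑ i, (ψ' (sumZeroEquiv n hn (z, s) i) + a i)))) :=
    (hρ.mul (continuous_const.mul (continuous_finsetSum _ fun i _ =>
      (hc'.comp (hTc i)).add continuous_const))).neg
  have key := abs_cov_le_of_samples hρ hρ' (fun s z => hasDerivAt_prod_exp hn hd a s z)
    (Y := fun s ω => ((sumZeroEquiv n hn).symm (X s ω)).1) (κ := √n * (A + 1)) (by positivity)
    (fun s => (continuous_fst.comp (sumZeroEquiv n hn).symm.continuous).measurable.comp (hXm s))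
    (fun s t ω => norm_sumZeroEquiv_symm_sub_le hn hA (hXs s ω) (hXs t ω) (hXL s t ω))
    hZ.cont hc hZ.pos hrel hf hfs hf0 hg hgs hg0 (n * m)
  have hT : ∀ z i, sumZeroEquiv n hn (z, n * m) i = hyperplaneParam n m z i := fun z i => by
    have : (n : ℝ) ≠ 0 := by positivity
    rw [sumZeroEquiv_apply, hyperplaneParam_apply, mul_div_cancel_left₀ _ this]
  simp only [hT] at key
  have e : ∀ u : sumZero n → ℝ,
      ∫ z, u z * ((1 / n) * ∑ i, (ψ' (hyperplaneParam n m z i) + a i)) ∂μ =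
      -(q * ∫ z, u z * -((∏ i, exp (-(ψ (hyperplaneParam n m z i) +
        a i * hyperplaneParam n m z i))) *
          ((1 / n) * ∑ i, (ψ' (hyperplaneParam n m z i) + a i))) ∂η) := fun u => by
    rw [hμ, ← mul_neg, ← integral_neg]
    congr 2
    ext z
    ring
  rw [e, e, hμ f, hμ g, hμ (fun z => ‖fderiv ℝ f z‖), hμ (fun z => ‖fderiv ℝ g z‖)]
  refine le_trans (le_of_eq ?_) ((mul_le_mul_of_nonneg_left key (sq_nonneg q)).trans
    (le_of_eq (by ring)))
  rw [← abs_of_nonneg (sq_nonneg q), ← abs_mul, ← abs_neg]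
  congr 1
  ring

/-- The canonical ensemble in terms of Hausdorff measure on the space `sumZero n`. -/
lemma canonEns_eq_map {n : ℕ} (hn : 0 < n) {ψ : ℝ → ℝ} (hψ : Continuous ψ) (a : Fin n → ℝ) (m : ℝ)
    {ν : Measure (sumZero n)} (hν : ν = (μH[(n : ℝ) - 1]).withDensity fun z => ENNReal.ofReal
      (∏ i, exp (-(ψ (hyperplaneParam n m z i) + a i * hyperplaneParam n m z i)))) :
    canonEns ψ n a m = Measure.map (hyperplaneParam n m) ((ν Set.univ)⁻¹ • ν) := by
  have hn1 : (1 : ℝ) ≤ n := by exact_mod_cast hn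
  have hi := isometry_hyperplaneParam n m
  have hm : Measurable (hyperplaneParam n m) := hi.continuous.measurable
  have hH := hi.map_hausdorffMeasure (d := (n : ℝ) - 1) (Or.inl (by linarith))
  rw [range_hyperplaneParam] at hH
  have hw : Measurable fun x : EuclideanSpace ℝ (Fin n) =>
      ENNReal.ofReal (Real.exp (-(∑ i, (ψ (x i) + a i * x i)))) := by
    refine (Continuous.measurable ?_).ennreal_ofReal
    fun_prop
  unfold canonEns
  simp only
  rw [← hH, withDensity_map_eq hm hw]
  have e : (μH[(n : ℝ) - 1]).withDensity ((fun x : EuclideanSpace ℝ (Fin n) =>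
      ENNReal.ofReal (Real.exp (-(∑ i, (ψ (x i) + a i * x i))))) ∘ hyperplaneParam n m) = ν := by
    rw [hν]
    congr 1
    ext z
    rw [Function.comp_apply, ← Real.exp_sum, Finset.sum_neg_distrib]
  rw [e, Measure.map_apply hm MeasurableSet.univ, Set.preimage_univ, Measure.map_smul]

/-- Covariance estimate for the canonical ensemble, given a Lipschitz family of samples. -/
lemma sq_covFn_canonEns_le {n : ℕ} (hn : 0 < n) {ψ ψ' : ℝ → ℝ} (hd : ∀ x, HasDerivAt ψ (ψ' x) x)
    (hc' : Continuous ψ') {a : Fin n → ℝ} (hp : ∀ i, Nice fun x => exp (-(ψ x + a i * x)))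
    {A : ℝ} (hA : 0 ≤ A) {Z : ℝ → ℝ} (hZ : Nice Z)
    (hS : Samples (fun i x => exp (-(ψ x + a i * x))) Z A) (m : ℝ)
    {f : EuclideanSpace ℝ (Fin n) → ℝ} (hf : ContDiff ℝ 1 f) (hf0 : ∀ x, 0 ≤ f x)
    (fi : Integrable f (canonEns ψ n a m)) (f1 : ∫ x, f x ∂(canonEns ψ n a m) = 1)
    (fFi : Integrable (fun x => f x * ((1 / (n : ℝ)) * ∑ i, ψ' (x i))) (canonEns ψ n a m))
    (Fi : Integrable (fun x => (1 / (n : ℝ)) * ∑ i, ψ' (x i)) (canonEns ψ n a m))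
    (Ii : Integrable (fisherX n f) (canonEns ψ n a m)) :
    (covFn (canonEns ψ n a m) f (fun x => (1 / (n : ℝ)) * ∑ i, ψ' (x i))) ^ 2
      ≤ (A + 1) ^ 2 * n * ∫ x, fisherX n f x ∂(canonEns ψ n a m) := by
  have hψc : Continuous ψ := continuous_iff_continuousAt.2 fun x => (hd x).continuousAt
  have hιc : Continuous (hyperplaneParam n m) := (isometry_hyperplaneParam n m).continuous
  have hιi : ∀ i, Continuous fun z => hyperplaneParam n m z i := fun i =>
    (EuclideanSpace.proj (𝕜 := ℝ) i).continuous.comp hιc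
  have hem : MeasurableEmbedding (hyperplaneParam n m) :=
    (isometry_hyperplaneParam n m).isClosedEmbedding.measurableEmbedding
  have hrank : (n : ℝ) - 1 = (Module.finrank ℝ (sumZero n) : ℝ) := by
    have := finrank_sumZero hn
    rw [sub_eq_iff_eq_add]
    exact_mod_cast this.symm
  set η : Measure (sumZero n) := μH[(n : ℝ) - 1] with hη
  haveI : η.IsAddHaarMeasure := by
    rw [hη, hrank]
    exact isAddHaarMeasure_hausdorffMeasure
  have hw : Measurable fun z => ENNReal.ofReal
      (∏ i, exp (-(ψ (hyperplaneParam n m z i) + a i * hyperplaneParam n m z i))) := by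
    refine (Continuous.measurable (continuous_finsetProd _ fun i _ => ?_)).ennreal_ofReal
    exact ((hψc.comp (hιi i)).add (continuous_const.mul (hιi i))).neg.rexp
  set ν : Measure (sumZero n) := η.withDensity fun z => ENNReal.ofReal
      (∏ i, exp (-(ψ (hyperplaneParam n m z i) + a i * hyperplaneParam n m z i))) with hν
  set μ : Measure (sumZero n) := (ν Set.univ)⁻¹ • ν with hμd
  have hmap := canonEns_eq_map hn hψc a m hν
  rw [← hμd] at hmap
  rw [hmap] at fi f1 fFi Fi Ii ⊢
  rw [hem.integral_map] at f1
  rw [hem.integrable_map_iff] at fi fFi Fi Ii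
  have hν0 : ν Set.univ ≠ 0 := fun h => by
    rw [hμd, Measure.measure_univ_eq_zero.1 h, smul_zero, integral_zero_measure] at f1
    exact zero_ne_one f1
  have hνt : ν Set.univ ≠ ∞ := fun h => by
    rw [hμd, h, ENNReal.inv_top, zero_smul, integral_zero_measure] at f1
    exact zero_ne_one f1
  haveI : IsProbabilityMeasure μ := ⟨by
    rw [hμd, Measure.smul_apply, smul_eq_mul, ENNReal.inv_mul_cancel hν0 hνt]⟩
  have hμ : ∀ u : sumZero n → ℝ, ∫ z, u z ∂μ = ((ν Set.univ)⁻¹).toReal * ∫ z, u z *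
      ∏ i, exp (-(ψ (hyperplaneParam n m z i) + a i * hyperplaneParam n m z i)) ∂η := fun u => by
    rw [hμd, integral_smul_measure, smul_eq_mul, hν,
      integral_withDensity_eq_integral_toReal_smul hw (Filter.Eventually.of_forall fun _ =>
        ENNReal.ofReal_lt_top)]
    congr 1
    refine integral_congr_ae (Filter.Eventually.of_forall fun z => ?_)
    simp only
    rw [ENNReal.toReal_ofReal (Finset.prod_nonneg fun i _ => (exp_pos _).le), smul_eq_mul, mul_comm]
  have hFe : (fun z => (1 / (n : ℝ)) * ∑ i, (ψ' (hyperplaneParam n m z i) + a i)) =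
      fun z => (1 / (n : ℝ)) * ∑ i, ψ' (hyperplaneParam n m z i) + (1 / (n : ℝ)) * ∑ i, a i := by
    ext z
    rw [Finset.sum_add_distrib, mul_add]
  have Fi' : Integrable (fun z => (1 / (n : ℝ)) * ∑ i, (ψ' (hyperplaneParam n m z i) + a i)) μ := by
    rw [hFe]
    exact Fi.add (integrable_const _)
  have hfFe : (fun z => f (hyperplaneParam n m z) *
      ((1 / (n : ℝ)) * ∑ i, (ψ' (hyperplaneParam n m z i) + a i))) =
      fun z => f (hyperplaneParam n m z) * ((1 / (n : ℝ)) * ∑ i, ψ' (hyperplaneParam n m z i)) +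
        f (hyperplaneParam n m z) * ((1 / (n : ℝ)) * ∑ i, a i) := by
    ext z
    rw [Finset.sum_add_distrib, mul_add, mul_add]
  have fFi' : Integrable (fun z => f (hyperplaneParam n m z) *
      ((1 / (n : ℝ)) * ∑ i, (ψ' (hyperplaneParam n m z i) + a i))) μ := by
    rw [hfFe]
    exact fFi.add (fi.mul_const _)
  have hιd : ContDiff ℝ 1 (hyperplaneParam n m) :=
    (sumZero n).subtypeL.contDiff.add contDiff_const
  have hF0 : ∀ x, 0 ≤ fisherX n f x := fun x => by
    unfold fisherX
    split_ifs
    · exact le_rfl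
    · exact div_nonneg (Finset.sum_nonneg fun i _ => sq_nonneg _) (hf0 x)
  have key := sq_cov_le_of_compactSupport (μ := μ) (κ := √n * (A + 1)) (by positivity)
    (fun u v hu hus hu0 hv hvs hv0 => abs_cov_le_sumZero hn hd hc' hp hA hZ hS m η
      ENNReal.toReal_nonneg hμ hu hus hu0 hv hvs hv0)
    (f := fun z => f (hyperplaneParam n m z)) (I := fun z => fisherX n f (hyperplaneParam n m z))
    (hf.comp hιd) (fun z => hf0 _) fi f1 fFi' Fi' Ii (fun z => hF0 _)
    (fun z => sq_norm_fderiv_hyperplaneParam_le m (hf.differentiable one_ne_zero) hf0 z)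
  have e1 : ∫ z, f (hyperplaneParam n m z) *
      ((1 / (n : ℝ)) * ∑ i, (ψ' (hyperplaneParam n m z i) + a i)) ∂μ =
      ∫ z, f (hyperplaneParam n m z) * ((1 / (n : ℝ)) * ∑ i, ψ' (hyperplaneParam n m z i)) ∂μ +
        (1 / (n : ℝ)) * ∑ i, a i := by
    rw [hfFe]
    refine (integral_add fFi (fi.mul_const _)).trans ?_
    congr 1
    refine (integral_mul_const _ _).trans ?_
    simp only [Function.comp_apply]
    rw [f1, one_mul]
  have e2 : ∫ z, (1 / (n : ℝ)) * ∑ i, (ψ' (hyperplaneParam n m z i) + a i) ∂μ =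
      ∫ z, (1 / (n : ℝ)) * ∑ i, ψ' (hyperplaneParam n m z i) ∂μ + (1 / (n : ℝ)) * ∑ i, a i := by
    rw [hFe]
    refine (integral_add Fi (integrable_const _)).trans ?_
    rw [integral_const, probReal_univ, one_smul]
    rfl
  rw [e1, e2, add_sub_add_right_eq_sub, mul_pow, Real.sq_sqrt (Nat.cast_nonneg n)] at key
  unfold covFn
  rw [hem.integral_map, hem.integral_map, hem.integral_map, hem.integral_map, f1, one_mul]
  exact key.trans (le_of_eq (by ring))

/-- Twice differentiable uniformly convex functions are convex potentials. -/
lemma convPot_of_le_deriv_deriv {lam : ℝ} {φ : ℝ → ℝ} (hlam : 0 < lam) (hφ : ContDiff ℝ 2 φ)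
    (h : ∀ x, lam ≤ _root_.deriv (_root_.deriv φ) x) : ConvPot lam φ (_root_.deriv φ) where
  lam_pos := hlam
  deriv x := (hφ.differentiable two_ne_zero x).hasDerivAt
  cont := hφ.continuous_deriv one_le_two
  mono x y hxy := by
    have hd : Differentiable ℝ (_root_.deriv φ) :=
      ((contDiff_succ_iff_deriv (n := 1)).1 hφ).2.2.differentiable one_ne_zero
    exact mul_sub_le_image_sub_of_le_deriv hd h hxy

/-- Covariance estimate for the canonical ensemble with perturbed strictly
convex single-site potential: there is `C₀` depending only on `ψ` and `L` such that
`|cov(f, (1/K)∑ψ'(xᵢ))|² ≤ C₀ K ∫ |∇f|²/f dμ_{K,a,m}` for all probability densities `f`. -/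
theorem statement3
    (ψ ψc δψ : ℝ → ℝ) (lam0 B L : ℝ)
    (hlam0 : 0 < lam0) (hL : 0 < L)
    (hψ : ContDiff ℝ 2 ψ) (hψc : ContDiff ℝ 2 ψc) (hδψ : ContDiff ℝ 1 δψ)
    (hsplit : ∀ x, ψ x = ψc x + δψ x)
    (hconv : ∀ x, lam0 ≤ deriv (deriv ψc) x)
    (hbnd : ∀ x, |δψ x| + |deriv δψ x| ≤ B) :
    ∃ C₀ : ℝ, 0 < C₀ ∧ ∀ (K : ℕ) (m : ℝ) (a : Fin K → ℝ), (∀ i, |a i| ≤ L) →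
      ∀ f : EuclideanSpace ℝ (Fin K) → ℝ, ContDiff ℝ (⊤ : ℕ∞) f → (∀ x, 0 ≤ f x) →
        Integrable f (canonEns ψ K a m) →
        (∫ x, f x ∂(canonEns ψ K a m)) = 1 →
        Integrable (fun x => f x * ((1 / (K : ℝ)) * ∑ i, deriv ψ (x i))) (canonEns ψ K a m) →
        Integrable (fun x => (1 / (K : ℝ)) * ∑ i, deriv ψ (x i)) (canonEns ψ K a m) →
        Integrable (fisherX K f) (canonEns ψ K a m) →
        (covFn (canonEns ψ K a m) f (fun x => (1 / (K : ℝ)) * ∑ i, deriv ψ (x i))) ^ 2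
          ≤ C₀ * K * ∫ x, fisherX K f x ∂(canonEns ψ K a m) := by
  have hδd : ∀ x, deriv ψ x - deriv ψc x = deriv δψ x := fun x => by
    have h1 := (hψc.differentiable two_ne_zero x).hasDerivAt.add
      (hδψ.differentiable one_ne_zero x).hasDerivAt
    have h2 : ψ = ψc + δψ := funext hsplit
    rw [h2, h1.deriv, add_sub_cancel_left]
  have hP : PertPot lam0 B ψc (deriv ψc) ψ (deriv ψ) :=
    { conv := convPot_of_le_deriv_deriv hlam0 hψc hconv
      deriv := fun x => (hψ.differentiable two_ne_zero x).hasDerivAt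
      cont := hψ.continuous_deriv one_le_two
      close := fun x => by
        rw [hsplit, add_sub_cancel_left]
        linarith [hbnd x, abs_nonneg (deriv δψ x)]
      close' := fun x => by
        rw [hδd]
        linarith [hbnd x, abs_nonneg (δψ x)] }
  have hB : 0 ≤ B := (add_nonneg (abs_nonneg _) (abs_nonneg _)).trans (hbnd 0)
  obtain ⟨A, hA, hS⟩ := exists_samples_uniform L hlam0 hB hP
  refine ⟨(A + 1) ^ 2, by positivity, fun K m a ha f hf hf0 fi f1 fFi Fi Ii => ?_⟩
  rcases Nat.eq_zero_or_pos K with rfl | hK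
  · simp [covFn]
  obtain ⟨Z, hZ, hSZ⟩ := hS K hK a ha
  exact sq_covFn_canonEns_le hK hP.deriv hP.cont (fun i => (hP.tilt (a i)).nice) hA hZ hSZ m
    (hf.of_le (by exact_mod_cast le_top)) hf0 fi f1 fFi Fi Ii
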